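/- Let k >= 1 be an integer, ell an integer with 0 <= ell <= k, r an integer, and q real with 0 < q < 1. Define B = sum_{j in Z} q^{j((2k+3)j+2ell+1)/2} ( V_{r-ell-(2k+3)j}(q) - V_{r+ell+1+(2k+3)j}(q) ); S = (q;q)_inf * sum q^{L(L+r)/k + (r-ell-n_0)(r+ell+n_0)/(4k) + C(n_0+1,2) + n C^{-1}(n - n_0 e_1 - e_ell)} / ((q;q)_L (q;q)_{L+r} (q;q)_{n_0}) * prod_{i=1}^{k-1} [n_i+m_i choose n_i]_q, where the sum is over integers L, n_0, ..., n_{k-1} >= 0 satisfying 2L + r + ell + n_0 == 2*sum_{i=1}^{k-1} i n_i (mod 2k) (equivalently (2L+r+ell+n_0)/(2k) + (C^{-1}n)_1 is an integer), n = (n_1,...,n_{k-1}), and m = C^{-1}[(2L+r+n_0) e_1 + e_ell - 2n] (whose entries are integers under the congruence); F = sum q^{(r-ell-n_0)(r+ell+n_0)/(4k) + C(n_0+1,2) + n C^{-1}(n - n_0 e_1 - e_ell)} / ((q;q)_{n_0} (q;q)_{n_1} ... (q;q)_{n_{k-1}}), where the sum is over integers n_0, ..., n_{k-1} >= 0 satisfying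 r + ell + n_0 == 2*sum_{i=1}^{k-1} i n_i (mod 2k). Then B = S = F. -/

import Mathlib

open scoped BigOperators

noncomputable section

/-- Finite q-Pochhammer symbol `(a;q)_n`. -/
def qP (q a : ℝ) (n : ℕ) : ℝ := ∏ m ∈ Finset.range n, (1 - a * q ^ m)

/-- Infinite q-Pochhammer symbol `(a;q)_∞`. -/
def qPInf (q a : ℝ) : ℝ := ∏' m : ℕ, (1 - a * q ^ m)

/-- `1/(q;q)_n` for `n : ℤ`, equal to `0` for negative `n`. -/
def invQ (q : ℝ) (n : ℤ) : ℝ := if 0 ≤ n then (qP q q n.toNat)⁻¹ else 0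

/-- `C(n,2) = n(n-1)/2` for `n : ℤ` (exact integer division). -/
def ch2 (n : ℤ) : ℤ := n * (n - 1) / 2

/-- Graded parafermion Verma character `V_t(q)`. -/
def V (q : ℝ) (t : ℤ) : ℝ :=
  (qPInf q q)⁻¹ * ∑' ij : ℕ × ℕ,
    q ^ (((ch2 (2 * (ij.2 : ℤ) - 2 * (ij.1 : ℤ) - t) + (ij.2 : ℤ) : ℤ) : ℝ)) *
      ((qP q q ij.1)⁻¹ * (qP q q ij.2)⁻¹)

/-- Entry `(C⁻¹)_{i+1,j+1}` of the inverse A_{k-1} Cartan matrix (0-based indices). -/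
def cinv (k i j : ℕ) : ℚ :=
  (min (i + 1) (j + 1) : ℚ) - (((i : ℚ) + 1) * ((j : ℚ) + 1)) / (k : ℚ)

/-- Quadratic form `w C⁻¹ v`. -/
def quad (k : ℕ) (w v : Fin (k - 1) → ℤ) : ℚ :=
  ∑ i : Fin (k-1), ∑ j : Fin (k-1), (w i : ℚ) * cinv k (i : ℕ) (j : ℕ) * (v j : ℚ)

/-- `i`-th entry of `C⁻¹ v`. -/
def mvec (k : ℕ) (v : Fin (k - 1) → ℤ) (i : Fin (k - 1)) : ℚ :=
  ∑ j : Fin (k-1), cinv k (i : ℕ) (j : ℕ) * (v j : ℚ)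

/-- The unit vector `e_l` of `ℤ^{k-1}` (1-based label; `e_0 = e_k = 0`). -/
def eV (k : ℕ) (l : ℤ) : Fin (k - 1) → ℤ := fun i => if (i : ℤ) + 1 = l then 1 else 0

/-- q-binomial coefficient with rational arguments: it is
`(q;q)_a / ((q;q)_b (q;q)_{a-b})` when `a, b` are integers with `0 ≤ b ≤ a`, and `0` otherwise. -/
def qBinQ (q : ℝ) (a b : ℚ) : ℝ :=
  if a.den = 1 ∧ b.den = 1 ∧ 0 ≤ b ∧ b ≤ a then
    qP q q a.num.toNat * ((qP q q b.num.toNat)⁻¹ * (qP q q (a.num - b.num).toNat)⁻¹)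
  else 0

section
namespace GP
open Filter Topology

theorem qP_pos {q : ℝ} [hq : Fact (0 < q ∧ q < 1)] (n : ℕ) : 0 < qP q q n := by
  obtain ⟨h0, h1⟩ := hq.out
  unfold qP
  apply Finset.prod_pos
  intro m _
  have : q * q ^ m < 1 := by
    have := pow_le_one₀ (n := m) h0.le h1.le
    nlinarith
  linarith

theorem invQ_nat {q : ℝ} (n : ℕ) : invQ q (n : ℤ) = (qP q q n)⁻¹ := by
  simp [invQ]

theorem invQ_neg {q : ℝ} {n : ℤ} (h : n < 0) : invQ q n = 0 := by
  simp [invQ, not_le.mpr h]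

theorem invQ_zero {q : ℝ} : invQ q 0 = 1 := by
  simp [invQ, qP]

theorem invQ_nonneg {q : ℝ} [hq : Fact (0 < q ∧ q < 1)] (n : ℤ) : 0 ≤ invQ q n := by
  unfold invQ
  split_ifs
  · exact (inv_pos.mpr (qP_pos _)).le
  · exact le_rfl

theorem invQ_pos {q : ℝ} [hq : Fact (0 < q ∧ q < 1)] (n : ℕ) : 0 < invQ q (n : ℤ) := by
  rw [invQ_nat]; exact (inv_pos.mpr (qP_pos _))

theorem invQ_pos' {q : ℝ} [hq : Fact (0 < q ∧ q < 1)] {n : ℤ} (h : 0 ≤ n) : 0 < invQ q n := by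
  lift n to ℕ using h
  exact invQ_pos n

theorem one_sub_pos {q : ℝ} [hq : Fact (0 < q ∧ q < 1)] (n : ℕ) : 0 < 1 - q ^ (n + 1) := by
  have := pow_lt_one₀ hq.out.1.le hq.out.2 (Nat.succ_ne_zero n)
  simpa using this

theorem invQ_succ {q : ℝ} [hq : Fact (0 < q ∧ q < 1)] (n : ℕ) :
    (1 - q ^ (n + 1)) * invQ q ((n + 1 : ℕ) : ℤ) = invQ q (n : ℤ) := by
  rw [invQ_nat, invQ_nat]
  have h : qP q q (n + 1) = qP q q n * (1 - q ^ (n + 1)) := by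
    unfold qP; rw [Finset.prod_range_succ, pow_succ' q n]
  have := one_sub_pos (q := q) n
  have h2 := qP_pos (q := q) n
  rw [h]; field_simp

theorem invQ_pred {q : ℝ} [hq : Fact (0 < q ∧ q < 1)] (n : ℤ) :
    (1 - q ^ n) * invQ q n = invQ q (n - 1) := by
  rcases lt_trichotomy n 0 with h | h | h
  · rw [invQ_neg h, invQ_neg (by omega), mul_zero]
  · subst h; simp [invQ_neg]
  · obtain ⟨m, rfl⟩ : ∃ m : ℕ, n = ((m + 1 : ℕ) : ℤ) := ⟨(n - 1).toNat, by omega⟩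
    rw [zpow_natCast, invQ_succ]; congr 1; push_cast; ring

/-- uniform bound -/
def CQ (q : ℝ) : ℝ := Real.exp ((1 - q)⁻¹ * (1 - q)⁻¹)

theorem CQ_pos (q : ℝ) : 0 < CQ q := Real.exp_pos _

theorem invQ_le {q : ℝ} [hq : Fact (0 < q ∧ q < 1)] (n : ℤ) : invQ q n ≤ CQ q := by
  obtain ⟨h0, h1⟩ := hq.out
  have key : ∀ n : ℕ, invQ q (n : ℤ) ≤ Real.exp ((1 - q)⁻¹ * ∑ i ∈ Finset.range n, q ^ i) := by
    intro n
    induction n with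
    | zero => simp [invQ_zero]
    | succ n ih =>
      have h3 := one_sub_pos (q := q) n
      have h4 := invQ_succ (q := q) n
      have h5 : invQ q ((n + 1 : ℕ) : ℤ) = invQ q (n : ℤ) * (1 - q ^ (n + 1))⁻¹ := by
        rw [← h4]; field_simp
      rw [h5, Finset.sum_range_succ, mul_add, Real.exp_add]
      have h6 : (1 - q ^ (n + 1))⁻¹ ≤ Real.exp ((1 - q)⁻¹ * q ^ n) := by
        have h7 : (1 - q ^ (n + 1))⁻¹ = q ^ (n + 1) * (1 - q ^ (n + 1))⁻¹ + 1 := by field_simp; ring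
        have h8 : q ^ (n + 1) * (1 - q ^ (n + 1))⁻¹ ≤ (1 - q)⁻¹ * q ^ n := by
          rw [mul_comm]
          have a1 : q ^ (n + 1) ≤ q ^ n := pow_le_pow_of_le_one h0.le h1.le (Nat.le_succ n)
          have a2 : q ^ (n + 1) ≤ q := by
            have := pow_le_pow_of_le_one h0.le h1.le (show 1 ≤ n + 1 by omega)
            simpa using this
          have a3 : (1 - q ^ (n + 1))⁻¹ ≤ (1 - q)⁻¹ := inv_anti₀ (by linarith) (by linarith)
          exact mul_le_mul a3 a1 (by positivity) (inv_nonneg.mpr (by linarith))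
        calc _ = _ := h7
          _ ≤ (1 - q)⁻¹ * q ^ n + 1 := by linarith
          _ ≤ _ := Real.add_one_le_exp _
      exact mul_le_mul ih h6 (inv_nonneg.mpr h3.le) (Real.exp_pos _).le
  rcases lt_or_ge n 0 with h | h
  · rw [invQ_neg h]; exact (CQ_pos q).le
  · lift n to ℕ using h
    refine (key n).trans (Real.exp_le_exp.mpr ?_)
    apply mul_le_mul_of_nonneg_left _ (inv_nonneg.mpr (by linarith))
    rw [← tsum_geometric_of_lt_one h0.le h1]
    exact (summable_geometric_of_lt_one h0.le h1).sum_le_tsum _ (fun i _ => by positivity)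

/-! Gaussian summability -/

theorem summ_ch {q : ℝ} [hq : Fact (0 < q ∧ q < 1)] {t : ℝ} (ht : 0 ≤ t) :
    Summable (fun n : ℕ => t ^ n * q ^ (n.choose 2)) := by
  obtain ⟨h0, h1⟩ := hq.out
  have : Summable (fun n : ℕ => (t + 1) ^ n * q ^ (n.choose 2)) := by
    apply summable_of_ratio_test_tendsto_lt_one (l := 0) zero_lt_one
    · exact Eventually.of_forall fun n => by positivity
    · have : ∀ n : ℕ, ‖(t + 1) ^ (n + 1) * q ^ ((n + 1).choose 2)‖ / ‖(t + 1) ^ n * q ^ (n.choose 2)‖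
          = (t + 1) * q ^ n := by
        intro n
        rw [Real.norm_of_nonneg (by positivity), Real.norm_of_nonneg (by positivity)]
        rw [Nat.choose_succ_succ' n 1, Nat.choose_one_right, show (1 + 1 : ℕ) = 2 from rfl, pow_add q, pow_succ]
        field_simp
      simp only [this]
      simpa using (tendsto_pow_atTop_nhds_zero_of_lt_one h0.le h1).const_mul (t + 1)
  refine this.of_nonneg_of_le (fun n => by positivity) (fun n => ?_)
  gcongr; linarith

theorem choose_sq (n : ℕ) : n ^ 2 = 2 * n.choose 2 + n := by
  induction n with
  | zero => simp
  | succ n ih => rw [Nat.choose_succ_succ' n 1, Nat.choose_one_right]; nlinarith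

theorem summ_gauss_nat {p : ℝ} [hp : Fact (0 < p ∧ p < 1)] {t : ℝ} (ht : 0 ≤ t) :
    Summable (fun n : ℕ => t ^ n * p ^ (n ^ 2)) := by
  obtain ⟨h0, h1⟩ := hp.out
  haveI : Fact (0 < p ^ 2 ∧ p ^ 2 < 1) := ⟨by positivity, by nlinarith⟩
  have := summ_ch (q := p ^ 2) (t := t * p) (by positivity)
  refine this.congr (fun n => ?_)
  rw [choose_sq n, pow_add, pow_mul, mul_pow]; ring

theorem summ_gauss {p : ℝ} [hp : Fact (0 < p ∧ p < 1)] {t : ℝ} (ht : 0 ≤ t) :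
    Summable (fun n : ℤ => t ^ n * p ^ (n ^ 2)) := by
  apply Summable.of_nat_of_neg
  · refine (summ_gauss_nat (p := p) ht).congr (fun n => ?_)
    rw [zpow_natCast, ← zpow_natCast]; push_cast; rfl
  · refine (summ_gauss_nat (p := p) (inv_nonneg.mpr ht)).congr (fun n => ?_)
    rw [zpow_neg, zpow_natCast, ← zpow_natCast p, inv_pow]; push_cast; rw [neg_sq]

/-- D^|n| version -/
theorem summ_gauss_abs {p : ℝ} [hp : Fact (0 < p ∧ p < 1)] {D t : ℝ} (hD : 0 < D) (ht : 0 ≤ t) :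
    Summable (fun n : ℤ => D ^ n.natAbs * (t ^ n * p ^ (n ^ 2))) := by
  obtain ⟨h0, h1⟩ := hp.out
  have a := summ_gauss (p := p) (t := D * t) (by positivity)
  have b := summ_gauss (p := p) (t := D⁻¹ * t) (by positivity)
  refine (a.add b).of_nonneg_of_le (fun n => by positivity) (fun n => ?_)
  rw [mul_zpow, mul_zpow, mul_assoc, mul_assoc, ← add_mul]
  apply mul_le_mul_of_nonneg_right _ (by positivity)
  rcases le_total 0 n with h | h
  · lift n to ℕ using h
    simp only [Int.natAbs_natCast, zpow_natCast]
    linarith [pow_pos (inv_pos.mpr hD) n]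
  · obtain ⟨m, rfl⟩ : ∃ m : ℕ, n = -(m : ℤ) := ⟨n.natAbs, by omega⟩
    simp only [Int.natAbs_neg, Int.natAbs_natCast, zpow_neg, zpow_natCast, inv_pow, inv_inv]
    linarith [inv_pos.mpr (pow_pos hD m)]

theorem tsum_int_nat {α : Type*} [AddCommMonoid α] [TopologicalSpace α] [T2Space α]
    (f : ℤ → α) (h : ∀ n < 0, f n = 0) : ∑' n : ℤ, f n = ∑' n : ℕ, f n := by
  refine (Function.Injective.tsum_eq (g := fun n : ℕ => (n : ℤ)) Nat.cast_injective ?_).symm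
  intro n hn
  by_contra hc
  apply hn
  apply h
  by_contra h2
  exact hc ⟨n.toNat, by simp; omega⟩

theorem summable_int_nat {α : Type*} [AddCommMonoid α] [TopologicalSpace α]
    (f : ℤ → α) (h : ∀ n < 0, f n = 0) : Summable f ↔ Summable (fun n : ℕ => f n) := by
  refine (Function.Injective.summable_iff (g := fun n : ℕ => (n : ℤ)) Nat.cast_injective ?_).symm
  intro n hn
  apply h
  by_contra h2
  exact hn ⟨n.toNat, by simp only [Int.toNat_of_nonneg (not_lt.mp h2)]⟩

/-! The function E -/

def Ep (q y : ℝ) : ℝ := ∑' s : ℕ, y ^ s * q ^ (s.choose 2) * invQ q s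

def E (q : ℝ) (Y : ℂ) : ℂ := ∑' s : ℕ, (-Y) ^ s * (q : ℂ) ^ (s.choose 2) * (invQ q s : ℂ)

section
variable {q : ℝ} [hq : Fact (0 < q ∧ q < 1)]

theorem Ep_summ {y : ℝ} (hy : 0 ≤ y) : Summable (fun s : ℕ => y ^ s * q ^ (s.choose 2) * invQ q s) := by
  have h0 := hq.out.1
  refine ((summ_ch (q := q) hy).mul_right (CQ q)).of_nonneg_of_le
    (fun n => mul_nonneg (by positivity) (invQ_nonneg _)) (fun n => ?_)
  exact mul_le_mul_of_nonneg_left (invQ_le _) (by positivity)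

theorem Ep_nonneg {y : ℝ} (hy : 0 ≤ y) : 0 ≤ Ep q y :=
  tsum_nonneg fun n => mul_nonneg (by have := hq.out.1; positivity) (invQ_nonneg _)

theorem Ep_mono {y z : ℝ} (hy : 0 ≤ y) (h : y ≤ z) : Ep q y ≤ Ep q z := by
  have h0 := hq.out.1
  refine (Ep_summ hy).tsum_le_tsum (fun n => ?_) (Ep_summ (hy.trans h))
  have := invQ_nonneg (q := q) n
  gcongr

theorem E_norm_term (Y : ℂ) (s : ℕ) : ‖(-Y) ^ s * (q : ℂ) ^ (s.choose 2) * (invQ q s : ℂ)‖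
    = ‖Y‖ ^ s * q ^ (s.choose 2) * invQ q s := by
  have h0 := hq.out.1
  simp [abs_of_pos h0, abs_of_nonneg (invQ_nonneg (q := q) s)]

theorem E_summ_norm (Y : ℂ) :
    Summable (fun s : ℕ => ‖(-Y) ^ s * (q : ℂ) ^ (s.choose 2) * (invQ q s : ℂ)‖) := by
  simp only [E_norm_term]; exact Ep_summ (norm_nonneg Y)

theorem E_summ (Y : ℂ) :
    Summable (fun s : ℕ => (-Y) ^ s * (q : ℂ) ^ (s.choose 2) * (invQ q s : ℂ)) :=
  (E_summ_norm Y).of_norm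

theorem E_le (Y : ℂ) : ‖E q Y‖ ≤ Ep q ‖Y‖ := by
  refine (norm_tsum_le_tsum_norm (E_summ_norm Y)).trans_eq ?_
  simp only [E_norm_term]; rfl

theorem E_zero : E q 0 = 1 := by
  unfold E
  rw [tsum_eq_single 0]
  · simp [invQ_zero]
  · intro s hs; simp [hs]

theorem E_fe (Y : ℂ) : E q Y = (1 - Y) * E q (Y * q) := by
  have h : E q Y - E q (Y * q) = -Y * E q (Y * q) := by
    unfold E
    rw [← (E_summ Y).tsum_sub (E_summ _), ((E_summ Y).sub (E_summ _)).tsum_eq_zero_add, ← tsum_mul_left]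
    simp only [pow_zero, Nat.choose_zero_succ, sub_self, zero_add]
    refine tsum_congr fun s => ?_
    rw [← invQ_succ s, Nat.choose_succ_succ' s 1, Nat.choose_one_right]
    push_cast
    ring
  linear_combination h

theorem E_tendsto {ι : Type*} {l : Filter ι} {Y : ι → ℂ} (h : Tendsto Y l (𝓝 0)) :
    Tendsto (fun i => E q (Y i)) l (𝓝 1) := by
  rw [← E_zero (q := q)]
  unfold E
  refine tendsto_tsum_of_dominated_convergence (Ep_summ (q := q) zero_le_one) (fun s => ?_) ?_
  · exact ((h.neg.pow s).mul_const _).mul_const _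
  · have : ∀ᶠ i in l, ‖Y i‖ ≤ 1 := by
      have := h.norm
      simp only [norm_zero] at this
      exact this.eventually_le_const zero_lt_one
    filter_upwards [this] with i hi s
    rw [E_norm_term]
    have h0 := hq.out.1
    have := invQ_nonneg (q := q) s
    gcongr

theorem qpow_tendsto (Y : ℂ) : Tendsto (fun n : ℕ => Y * (q : ℂ) ^ n) atTop (𝓝 0) := by
  have : Tendsto (fun n : ℕ => (q : ℂ) ^ n) atTop (𝓝 0) := by
    apply tendsto_pow_atTop_nhds_zero_of_norm_lt_one
    simp [abs_of_pos hq.out.1, hq.out.2]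
  simpa using this.const_mul Y

theorem E_prod (Y : ℂ) (n : ℕ) : E q Y = (∏ m ∈ Finset.range n, (1 - Y * (q : ℂ) ^ m)) * E q (Y * q ^ n) := by
  induction n with
  | zero => simp
  | succ n ih => rw [ih, Finset.prod_range_succ, E_fe (Y * q ^ n), pow_succ]; ring_nf

def E2 (q : ℝ) (Y : ℂ) : ℂ := ∑' s : ℕ, Y ^ s * (invQ q s : ℂ)

theorem E2_summ_norm {Y : ℂ} (hY : ‖Y‖ < 1) : Summable (fun s : ℕ => ‖Y ^ s * (invQ q s : ℂ)‖) := by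
  refine ((summable_geometric_of_lt_one (norm_nonneg Y) hY).mul_right (CQ q)).of_nonneg_of_le
    (fun n => norm_nonneg _) (fun n => ?_)
  simp only [norm_mul, norm_pow, Complex.norm_real, Real.norm_of_nonneg (invQ_nonneg (q := q) n)]
  exact mul_le_mul_of_nonneg_left (invQ_le _) (by positivity)

theorem norm_q : ‖(q : ℂ)‖ = q := by simp [abs_of_pos hq.out.1]

theorem q_ne : (q : ℂ) ≠ 0 := by exact_mod_cast hq.out.1.ne'

theorem norm_mul_q {Y : ℂ} (hY : ‖Y‖ < 1) : ‖Y * q‖ < 1 := by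
  rw [norm_mul, norm_q]
  nlinarith [hq.out.1, hq.out.2, norm_nonneg Y]

theorem E2_fe {Y : ℂ} (hY : ‖Y‖ < 1) : (1 - Y) * E2 q Y = E2 q (Y * q) := by
  have s1 := (E2_summ_norm (q := q) hY).of_norm
  have s2 := (E2_summ_norm (q := q) (norm_mul_q (q := q) hY)).of_norm
  have h : E2 q Y - E2 q (Y * q) = Y * E2 q Y := by
    unfold E2
    rw [← s1.tsum_sub s2, (s1.sub s2).tsum_eq_zero_add, ← tsum_mul_left]
    simp only [pow_zero, sub_self, zero_add]
    refine tsum_congr fun s => ?_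
    rw [← invQ_succ s]
    push_cast
    ring
  linear_combination h

theorem E_mul_E2 {Y : ℂ} (hY : ‖Y‖ < 1) : E q Y * E2 q Y = 1 := by
  have key : ∀ n : ℕ, ‖Y * q ^ n‖ < 1 ∧ E q Y * E2 q Y = E q (Y * q ^ n) * E2 q (Y * q ^ n) := by
    intro n
    induction n with
    | zero => simp [hY]
    | succ n ih =>
      obtain ⟨h1, h2⟩ := ih
      have e : Y * (q : ℂ) ^ (n + 1) = Y * q ^ n * q := by rw [pow_succ]; ring
      rw [e]
      refine ⟨norm_mul_q h1, ?_⟩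
      rw [h2, E_fe (Y * q ^ n), ← E2_fe h1]; ring
  have t1 := E_tendsto (q := q) (qpow_tendsto (q := q) Y)
  have t2 : Tendsto (fun n : ℕ => E2 q (Y * q ^ n)) atTop (𝓝 1) := by
    have : (1 : ℂ) = E2 q 0 := by
      unfold E2
      rw [tsum_eq_single 0]
      · simp [invQ_zero]
      · intro s hs; simp [hs]
    rw [this]
    unfold E2
    refine tendsto_tsum_of_dominated_convergence (E2_summ_norm (q := q) hY) (fun s => ?_) ?_
    · exact ((qpow_tendsto (q := q) Y).pow s).mul_const _
    · refine Eventually.of_forall fun n s => ?_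
      simp only [norm_mul, norm_pow, norm_q]
      apply mul_le_mul_of_nonneg_right _ (norm_nonneg _)
      apply pow_le_pow_left₀ (mul_nonneg (norm_nonneg _) (pow_nonneg hq.out.1.le _))
      exact mul_le_of_le_one_right (norm_nonneg _) (pow_le_one₀ hq.out.1.le hq.out.2.le)
  have t3 := t1.mul t2
  have : (fun n : ℕ => E q (Y * q ^ n) * E2 q (Y * q ^ n)) = fun _ => E q Y * E2 q Y :=
    funext fun n => ((key n).2).symm
  rw [this, one_mul] at t3
  exact tendsto_nhds_unique tendsto_const_nhds t3

theorem E_ne {Y : ℂ} (hY : ‖Y‖ < 1) : E q Y ≠ 0 := left_ne_zero_of_mul_eq_one (E_mul_E2 hY)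

theorem Eq_ne : E q q ≠ 0 := E_ne (by rw [norm_q]; exact hq.out.2)

theorem E_q_pow (n : ℕ) : E q ((q : ℂ) ^ (n + 1)) = E q q * (invQ q n : ℝ) := by
  rw [E_prod (q := q) (q : ℂ) n]
  have h : (∏ m ∈ Finset.range n, (1 - (q : ℂ) * (q : ℂ) ^ m)) = ((qP q q n : ℝ) : ℂ) := by
    unfold qP; push_cast; rfl
  rw [h, invQ_nat, pow_succ' (q : ℂ) n]
  have := (qP_pos (q := q) n).ne'
  have h2 : ((qP q q n : ℝ) : ℂ) ≠ 0 := by exact_mod_cast this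
  push_cast
  field_simp

theorem E_one : E q 1 = 0 := by rw [E_fe]; simp

theorem E_q_zpow (n : ℤ) : E q ((q : ℂ) ^ (n + 1)) = E q q * invQ q n := by
  rcases lt_or_ge n 0 with h | h
  · rw [invQ_neg h]
    obtain ⟨m, hm⟩ : ∃ m : ℕ, n + 1 = -(m : ℤ) := ⟨(-(n + 1)).toNat, by omega⟩
    rw [hm, E_prod (q := q) _ m]
    have : (q : ℂ) ^ (-(m : ℤ)) * (q : ℂ) ^ m = 1 := by
      rw [zpow_neg, zpow_natCast]; exact inv_mul_cancel₀ (pow_ne_zero _ q_ne)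
    rw [this, E_one]; simp
  · lift n to ℕ using h
    rw [← E_q_pow]; norm_cast

theorem qPInf_tendsto : Tendsto (fun n : ℕ => ∏ m ∈ Finset.range n, (1 - q * q ^ m)) atTop
    (𝓝 (qPInf q q)) := by
  have h0 := hq.out.1
  have m1 : Multipliable (fun m : ℕ => 1 + (-(q * q ^ m))) := by
    apply multipliable_one_add_of_summable
    have : Summable (fun m : ℕ => q * q ^ m) := (summable_geometric_of_lt_one h0.le hq.out.2).mul_left q
    simpa [abs_of_pos h0] using this
  have t1 := m1.hasProd.tendsto_prod_nat
  simp only [← sub_eq_add_neg] at t1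
  exact t1

theorem qPInf_eq : ((qPInf q q : ℝ) : ℂ) = E q q := by
  have t1 := qPInf_tendsto (q := q)
  have t2 : Tendsto (fun n : ℕ => ((∏ m ∈ Finset.range n, (1 - q * q ^ m) : ℝ) : ℂ)) atTop
      (𝓝 ((qPInf q q : ℝ) : ℂ)) := (Complex.continuous_ofReal.tendsto _).comp t1
  have t3 := t2.mul (E_tendsto (q := q) (qpow_tendsto (q := q) (q : ℂ)))
  have : (fun n : ℕ => ((∏ m ∈ Finset.range n, (1 - q * q ^ m) : ℝ) : ℂ) * E q (q * (q : ℂ) ^ n))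
     = fun _ => E q q := by
    funext n; rw [E_prod (q := q) (q : ℂ) n]; push_cast; rfl
  rw [this, mul_one] at t3
  exact (tendsto_nhds_unique tendsto_const_nhds t3).symm

theorem qPInf_pos : 0 < qPInf q q := by
  have h1 : 0 ≤ qPInf q q := by
    have : ∀ m : ℕ, 0 ≤ 1 - q * q ^ m := fun m => by
      have := one_sub_pos (q := q) m
      rw [pow_succ'] at this; exact this.le
    exact ge_of_tendsto' qPInf_tendsto fun n => Finset.prod_nonneg fun m _ => this m
  have h2 : qPInf q q ≠ 0 := by
    intro h
    have := qPInf_eq (q := q)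
    rw [h] at this
    exact Eq_ne (q := q) (by rw [← this]; simp)
  exact lt_of_le_of_ne h1 h2.symm

theorem invQ_tendsto : Tendsto (fun n : ℕ => (invQ q n : ℂ)) atTop (𝓝 (E q q)⁻¹) := by
  have h := (E_tendsto (q := q) (qpow_tendsto (q := q) (q : ℂ))).const_mul (E q q)⁻¹
  rw [mul_one] at h
  refine h.congr fun n => ?_
  rw [← pow_succ', E_q_pow]
  have := Eq_ne (q := q)
  field_simp

end
end GP
end

section
namespace GP
open Filter Topology

theorem ch2_two (n : ℤ) : 2 * ch2 n = n * (n - 1) := by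
  unfold ch2
  have : (2 : ℤ) ∣ n * (n - 1) := by
    rw [mul_comm]; 
    have := Int.even_mul_succ_self (n - 1)
    rw [sub_add_cancel] at this
    exact this.two_dvd
  exact Int.mul_ediv_cancel' this

theorem ch2_nat (n : ℕ) : ch2 (n : ℤ) = (n.choose 2 : ℤ) := by
  have h1 := ch2_two n
  have h2 := choose_sq n
  zify at h2
  nlinarith

section
variable {q : ℝ} [hq : Fact (0 < q ∧ q < 1)]

theorem invC_pred (n : ℤ) : (1 - (q : ℂ) ^ n) * (invQ q n : ℂ) = (invQ q (n - 1) : ℂ) := by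
  rw [← invQ_pred]; push_cast; rfl

theorem step_fin (n : ℕ) (Y : ℂ) :
    ∑ c ∈ Finset.range (n + 1), (invQ q c : ℂ) * (invQ q ((n : ℤ) - c) : ℂ) * Y ^ c * (q : ℂ) ^ (c ^ 2)
      * E q (Y * q ^ (c + 1)) = (invQ q n : ℂ) * E q (Y * q ^ (n + 1)) := by
  induction n generalizing Y with
  | zero => simp [invQ_zero]
  | succ n ih =>
    have hne : (1 - (q : ℂ) ^ (n + 1)) ≠ 0 := by
      have := (one_sub_pos (q := q) n).ne'
      exact_mod_cast this
    apply mul_left_cancel₀ hne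
    have hR : (1 - (q : ℂ) ^ (n + 1)) * ((invQ q ((n + 1 : ℕ) : ℤ) : ℂ) * E q (Y * q ^ (n + 1 + 1)))
        = (invQ q n : ℂ) * E q (Y * q ^ (n + 1)) + Y * q ^ (n + 1) * ((invQ q n : ℂ) * E q (Y * q * q ^ (n + 1))) := by
      rw [E_fe (Y * q ^ (n + 1)), ← invQ_succ n]
      have e1 : Y * (q : ℂ) ^ (n + 1) * q = Y * q ^ (n + 1 + 1) := by ring
      have e2 : Y * (q : ℂ) * q ^ (n + 1) = Y * q ^ (n + 1 + 1) := by ring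
      rw [e1, e2]; push_cast; ring
    rw [hR, ← ih, ← ih]
    have hA : ∀ c : ℕ, (1 - (q : ℂ) ^ (n + 1)) * ((invQ q c : ℂ) * (invQ q (((n + 1 : ℕ) : ℤ) - c) : ℂ) * Y ^ c * (q : ℂ) ^ (c ^ 2)
      * E q (Y * q ^ (c + 1))) = (invQ q c : ℂ) * (invQ q ((n : ℤ) - c) : ℂ) * Y ^ c * (q : ℂ) ^ (c ^ 2)
      * E q (Y * q ^ (c + 1)) + (q : ℂ) ^ ((n : ℤ) + 1 - c) * (invQ q ((c : ℤ) - 1) : ℂ) * (invQ q ((n : ℤ) + 1 - c) : ℂ) * Y ^ c * (q : ℂ) ^ (c ^ 2)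
      * E q (Y * q ^ (c + 1)) := by
      intro c
      have i1 : ((n : ℤ) - c) = ((n : ℤ) + 1 - c) - 1 := by ring
      have i2 : (((n + 1 : ℕ) : ℤ) - c) = (n : ℤ) + 1 - c := by push_cast; ring
      rw [i1, i2, ← invC_pred ((n : ℤ) + 1 - c), ← invC_pred (c : ℤ)]
      have : (q : ℂ) ^ (n + 1) = (q : ℂ) ^ ((n : ℤ) + 1 - c) * (q : ℂ) ^ (c : ℤ) := by
        rw [← zpow_add₀ q_ne, ← zpow_natCast]; congr 1; push_cast; ring
      rw [this]; ring
    rw [Finset.mul_sum, Finset.sum_congr rfl (fun c _ => hA c), Finset.sum_add_distrib]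
    congr 1
    · rw [Finset.sum_range_succ]
      rw [invQ_neg (n := (n : ℤ) - ((n + 1 : ℕ) : ℤ)) (by push_cast; omega)]
      simp
    · rw [Finset.sum_range_succ']
      rw [invQ_neg (n := ((0 : ℕ) : ℤ) - 1) (by norm_num)]
      simp only [Complex.ofReal_zero, mul_zero, zero_mul, add_zero]
      rw [Finset.mul_sum]
      refine Finset.sum_congr rfl fun c hc => ?_
      have hc' : c ≤ n := by simpa [Nat.lt_succ_iff] using hc
      have i1 : ((c + 1 : ℕ) : ℤ) - 1 = c := by push_cast; ring
      have i2 : (n : ℤ) + 1 - ((c + 1 : ℕ) : ℤ) = n - c := by push_cast; ring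
      rw [i1, i2]
      have e1 : Y * (q : ℂ) * q ^ (c + 1) = Y * q ^ (c + 1 + 1) := by ring
      rw [e1]
      have i3 : (q : ℂ) ^ ((n : ℤ) - c) = (q : ℂ) ^ (n - c) := by
        rw [← zpow_natCast]; congr 1; omega
      have i4 : (q : ℂ) ^ (n + 1) = (q : ℂ) ^ (n - c) * (q : ℂ) ^ (c + 1) := by
        rw [← pow_add]; congr 1; omega
      rw [i3, i4]; ring

/-- final sum -/
def g (q : ℝ) (s : ℕ) (Y : ℂ) : ℂ :=
  ∑' c : ℕ, Y ^ c * (q : ℂ) ^ ((c : ℤ) ^ 2 - s * c) * (invQ q c : ℂ) * E q (Y * q ^ (c + 1))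

theorem E_le_unif (Y : ℂ) (c : ℕ) : ‖E q (Y * q ^ c)‖ ≤ Ep q ‖Y‖ := by
  refine (E_le _).trans (Ep_mono (norm_nonneg _) ?_)
  rw [norm_mul, norm_pow, norm_q]
  exact mul_le_of_le_one_right (norm_nonneg _) (pow_le_one₀ hq.out.1.le hq.out.2.le)

theorem norm_inv_le (n : ℤ) : ‖(invQ q n : ℂ)‖ ≤ CQ q := by
  rw [Complex.norm_real, Real.norm_of_nonneg (invQ_nonneg _)]; exact invQ_le _

theorem g_bound_summ (s : ℕ) (Y : ℂ) :
    Summable (fun c : ℕ => ‖Y‖ ^ c * q ^ ((c : ℤ) ^ 2 - s * c) * CQ q * Ep q ‖Y‖) := by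
  have h0 := hq.out.1
  have := summ_gauss_nat (p := q) (t := ‖Y‖ * q ^ (-(s : ℤ))) (by positivity)
  refine ((this.mul_right (CQ q)).mul_right (Ep q ‖Y‖)).congr (fun c => ?_)
  congr 2
  rw [mul_pow, mul_assoc, ← zpow_natCast (q ^ (-(s : ℤ))), ← zpow_mul, ← zpow_natCast q (c ^ 2),
    ← zpow_add₀ h0.ne']
  congr 2; push_cast; ring

theorem g_term_le (s : ℕ) (Y : ℂ) (c : ℕ) :
    ‖Y ^ c * (q : ℂ) ^ ((c : ℤ) ^ 2 - s * c) * (invQ q c : ℂ) * E q (Y * q ^ (c + 1))‖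
    ≤ ‖Y‖ ^ c * q ^ ((c : ℤ) ^ 2 - s * c) * CQ q * Ep q ‖Y‖ := by
  have h0 := hq.out.1
  rw [norm_mul, norm_mul, norm_mul, norm_pow, norm_zpow, norm_q]
  have := CQ_pos q
  gcongr
  · exact norm_inv_le _
  · exact E_le_unif _ _

theorem g_summ (s : ℕ) (Y : ℂ) :
    Summable (fun c : ℕ => Y ^ c * (q : ℂ) ^ ((c : ℤ) ^ 2 - s * c) * (invQ q c : ℂ) * E q (Y * q ^ (c + 1))) :=
  Summable.of_norm_bounded (g_bound_summ s Y) (g_term_le s Y)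

theorem g_zero (Y : ℂ) : g q 0 Y = 1 := by
  have hE := Eq_ne (q := q)
  have t1 : Tendsto (fun n : ℕ => (invQ q n : ℂ) * E q (Y * q ^ (n + 1))) atTop (𝓝 ((E q q)⁻¹ * 1)) :=
    invQ_tendsto.mul ((E_tendsto (qpow_tendsto Y)).comp (tendsto_add_atTop_nat 1))
  have t2 : Tendsto (fun n : ℕ => ∑' c : ℕ, (invQ q c : ℂ) * (invQ q ((n : ℤ) - c) : ℂ) * Y ^ c * (q : ℂ) ^ (c ^ 2)
      * E q (Y * q ^ (c + 1))) atTop (𝓝 (∑' c : ℕ, (invQ q c : ℂ) * (E q q)⁻¹ * Y ^ c * (q : ℂ) ^ (c ^ 2)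
      * E q (Y * q ^ (c + 1)))) := by
    refine tendsto_tsum_of_dominated_convergence ((g_bound_summ (q := q) 0 Y).mul_right (CQ q)) (fun c => ?_) ?_
    · refine Tendsto.mul_const _ (Tendsto.mul_const _ (Tendsto.mul_const _ (Tendsto.const_mul _ ?_)))
      have := (invQ_tendsto (q := q)).comp (tendsto_sub_atTop_nat c)
      refine this.congr' ?_
      filter_upwards [eventually_ge_atTop c] with n hn
      simp only [Function.comp]; congr 2; omega
    · refine Eventually.of_forall fun n c => ?_
      have h := g_term_le (q := q) 0 Y c
      have h2 := norm_inv_le (q := q) ((n : ℤ) - c)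
      have e : (invQ q c : ℂ) * (invQ q ((n : ℤ) - c) : ℂ) * Y ^ c * (q : ℂ) ^ (c ^ 2)
      * E q (Y * q ^ (c + 1)) = (Y ^ c * (q : ℂ) ^ ((c : ℤ) ^ 2 - (0 : ℕ) * c) * (invQ q c : ℂ) * E q (Y * q ^ (c + 1))) *
        (invQ q ((n : ℤ) - c) : ℂ) := by
        have : (q : ℂ) ^ ((c : ℤ) ^ 2 - (0 : ℕ) * c) = (q : ℂ) ^ (c ^ 2) := by
          rw [← zpow_natCast]; congr 1; push_cast; ring
        rw [this]; ring
      rw [e, norm_mul]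
      exact mul_le_mul h h2 (norm_nonneg _) ((norm_nonneg _).trans h)
  have e : (fun n : ℕ => ∑' c : ℕ, (invQ q c : ℂ) * (invQ q ((n : ℤ) - c) : ℂ) * Y ^ c * (q : ℂ) ^ (c ^ 2)
      * E q (Y * q ^ (c + 1))) = (fun n : ℕ => (invQ q n : ℂ) * E q (Y * q ^ (n + 1))) := by
    funext n
    rw [← step_fin n Y]
    refine tsum_eq_sum fun c hc => ?_
    have : ¬ c < n + 1 := by simpa using hc
    rw [invQ_neg (n := (n : ℤ) - c) (by omega)]; simp
  rw [e] at t2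
  have h := tendsto_nhds_unique t1 t2
  rw [mul_one] at h
  have h2 : ∑' c : ℕ, (invQ q c : ℂ) * (E q q)⁻¹ * Y ^ c * (q : ℂ) ^ (c ^ 2) * E q (Y * q ^ (c + 1))
     = (E q q)⁻¹ * g q 0 Y := by
    unfold g
    rw [← tsum_mul_left]
    refine tsum_congr fun c => ?_
    have : (q : ℂ) ^ ((c : ℤ) ^ 2 - (0 : ℕ) * c) = (q : ℂ) ^ (c ^ 2) := by
      rw [← zpow_natCast]; congr 1; push_cast; ring
    rw [this]; ring
  rw [h2] at h
  have := inv_ne_zero hE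
  exact (mul_left_cancel₀ this (by rw [← h, mul_one]))

theorem g_rec (s : ℕ) (Y : ℂ) : g q (s + 1) Y = g q s Y + Y * (q : ℂ) ^ (-(s : ℤ)) * g q s (Y * q) := by
  have h : g q (s + 1) Y - g q s Y = Y * (q : ℂ) ^ (-(s : ℤ)) * g q s (Y * q) := by
    unfold g
    rw [← (g_summ _ _).tsum_sub (g_summ _ _), ((g_summ _ _).sub (g_summ _ _)).tsum_eq_zero_add, ← tsum_mul_left]
    simp only [pow_zero, Nat.cast_zero, mul_zero, sub_self, zero_add]
    refine tsum_congr fun c => ?_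
    rw [← invQ_succ c]
    have e1 : Y * (q : ℂ) * q ^ (c + 1) = Y * q ^ (c + 1 + 1) := by ring
    rw [e1]
    have e2 : (q : ℂ) ^ (((c + 1 : ℕ) : ℤ) ^ 2 - s * ((c + 1 : ℕ) : ℤ)) =
      (q : ℂ) ^ (((c + 1 : ℕ) : ℤ) ^ 2 - ((s + 1 : ℕ) : ℤ) * ((c + 1 : ℕ) : ℤ)) * (q : ℂ) ^ (c + 1) := by
      rw [← zpow_natCast (q : ℂ) (c + 1), ← zpow_add₀ q_ne]; congr 1; push_cast; ring
    have e3 : (q : ℂ) ^ (((c + 1 : ℕ) : ℤ) ^ 2 - ((s + 1 : ℕ) : ℤ) * ((c + 1 : ℕ) : ℤ)) =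
      (q : ℂ) ^ (-(s : ℤ)) * (q : ℂ) ^ c * (q : ℂ) ^ ((c : ℤ) ^ 2 - s * c) := by
      rw [← zpow_natCast (q : ℂ) c, ← zpow_add₀ q_ne, ← zpow_add₀ q_ne]; congr 1; push_cast; ring
    rw [e2, e3]; push_cast; ring
  linear_combination h

theorem g_eq (s : ℕ) (Y : ℂ) : (invQ q s : ℂ) * g q s Y =
    ∑ j ∈ Finset.range (s + 1), (invQ q j : ℂ) * (invQ q ((s : ℤ) - j) : ℂ) * (q : ℂ) ^ ((j : ℤ) ^ 2 - j * s) * Y ^ j := by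
  induction s generalizing Y with
  | zero => simp [g_zero, invQ_zero]
  | succ s ih =>
    have hne : (1 - (q : ℂ) ^ (s + 1)) ≠ 0 := by
      have := (one_sub_pos (q := q) s).ne'
      exact_mod_cast this
    apply mul_left_cancel₀ hne
    have hR : (1 - (q : ℂ) ^ (s + 1)) * ((invQ q ((s + 1 : ℕ) : ℤ) : ℂ) * g q (s + 1) Y) =
       (invQ q s : ℂ) * g q s Y + Y * (q : ℂ) ^ (-(s : ℤ)) * ((invQ q s : ℂ) * g q s (Y * q)) := by
      rw [g_rec, ← invQ_succ s]; push_cast; ring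
    rw [hR, ih, ih]
    symm
    have hA : ∀ j : ℕ, (1 - (q : ℂ) ^ (s + 1)) * ((invQ q j : ℂ) * (invQ q (((s + 1 : ℕ) : ℤ) - j) : ℂ) * (q : ℂ) ^ ((j : ℤ) ^ 2 - j * ((s + 1 : ℕ) : ℤ)) * Y ^ j)
       = (invQ q j : ℂ) * (invQ q ((s : ℤ) - j) : ℂ) * (q : ℂ) ^ ((j : ℤ) ^ 2 - j * s) * Y ^ j +
       (invQ q ((j : ℤ) - 1) : ℂ) * (invQ q ((s : ℤ) + 1 - j) : ℂ) * (q : ℂ) ^ ((j : ℤ) ^ 2 - j * ((s : ℤ) + 1)) * Y ^ j := by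
      intro j
      have i1 : ((s : ℤ) - j) = ((s : ℤ) + 1 - j) - 1 := by ring
      have i2 : (((s + 1 : ℕ) : ℤ) - j) = (s : ℤ) + 1 - j := by push_cast; ring
      rw [i1, i2, ← invC_pred ((s : ℤ) + 1 - j), ← invC_pred (j : ℤ)]
      have e1 : (q : ℂ) ^ (s + 1) = (q : ℂ) ^ ((s : ℤ) + 1 - j) * (q : ℂ) ^ (j : ℤ) := by
        rw [← zpow_add₀ q_ne, ← zpow_natCast]; congr 1; push_cast; ring
      have e2 : (q : ℂ) ^ ((j : ℤ) ^ 2 - j * s) = (q : ℂ) ^ ((j : ℤ) ^ 2 - j * ((s : ℤ) + 1)) * (q : ℂ) ^ (j : ℤ) := by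
        rw [← zpow_add₀ q_ne]; congr 1; ring
      rw [e1, e2]; push_cast; ring
    rw [Finset.mul_sum, Finset.sum_congr rfl (fun c _ => hA c), Finset.sum_add_distrib]
    congr 1
    · rw [Finset.sum_range_succ _ (s + 1)]
      rw [invQ_neg (n := (s : ℤ) - ((s + 1 : ℕ) : ℤ)) (by push_cast; omega)]
      simp
    · rw [Finset.sum_range_succ' _ (s + 1)]
      rw [invQ_neg (n := ((0 : ℕ) : ℤ) - 1) (by norm_num)]
      simp only [Complex.ofReal_zero, zero_mul, add_zero]
      rw [Finset.mul_sum]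
      refine Finset.sum_congr rfl fun c hc => ?_
      have i1 : ((c + 1 : ℕ) : ℤ) - 1 = c := by push_cast; ring
      have i2 : (s : ℤ) + 1 - ((c + 1 : ℕ) : ℤ) = s - c := by push_cast; ring
      rw [i1, i2]
      have e : (q : ℂ) ^ (((c + 1 : ℕ) : ℤ) ^ 2 - ((c + 1 : ℕ) : ℤ) * ((s : ℤ) + 1)) =
        (q : ℂ) ^ (-(s : ℤ)) * (q : ℂ) ^ c * (q : ℂ) ^ ((c : ℤ) ^ 2 - c * s) := by
        rw [← zpow_natCast (q : ℂ) c, ← zpow_add₀ q_ne, ← zpow_add₀ q_ne]; congr 1; push_cast; ring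
      rw [e]; ring

theorem D_c (v : ℤ) : E q q * ∑' e : ℕ, (q : ℂ) ^ ((e : ℤ) ^ 2 + e * v) * (invQ q e : ℂ) * (invQ q (e + v) : ℂ) = 1 := by
  rw [← g_zero (q := q) ((q : ℂ) ^ v), g, ← tsum_mul_left]
  refine tsum_congr fun c => ?_
  have e1 : (q : ℂ) ^ v * (q : ℂ) ^ (c + 1) = (q : ℂ) ^ (((c : ℤ) + v) + 1) := by
    rw [← zpow_natCast, ← zpow_add₀ q_ne]; congr 1; push_cast; ring
  rw [e1, E_q_zpow]
  have e2 : (q : ℂ) ^ ((c : ℤ) ^ 2 + c * v) = ((q : ℂ) ^ v) ^ c * (q : ℂ) ^ ((c : ℤ) ^ 2 - (0 : ℕ) * c) := by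
    rw [← zpow_natCast ((q : ℂ) ^ v), ← zpow_mul, ← zpow_add₀ q_ne]; congr 1; push_cast; ring
  rw [e2]; ring

theorem D_r (v : ℤ) : qPInf q q * ∑' e : ℕ, q ^ ((e : ℤ) ^ 2 + e * v) * invQ q e * invQ q (e + v) = 1 := by
  have := D_c (q := q) v
  rw [← qPInf_eq] at this
  exact_mod_cast this

end
end GP
end

section
namespace GP
open Filter Topology

theorem ch2_succ (n : ℤ) : ch2 (n + 1) = ch2 n + n := by
  have h1 := ch2_two n
  have h2 := ch2_two (n + 1)
  linarith

section
variable {q : ℝ} [hq : Fact (0 < q ∧ q < 1)]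

theorem E_int_term {Y : ℂ} (n : ℕ) : (-Y) ^ n * (q : ℂ) ^ (n.choose 2) * (invQ q n : ℂ) =
    (-Y) ^ (n : ℤ) * (q : ℂ) ^ (ch2 n) * (invQ q n : ℂ) := by
  rw [ch2_nat, zpow_natCast, zpow_natCast]

theorem E_int (Y : ℂ) : E q Y = ∑' n : ℤ, (-Y) ^ n * (q : ℂ) ^ (ch2 n) * (invQ q n : ℂ) := by
  rw [tsum_int_nat _ (fun n hn => by rw [invQ_neg hn]; simp), E]
  exact tsum_congr fun n => E_int_term n

theorem E_int_summ_norm (Y : ℂ) : Summable (fun n : ℤ => ‖(-Y) ^ n * (q : ℂ) ^ (ch2 n) * (invQ q n : ℂ)‖) := by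
  rw [summable_int_nat _ (fun n hn => by rw [invQ_neg hn]; simp)]
  exact (E_summ_norm (q := q) Y).congr fun n => by rw [E_int_term n]

def theta (q : ℝ) (X : ℂ) : ℂ := E q X * E q (q / X)

theorem theta_inv {X : ℂ} (hX : X ≠ 0) : theta q X⁻¹ = - X⁻¹ * theta q X := by
  unfold theta
  have e1 : (q : ℂ) / X⁻¹ = X * q := by field_simp
  have e2 : (q : ℂ) / X = X⁻¹ * q := by field_simp
  rw [e1, e2, E_fe X, E_fe X⁻¹]
  field_simp; ring

theorem theta_q {X : ℂ} (hX : X ≠ 0) : theta q (X * q) = - X⁻¹ * theta q X := by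
  rw [← theta_inv hX]
  unfold theta
  have e1 : (q : ℂ) / X⁻¹ = X * q := by field_simp
  have e2 : (q : ℂ) / (X * q) = X⁻¹ := by have := q_ne (q := q); field_simp
  rw [e1, e2, mul_comm]

theorem theta_shift {X : ℂ} (hX : X ≠ 0) (r : ℤ) :
    theta q (X * (q : ℂ) ^ r) = (-X) ^ (-r) * (q : ℂ) ^ (-ch2 r) * theta q X := by
  have hqn := q_ne (q := q)
  have hX' : -X ≠ 0 := neg_ne_zero.mpr hX
  have step : ∀ r : ℤ, theta q (X * (q : ℂ) ^ (r + 1)) = (-X)⁻¹ * (q : ℂ) ^ (-r) * theta q (X * (q : ℂ) ^ r) := by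
    intro r
    rw [zpow_add₀ hqn, zpow_one, ← mul_assoc, theta_q (mul_ne_zero hX (zpow_ne_zero _ hqn)), zpow_neg,
      mul_inv, inv_neg]
    ring
  have fac : ∀ r : ℤ, (-X) ^ (-(r + 1)) * (q : ℂ) ^ (-ch2 (r + 1)) =
      (-X)⁻¹ * (q : ℂ) ^ (-r) * ((-X) ^ (-r) * (q : ℂ) ^ (-ch2 r)) := by
    intro r
    rw [ch2_succ, neg_add, zpow_add₀ hX', neg_add, zpow_add₀ hqn, zpow_neg_one]; ring
  induction r using Int.induction_on with
  | zero => simp [ch2]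
  | succ n ih => rw [step, ih, fac]; ring
  | pred n ih =>
    have h1 := step (-(n : ℤ) - 1)
    have h2 := fac (-(n : ℤ) - 1)
    rw [sub_add_cancel] at h1 h2
    rw [ih, h2] at h1
    have : (-X)⁻¹ * (q : ℂ) ^ (-(-(n : ℤ) - 1)) ≠ 0 := mul_ne_zero (inv_ne_zero hX') (zpow_ne_zero _ hqn)
    apply mul_left_cancel₀ this
    rw [← h1]; ring

theorem JTP_aux {X : ℂ} (hX : X ≠ 0) (n j : ℤ) :
    ((-X) ^ (n + j) * (q : ℂ) ^ (ch2 (n + j)) * (invQ q (n + j) : ℂ)) *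
    ((-((q : ℂ) / X)) ^ j * (q : ℂ) ^ (ch2 j) * (invQ q j : ℂ)) =
    (-X) ^ n * (q : ℂ) ^ (ch2 n) * ((q : ℂ) ^ (j ^ 2 + j * n) * (invQ q j : ℂ) * (invQ q (j + n) : ℂ)) := by
  have hqn := q_ne (q := q)
  have hX' : -X ≠ 0 := neg_ne_zero.mpr hX
  have e1 : -((q : ℂ) / X) = (-X)⁻¹ * q := by field_simp
  have e2 : (q : ℂ) ^ (ch2 (n + j)) * ((q : ℂ) ^ j * (q : ℂ) ^ (ch2 j)) = (q : ℂ) ^ (ch2 n) * (q : ℂ) ^ (j ^ 2 + j * n) := by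
    rw [← zpow_add₀ hqn, ← zpow_add₀ hqn, ← zpow_add₀ hqn]
    congr 1
    have h1 := ch2_two n
    have h2 := ch2_two j
    have h3 := ch2_two (n + j)
    nlinarith
  rw [e1, mul_zpow, zpow_add₀ hX', inv_zpow, add_comm j n]
  have h3 : (-X) ^ j ≠ 0 := zpow_ne_zero _ hX'
  rw [show (-X) ^ n * (-X) ^ j * (q : ℂ) ^ (ch2 (n + j)) * (invQ q (n + j) : ℂ) * (((-X) ^ j)⁻¹ * (q : ℂ) ^ j * (q : ℂ) ^ (ch2 j) * (invQ q j : ℂ))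
    = (-X) ^ n * ((-X) ^ j * ((-X) ^ j)⁻¹) * ((q : ℂ) ^ (ch2 (n + j)) * ((q : ℂ) ^ j * (q : ℂ) ^ (ch2 j))) * (invQ q (n + j) : ℂ) * (invQ q j : ℂ) by ring,
    e2, mul_inv_cancel₀ h3]
  ring

def shearE : ℤ × ℤ ≃ ℤ × ℤ where
  toFun x := (x.1 + x.2, x.2)
  invFun x := (x.1 - x.2, x.2)
  left_inv x := by simp
  right_inv x := by simp

theorem D_int (v : ℤ) : ∑' e : ℤ, (q : ℂ) ^ (e ^ 2 + e * v) * (invQ q e : ℂ) * (invQ q (e + v) : ℂ) = (E q q)⁻¹ := by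
  rw [tsum_int_nat _ (fun n hn => by rw [invQ_neg hn]; simp)]
  exact eq_inv_of_mul_eq_one_right (D_c v)

theorem JTP {X : ℂ} (hX : X ≠ 0) : HasSum (fun n : ℤ => (-X) ^ n * (q : ℂ) ^ (ch2 n)) (theta q X * E q q) := by
  have hE := Eq_ne (q := q)
  have s := summable_mul_of_summable_norm (E_int_summ_norm (q := q) X) (E_int_summ_norm (q := q) (q / X))
  have h := tsum_mul_tsum_of_summable_norm (E_int_summ_norm (q := q) X) (E_int_summ_norm (q := q) (q / X))
  rw [← E_int, ← E_int, ← shearE.tsum_eq] at h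
  have s2 := (shearE.summable_iff).mpr s
  have e : ∀ x : ℤ × ℤ, (fun z : ℤ × ℤ => ((-X) ^ z.1 * (q : ℂ) ^ (ch2 z.1) * (invQ q z.1 : ℂ)) * ((-((q : ℂ) / X)) ^ z.2 * (q : ℂ) ^ (ch2 z.2) * (invQ q z.2 : ℂ))) (shearE x)
     = (-X) ^ x.1 * (q : ℂ) ^ (ch2 x.1) * ((q : ℂ) ^ (x.2 ^ 2 + x.2 * x.1) * (invQ q x.2 : ℂ) * (invQ q (x.2 + x.1) : ℂ)) :=
    fun x => JTP_aux hX x.1 x.2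
  rw [show theta q X = E q X * E q (q / X) from rfl, h]
  have s3 : Summable (fun x : ℤ × ℤ => (-X) ^ x.1 * (q : ℂ) ^ (ch2 x.1) * ((q : ℂ) ^ (x.2 ^ 2 + x.2 * x.1) * (invQ q x.2 : ℂ) * (invQ q (x.2 + x.1) : ℂ))) :=
    s2.congr e
  have h3 := s3.hasSum.prod_fiberwise (fun n => (s3.prod_factor n).hasSum)
  simp only [tsum_mul_left, D_int] at h3
  rw [tsum_congr e]
  have h4 := h3.mul_right (E q q)
  simpa [mul_assoc, inv_mul_cancel₀ hE] using h4

/-! bounds -/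

instance : Fact (0 < √q ∧ √q < 1) := ⟨Real.sqrt_pos.mpr hq.out.1, by
  rw [Real.sqrt_lt' one_pos]; simpa using hq.out.2⟩

theorem sqrt_sq_q : √q * √q = q := Real.mul_self_sqrt hq.out.1.le

theorem q_zpow_sqrt (n : ℤ) : q ^ n = √q ^ (2 * n) := by
  have h := sqrt_sq_q (q := q)
  conv_lhs => rw [← h]
  rw [zpow_mul]; congr 1; rw [zpow_ofNat, sq]

/-- constant -/
def MEp (q z : ℝ) : ℝ := CQ q * ∑' n : ℤ, (z / √q) ^ n * √q ^ (n ^ 2)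

theorem MEp_nonneg {z : ℝ} (hz : 0 ≤ z) : 0 ≤ MEp q z := by
  have := (inferInstance : Fact (0 < √q ∧ √q < 1)).out.1
  exact mul_nonneg (CQ_pos q).le (tsum_nonneg fun n => by positivity)

theorem Ep_bound {z : ℝ} (hz : 0 < z) (a : ℤ) : Ep q (z * q ^ a) ≤ MEp q z * ((√q / z) ^ a * √q ^ (-a ^ 2)) := by
  have hp := (inferInstance : Fact (0 < √q ∧ √q < 1)).out.1
  have h0 := hq.out.1
  have hs := summ_gauss (p := √q) (t := z / √q) (by positivity)
  have inj : Function.Injective (fun s : ℕ => (s : ℤ) + a) := fun x y h => by simpa using h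
  have h1 : ∑' s : ℕ, (z / √q) ^ ((s : ℤ) + a) * √q ^ (((s : ℤ) + a) ^ 2) ≤ ∑' n : ℤ, (z / √q) ^ n * √q ^ (n ^ 2) :=
    tsum_comp_le_tsum_of_inj hs (fun n => by positivity) inj
  have hs2 : Summable (fun s : ℕ => (z / √q) ^ ((s : ℤ) + a) * √q ^ (((s : ℤ) + a) ^ 2)) := hs.comp_injective inj
  have h2 : Ep q (z * q ^ a) ≤ ∑' s : ℕ, CQ q * ((√q / z) ^ a * √q ^ (-a ^ 2)) * ((z / √q) ^ ((s : ℤ) + a) * √q ^ (((s : ℤ) + a) ^ 2)) := by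
    refine (Ep_summ (by positivity)).tsum_le_tsum (fun s => ?_) (hs2.mul_left _)
    have e : (z * q ^ a) ^ s * q ^ (s.choose 2) = ((√q / z) ^ a * √q ^ (-a ^ 2)) * ((z / √q) ^ ((s : ℤ) + a) * √q ^ (((s : ℤ) + a) ^ 2)) := by
      rw [show √q / z = (z / √q)⁻¹ by rw [inv_div], inv_zpow, zpow_add₀ (by positivity : z / √q ≠ 0)]
      have hne : (z / √q) ^ a ≠ 0 := by positivity
      rw [show ((z / √q) ^ a)⁻¹ * √q ^ (-a ^ 2) * ((z / √q) ^ (s : ℤ) * (z / √q) ^ a * √q ^ (((s : ℤ) + a) ^ 2))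
        = (((z / √q) ^ a)⁻¹ * (z / √q) ^ a) * (z / √q) ^ (s : ℤ) * (√q ^ (-a ^ 2) * √q ^ (((s : ℤ) + a) ^ 2)) by ring,
        inv_mul_cancel₀ hne, one_mul, ← zpow_add₀ hp.ne', zpow_natCast, div_pow, mul_pow,
        ← zpow_natCast q, ← zpow_natCast (q ^ a), ← zpow_mul, mul_assoc, ← zpow_add₀ h0.ne', q_zpow_sqrt, div_mul_eq_mul_div,
        mul_div_assoc, ← zpow_natCast √q, ← zpow_sub₀ hp.ne']
      congr 2
      have := ch2_two s
      rw [ch2_nat] at this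
      linarith
    rw [e, mul_comm _ (invQ q s), mul_assoc (CQ q)]
    exact mul_le_mul_of_nonneg_right (invQ_le _) (by positivity)
  rw [tsum_mul_left] at h2
  refine h2.trans ?_
  rw [MEp, mul_assoc, mul_assoc (CQ q), mul_comm (∑' n : ℤ, (z / √q) ^ n * √q ^ (n ^ 2))]
  exact mul_le_mul_of_nonneg_left (mul_le_mul_of_nonneg_left h1 (by positivity)) (CQ_pos q).le

theorem E_bound {Z : ℂ} (hZ : Z ≠ 0) (a : ℤ) :
    ‖E q (Z * (q : ℂ) ^ a)‖ ≤ MEp q ‖Z‖ * ((√q / ‖Z‖) ^ a * √q ^ (-a ^ 2)) := by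
  refine (E_le _).trans ?_
  rw [norm_mul, norm_zpow, norm_q]
  exact Ep_bound (norm_pos_iff.mpr hZ) a

end
end GP
end

section
namespace GP
open Filter Topology

def K (q : ℝ) (Z : ℂ) (N r : ℤ) : ℂ := E q (Z * (q : ℂ) ^ (N + r)) * (invQ q (N - r) : ℂ)

def GB (q : ℝ) (γ : ℤ → ℂ) : Prop :=
  ∃ C D : ℝ, 0 ≤ C ∧ 0 < D ∧ ∀ r, ‖γ r‖ ≤ C * (D ^ r.natAbs * q ^ (2 * r ^ 2))

theorem zpow_le_natAbs {t : ℝ} (ht : 0 < t) (n : ℤ) : t ^ n ≤ (max t t⁻¹) ^ n.natAbs := by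
  rcases le_total 0 n with h | h
  · lift n to ℕ using h
    simp only [Int.natAbs_natCast, zpow_natCast]
    exact pow_le_pow_left₀ ht.le (le_max_left _ _) _
  · obtain ⟨m, rfl⟩ : ∃ m : ℕ, n = -(m : ℤ) := ⟨n.natAbs, by omega⟩
    simp only [Int.natAbs_neg, Int.natAbs_natCast, zpow_neg, zpow_natCast, ← inv_pow]
    exact pow_le_pow_left₀ (inv_pos.mpr ht).le (le_max_right _ _) _

section
variable {q : ℝ} [hq : Fact (0 < q ∧ q < 1)]

theorem q_zpow_le_one {n : ℤ} (h : 0 ≤ n) : q ^ n ≤ 1 := by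
  lift n to ℕ using h
  rw [zpow_natCast]; exact pow_le_one₀ hq.out.1.le hq.out.2.le

theorem GB.add {γ δ : ℤ → ℂ} (h1 : GB q γ) (h2 : GB q δ) : GB q (fun r => γ r + δ r) := by
  have h0 := hq.out.1
  obtain ⟨C, D, hC, hD, h⟩ := h1
  obtain ⟨C', D', hC', hD', h'⟩ := h2
  refine ⟨C + C', max D D', by positivity, by positivity, fun r => (norm_add_le _ _).trans ?_⟩
  rw [add_mul]
  refine add_le_add ((h r).trans ?_) ((h' r).trans ?_)
  · gcongr; exact le_max_left _ _
  · gcongr; exact le_max_right _ _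

theorem GB.neg {γ : ℤ → ℂ} (h1 : GB q γ) : GB q (fun r => - γ r) := by
  obtain ⟨C, D, hC, hD, h⟩ := h1
  exact ⟨C, D, hC, hD, fun r => by rw [norm_neg]; exact h r⟩

theorem GB.mul {γ : ℤ → ℂ} (h1 : GB q γ) {t : ℂ} (ht : t ≠ 0) (j : ℕ) :
    GB q (fun r => t ^ r * (q : ℂ) ^ (j * r ^ 2) * γ r) := by
  have h0 := hq.out.1
  obtain ⟨C, D, hC, hD, h⟩ := h1
  have htp := norm_pos_iff.mpr ht
  refine ⟨C, max ‖t‖ ‖t‖⁻¹ * D, hC, by positivity, fun r => ?_⟩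
  rw [norm_mul, norm_mul, norm_zpow, norm_zpow, norm_q]
  calc ‖t‖ ^ r * q ^ (j * r ^ 2) * ‖γ r‖ ≤ (max ‖t‖ ‖t‖⁻¹) ^ r.natAbs * 1 * (C * (D ^ r.natAbs * q ^ (2 * r ^ 2))) := by
        gcongr
        · exact zpow_le_natAbs htp r
        · exact q_zpow_le_one (by positivity)
        · exact h r
    _ = _ := by rw [mul_pow]; ring

theorem GB_basic (c : ℂ) {t : ℂ} (ht : t ≠ 0) : GB q (fun r => c * t ^ r * (q : ℂ) ^ (2 * r ^ 2)) := by
  have h0 := hq.out.1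
  have htp := norm_pos_iff.mpr ht
  refine ⟨‖c‖, max ‖t‖ ‖t‖⁻¹, by positivity, by positivity, fun r => ?_⟩
  rw [norm_mul, norm_mul, norm_zpow, norm_zpow, norm_q, mul_assoc]
  gcongr
  exact zpow_le_natAbs htp r

theorem GB.congr {γ δ : ℤ → ℂ} (h1 : GB q γ) (h : ∀ r, δ r = γ r) : GB q δ := by
  rwa [show δ = γ from funext h]

theorem swap_summ {γ : ℤ → ℂ} (hγ : GB q γ) {Z W : ℂ} (hZ : Z ≠ 0) (hW : W ≠ 0) {u : ℤ → ℂ} {U : ℝ}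
    (hu : ∀ n, ‖u n‖ ≤ U) :
    Summable (fun x : ℤ × ℤ => ‖u x.2 * (W ^ x.2 * (q : ℂ) ^ (x.2 ^ 2)) * (γ x.1 * K q Z x.2 x.1)‖) := by
  obtain ⟨C, D, hC, hD, h⟩ := hγ
  have h0 := hq.out.1
  have hp := (inferInstance : Fact (0 < √q ∧ √q < 1)).out.1
  have hZp := norm_pos_iff.mpr hZ
  have hWp := norm_pos_iff.mpr hW
  set τ := √q / ‖Z‖ with hτ
  have hτp : 0 < τ := by positivity
  have hU : 0 ≤ U := (norm_nonneg _).trans (hu 0)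
  have hM := MEp_nonneg (q := q) hZp.le
  have hCQ := CQ_pos q
  have s1 := summ_gauss_abs (p := q) hD (t := ‖W‖ * τ ^ 2) (by positivity)
  have s2 := summ_gauss (p := √q) (t := ‖W‖ * τ) (by positivity)
  have s3 := (s1.mul_of_nonneg s2 (fun r => by positivity) (fun r => by positivity)).mul_left (U * C * MEp q ‖Z‖ * CQ q)
  let e : ℤ × ℤ ≃ ℤ × ℤ :=
    { toFun := fun x => (x.1, x.1 + x.2), invFun := fun x => (x.1, x.2 - x.1),
      left_inv := fun x => by simp, right_inv := fun x => by simp }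
  rw [← e.summable_iff]
  refine s3.of_nonneg_of_le (fun x => norm_nonneg _) (fun x => ?_)
  obtain ⟨r, c⟩ := x
  simp only [Function.comp, e, Equiv.coe_fn_mk, K]
  rw [norm_mul, norm_mul, norm_mul, norm_mul, norm_mul, norm_zpow, norm_zpow, norm_q]
  calc ‖u (r + c)‖ * (‖W‖ ^ (r + c) * q ^ ((r + c) ^ 2)) * (‖γ r‖ * (‖E q (Z * (q : ℂ) ^ (r + c + r))‖ * ‖(invQ q (r + c - r) : ℂ)‖))
      ≤ U * (‖W‖ ^ (r + c) * q ^ ((r + c) ^ 2)) * ((C * (D ^ r.natAbs * q ^ (2 * r ^ 2))) * (MEp q ‖Z‖ * (τ ^ (r + c + r) * √q ^ (-(r + c + r) ^ 2)) * CQ q)) := by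
        gcongr
        · exact hu _
        · exact h r
        · exact E_bound hZ _
        · exact norm_inv_le _
    _ = _ := by
        have e1 : ‖W‖ ^ (r + c) = ‖W‖ ^ r * ‖W‖ ^ c := zpow_add₀ hWp.ne' _ _
        have e2 : τ ^ (r + c + r) = (τ ^ 2) ^ r * τ ^ c := by
          rw [← zpow_natCast τ, ← zpow_mul, ← zpow_add₀ hτp.ne']; congr 1; push_cast; ring
        have e3 : q ^ ((r + c) ^ 2) * q ^ (2 * r ^ 2) * √q ^ (-(r + c + r) ^ 2) = q ^ (r ^ 2) * √q ^ (c ^ 2) := by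
          rw [q_zpow_sqrt, q_zpow_sqrt (2 * r ^ 2), q_zpow_sqrt (r ^ 2), ← zpow_add₀ hp.ne', ← zpow_add₀ hp.ne', ← zpow_add₀ hp.ne']
          congr 1; ring
        rw [e1, e2, mul_zpow, mul_zpow]
        calc _ = U * C * MEp q ‖Z‖ * CQ q * (D ^ r.natAbs * (‖W‖ ^ r * (τ ^ 2) ^ r) * (‖W‖ ^ c * τ ^ c)) *
              (q ^ ((r + c) ^ 2) * q ^ (2 * r ^ 2) * √q ^ (-(r + c + r) ^ 2)) := by ring
          _ = _ := by rw [e3]; ring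

theorem GB.summ {γ : ℤ → ℂ} (hγ : GB q γ) {Z : ℂ} (hZ : Z ≠ 0) (N : ℤ) :
    Summable (fun r => γ r * K q Z N r) := by
  have h := (swap_summ (W := 1) hγ hZ one_ne_zero (u := fun _ => 1) (U := 1) (by simp)).of_norm
  have h2 := (h.prod_symm).prod_factor N
  simp only [Prod.swap, one_zpow, one_mul] at h2
  have hne : (q : ℂ) ^ (N ^ 2) ≠ 0 := zpow_ne_zero _ q_ne
  exact (summable_mul_left_iff hne).mp h2

theorem bailey {γ : ℤ → ℂ} (hγ : GB q γ) {Z W : ℂ} (hZ : Z ≠ 0) (hW : W ≠ 0) {u : ℤ → ℂ} {U : ℝ}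
    (hu : ∀ n, ‖u n‖ ≤ U) {v : ℤ → ℂ} (hv : ∀ N, HasSum (fun r => γ r * K q Z N r) (v N)) :
    HasSum (fun r => γ r * ∑' N, u N * (W ^ N * (q : ℂ) ^ (N ^ 2)) * K q Z N r)
      (∑' N, u N * (W ^ N * (q : ℂ) ^ (N ^ 2)) * v N) := by
  have s := (swap_summ hγ hZ hW hu).of_norm
  have a1 := s.hasSum.prod_fiberwise (fun r => (s.prod_factor r).hasSum)
  have a2 := s.prod_symm.hasSum.prod_fiberwise (fun N => (s.prod_symm.prod_factor N).hasSum)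
  have e1 : ∑' (z : ℤ × ℤ), u z.2 * (W ^ z.2 * (q : ℂ) ^ (z.2 ^ 2)) * (γ z.1 * K q Z z.2 z.1) =
      ∑' N, u N * (W ^ N * (q : ℂ) ^ (N ^ 2)) * v N := by
    rw [← (Equiv.prodComm ℤ ℤ).tsum_eq]
    have := a2.tsum_eq
    rw [show (∑' (z : ℤ × ℤ), (fun z : ℤ × ℤ => u z.2 * (W ^ z.2 * (q : ℂ) ^ (z.2 ^ 2)) * (γ z.1 * K q Z z.2 z.1)) ((Equiv.prodComm ℤ ℤ) z)) = _ from this.symm]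
    refine tsum_congr fun N => ?_
    simp only [Prod.swap]
    rw [tsum_mul_left, (hv N).tsum_eq]
  rw [e1] at a1
  refine a1.congr_fun ?_
  intro r
  simp only
  rw [← tsum_mul_left]
  refine tsum_congr fun N => ?_
  ring

theorem step_id {Z : ℂ} (hZ : Z ≠ 0) (L r : ℤ) :
    ∑' N, (invQ q (L - N) : ℂ) * ((Z / q) ^ N * (q : ℂ) ^ (N ^ 2)) * K q Z N r
      = (Z / q) ^ r * (q : ℂ) ^ (r ^ 2) * K q Z L r := by
  have hqn := q_ne (q := q)
  have hZq : Z / (q : ℂ) ≠ 0 := div_ne_zero hZ hqn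
  rw [← (Equiv.addLeft r).tsum_eq]
  simp only [Equiv.coe_addLeft, K]
  rw [tsum_int_nat _ (fun n hn => by rw [invQ_neg (n := r + n - r) (by omega)]; simp)]
  set Y := Z / q * (q : ℂ) ^ (2 * r) with hY
  have hterm : ∀ c : ℕ, (invQ q (L - (r + c)) : ℂ) * ((Z / q) ^ (r + (c : ℤ)) * (q : ℂ) ^ ((r + (c : ℤ)) ^ 2)) *
      (E q (Z * (q : ℂ) ^ (r + c + r)) * (invQ q (r + c - r) : ℂ)) =
      (Z / q) ^ r * (q : ℂ) ^ (r ^ 2) * ((invQ q c : ℂ) * (invQ q ((L - r) - c) : ℂ) * Y ^ c * (q : ℂ) ^ (c ^ 2) * E q (Y * q ^ (c + 1))) := by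
    intro c
    have e1 : Y * (q : ℂ) ^ (c + 1) = Z * (q : ℂ) ^ (r + c + r) := by
      rw [hY, ← zpow_natCast (q : ℂ) (c + 1), div_mul_eq_mul_div, mul_div_assoc, mul_assoc]
      congr 1
      rw [div_mul_eq_mul_div, ← zpow_add₀ hqn, div_eq_iff hqn, ← zpow_add_one₀ hqn]
      congr 1; push_cast; ring
    have e2 : r + (c : ℤ) - r = c := by ring
    have e3 : L - (r + c) = L - r - c := by ring
    have e4 : (q : ℂ) ^ ((r + (c : ℤ)) ^ 2) = (q : ℂ) ^ (r ^ 2) * ((q : ℂ) ^ (2 * r)) ^ c * (q : ℂ) ^ (c ^ 2) := by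
      rw [← zpow_natCast ((q : ℂ) ^ (2 * r)), ← zpow_mul, ← zpow_natCast (q : ℂ) (c ^ 2), ← zpow_add₀ hqn, ← zpow_add₀ hqn]
      congr 1; push_cast; ring
    rw [e1, e2, e3, e4, hY, zpow_add₀ hZq, zpow_natCast, mul_pow]; ring
  rw [tsum_congr hterm, tsum_mul_left]
  congr 1
  rcases lt_or_ge (L - r) 0 with h | h
  · rw [invQ_neg h]
    simp only [Complex.ofReal_zero, mul_zero]
    convert tsum_zero with c
    rw [invQ_neg (n := L - r - c) (by omega)]; simp
  · obtain ⟨n, hn⟩ := Int.eq_ofNat_of_zero_le h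
    rw [hn]
    rw [tsum_eq_sum (s := Finset.range (n + 1))]
    · rw [step_fin]
      have e1 : Y * (q : ℂ) ^ (n + 1) = Z * (q : ℂ) ^ (L + r) := by
        have : L + r = n + 2 * r := by omega
        rw [this, hY, ← zpow_natCast (q : ℂ) (n + 1), div_mul_eq_mul_div, mul_div_assoc, mul_assoc]
        congr 1
        rw [div_mul_eq_mul_div, ← zpow_add₀ hqn, div_eq_iff hqn, ← zpow_add_one₀ hqn]
        congr 1; push_cast; ring
      rw [e1]; ring
    · intro c hc
      have : ¬ c < n + 1 := by simpa using hc
      rw [invQ_neg (n := (n : ℤ) - c) (by omega)]; simp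

theorem final_id {Z : ℂ} (hZ : Z ≠ 0) (s : ℕ) (r : ℤ) :
    ∑' N, (1 : ℂ) * ((Z / q * (q : ℂ) ^ (-(s : ℤ))) ^ N * (q : ℂ) ^ (N ^ 2)) * K q Z N r
      = (Z / q * (q : ℂ) ^ (-(s : ℤ))) ^ r * (q : ℂ) ^ (r ^ 2) * g q s (Z / q * (q : ℂ) ^ (2 * r)) := by
  have hqn := q_ne (q := q)
  have hZq : Z / (q : ℂ) ≠ 0 := div_ne_zero hZ hqn
  rw [← (Equiv.addLeft r).tsum_eq]
  simp only [Equiv.coe_addLeft, K]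
  rw [tsum_int_nat _ (fun n hn => by rw [invQ_neg (n := r + n - r) (by omega)]; simp)]
  set Y := Z / q * (q : ℂ) ^ (2 * r) with hY
  rw [g, ← tsum_mul_left]
  refine tsum_congr fun c => ?_
  have e1 : Y * (q : ℂ) ^ (c + 1) = Z * (q : ℂ) ^ (r + c + r) := by
    rw [hY, ← zpow_natCast (q : ℂ) (c + 1), div_mul_eq_mul_div, mul_div_assoc, mul_assoc]
    congr 1
    rw [div_mul_eq_mul_div, ← zpow_add₀ hqn, div_eq_iff hqn, ← zpow_add_one₀ hqn]
    congr 1; push_cast; ring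
  have e2 : r + (c : ℤ) - r = c := by ring
  have e4 : (q : ℂ) ^ (r ^ 2) * ((q : ℂ) ^ (2 * r)) ^ c * (q : ℂ) ^ ((c : ℤ) ^ 2 - s * c) =
      (q : ℂ) ^ ((r + (c : ℤ)) ^ 2) * (q : ℂ) ^ (-(s : ℤ) * c) := by
    rw [← zpow_natCast ((q : ℂ) ^ (2 * r)), ← zpow_mul, ← zpow_add₀ hqn, ← zpow_add₀ hqn, ← zpow_add₀ hqn]
    congr 1; push_cast; ring
  have hW : Z / q * (q : ℂ) ^ (-(s : ℤ)) ≠ 0 := mul_ne_zero hZq (zpow_ne_zero _ hqn)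
  rw [e1, e2, zpow_add₀ hW, zpow_natCast, mul_pow _ _ c, ← zpow_natCast ((q : ℂ) ^ (-(s : ℤ))) c, ← zpow_mul]
  rw [hY, mul_pow (Z / (q : ℂ))]
  linear_combination (-(Z / (q : ℂ) * (q : ℂ) ^ (-(s : ℤ))) ^ r * (Z / (q : ℂ)) ^ c * (invQ q c : ℂ) * E q (Z * (q : ℂ) ^ (r + c + r))) * e4

/-- Bailey pair predicate -/
def BP (q : ℝ) (Z : ℂ) (γ v : ℤ → ℂ) : Prop := GB q γ ∧ ∀ N, HasSum (fun r => γ r * K q Z N r) (v N)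

theorem bp_step {Z : ℂ} (hZ : Z ≠ 0) {γ v : ℤ → ℂ} (h : BP q Z γ v) :
    BP q Z (fun r => (Z / q) ^ r * (q : ℂ) ^ (r ^ 2) * γ r)
      (fun L => ∑' N, (invQ q (L - N) : ℂ) * ((Z / q) ^ N * (q : ℂ) ^ (N ^ 2) * v N)) := by
  have hZq : Z / (q : ℂ) ≠ 0 := div_ne_zero hZ q_ne
  refine ⟨(h.1.mul hZq 1).congr fun r => by simp, fun L => ?_⟩
  have := bailey h.1 hZ hZq (u := fun N => (invQ q (L - N) : ℂ)) (fun n => norm_inv_le _) h.2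
  simp only [step_id hZ] at this
  convert this using 1
  · funext r; ring
  · refine tsum_congr fun N => ?_
    ring

theorem bp_final {Z : ℂ} (hZ : Z ≠ 0) {γ v : ℤ → ℂ} (h : BP q Z γ v) (s : ℕ) :
    HasSum (fun r => γ r * ((Z / q * (q : ℂ) ^ (-(s : ℤ))) ^ r * (q : ℂ) ^ (r ^ 2) * g q s (Z / q * (q : ℂ) ^ (2 * r))))
      (∑' N, (Z / q * (q : ℂ) ^ (-(s : ℤ))) ^ N * (q : ℂ) ^ (N ^ 2) * v N) := by
  have hZq : Z / (q : ℂ) ≠ 0 := div_ne_zero hZ q_ne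
  have hW : Z / q * (q : ℂ) ^ (-(s : ℤ)) ≠ 0 := mul_ne_zero hZq (zpow_ne_zero _ q_ne)
  have := bailey h.1 hZ hW (u := fun N => 1) (U := 1) (by simp) h.2
  simp only [final_id hZ] at this
  simpa using this

end
end GP
end

section
namespace GP
open Filter Topology

section
variable {q : ℝ} [hq : Fact (0 < q ∧ q < 1)]

theorem hasSum_int_even_odd {f : ℤ → ℂ} {a : ℂ} (h : HasSum f a) :
    HasSum (fun r : ℤ => f (2 * r) + f (2 * r + 1)) a := by
  have h1 := (Equiv.hasSum_iff (Int.divModEquiv 2).symm).mpr h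
  have h2 := h1.prod_fiberwise (fun b => hasSum_fintype _)
  refine h2.congr_fun ?_
  intro b
  simp [Fin.sum_univ_two, Int.divModEquiv, mul_comm]

def aF (q : ℝ) (X : ℂ) (j : ℕ) (r : ℤ) : ℂ := X ^ ((j : ℤ) * r) * (q : ℂ) ^ ((j : ℤ) * r ^ 2 - r)

theorem aF_two {X : ℂ} (hX : X ≠ 0) (r : ℤ) : aF q X 2 r = (X ^ 2 / q) ^ r * (q : ℂ) ^ (2 * r ^ 2) := by
  have hqn := q_ne (q := q)
  unfold aF
  rw [div_zpow, ← zpow_natCast, ← zpow_mul, zpow_sub₀ hqn]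
  push_cast
  field_simp

theorem telesc {t : ℤ → ℂ} (h : Summable t) : HasSum (fun r => t r - t (r + 1)) 0 := by
  have := h.hasSum.sub ((Equiv.addRight (1 : ℤ)).hasSum_iff.mpr h.hasSum)
  simpa using this

theorem lemA_diff {X : ℂ} (hX : X ≠ 0) (N r : ℤ) :
    aF q X 2 r * (1 - X * (q : ℂ) ^ (2 * r)) * (K q (X * q) N r - K q (X * q) (N - 1) r)
    = aF q X 2 r * (q : ℂ) ^ (N - r) * K q X N r - aF q X 2 (r + 1) * (q : ℂ) ^ (N - (r + 1)) * K q X N (r + 1) := by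
  have hqn := q_ne (q := q)
  unfold K
  have e1 : X * q * (q : ℂ) ^ (N - 1 + r) = X * (q : ℂ) ^ (N + r) := by
    rw [mul_assoc, ← zpow_one_add₀ hqn]; congr 2; ring
  have e2 : X * (q : ℂ) ^ (N + (r + 1)) = X * (q : ℂ) ^ (N + r) * q := by
    rw [mul_assoc, ← zpow_add_one₀ hqn]; congr 2; ring
  have e3 : X * q * (q : ℂ) ^ (N + r) = X * (q : ℂ) ^ (N + r) * q := by ring
  have e4 : N - 1 - r = N - r - 1 := by ring
  have e5 : N - (r + 1) = N - r - 1 := by ring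
  rw [e1, e2, e3, e4, e5, E_fe (X * (q : ℂ) ^ (N + r)), ← invC_pred]
  generalize E q _ = e
  generalize (invQ q (N - r) : ℂ) = i
  have ea : aF q X 2 (r + 1) = aF q X 2 r * (X ^ 2 * (q ^ r) ^ 4 * q) := by
    unfold aF
    rw [show ((2 : ℕ) : ℤ) * (r + 1) ^ 2 - (r + 1) = (((2 : ℕ) : ℤ) * r ^ 2 - r) + (4 * r + 1) by push_cast; ring,
      show ((2 : ℕ) : ℤ) * (r + 1) = ((2 : ℕ) : ℤ) * r + 2 by push_cast; ring, zpow_add₀ hX, zpow_add₀ hqn _ (4 * r + 1),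
      zpow_add_one₀ hqn, mul_comm 4 r, zpow_mul (q : ℂ) r 4]
    simp only [zpow_ofNat]; generalize (q : ℂ) ^ r = w; ring
  rw [ea]
  generalize aF q X 2 r = a
  have hw : (q : ℂ) ^ r ≠ 0 := zpow_ne_zero _ hqn
  rw [mul_comm 2 r, zpow_mul, zpow_sub₀ hqn, zpow_sub₀ hqn, zpow_add₀ hqn, zpow_sub₀ hqn]
  generalize (q : ℂ) ^ r = w at *
  generalize (q : ℂ) ^ N = u at *
  norm_cast
  push_cast
  field_simp
  ring

theorem lemA_GB {X : ℂ} (hX : X ≠ 0) : GB q (fun r => aF q X 2 r * (1 - X * (q : ℂ) ^ (2 * r))) := by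
  have hqn := q_ne (q := q)
  have h1 := GB_basic (q := q) 1 (t := X ^ 2 / q) (by positivity)
  have h2 := (GB_basic (q := q) X (t := X ^ 2 * q) (by positivity)).neg
  refine (h1.add h2).congr fun r => ?_
  rw [aF_two hX, mul_comm 2 r, zpow_mul (q : ℂ) r 2, mul_zpow, div_zpow]
  simp only [zpow_ofNat]
  have hw : (q : ℂ) ^ r ≠ 0 := zpow_ne_zero _ hqn
  generalize (q : ℂ) ^ r = w at *
  field_simp
  ring

theorem lemA_const {X : ℂ} (hX : X ≠ 0) (N : ℤ) :
    ∑' r, aF q X 2 r * (1 - X * (q : ℂ) ^ (2 * r)) * K q (X * q) N r =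
    ∑' r, aF q X 2 r * (1 - X * (q : ℂ) ^ (2 * r)) * K q (X * q) (N - 1) r := by
  have hqn := q_ne (q := q)
  have hXq : X * (q : ℂ) ≠ 0 := mul_ne_zero hX hqn
  have hg := lemA_GB (q := q) hX
  rw [← sub_eq_zero, ← (hg.summ hXq N).tsum_sub (hg.summ hXq (N - 1))]
  have hs : Summable (fun r => aF q X 2 r * (q : ℂ) ^ (N - r) * K q X N r) := by
    refine GB.summ ((GB_basic (q := q) ((q : ℂ) ^ N) (t := X ^ 2 / q / q) (by positivity)).congr fun r => ?_) hX N
    rw [aF_two hX, zpow_sub₀ hqn, div_zpow (X ^ 2 / (q : ℂ)), div_zpow]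
    field_simp
  rw [← (telesc hs).tsum_eq]
  refine tsum_congr fun r => ?_
  rw [← lemA_diff hX]; ring

theorem lemA_lim {X : ℂ} (hX : X ≠ 0) :
    HasSum (fun r => aF q X 2 r * (1 - X * (q : ℂ) ^ (2 * r)) * (E q q)⁻¹) (theta q X) := by
  have hqn := q_ne (q := q)
  have h := (hasSum_int_even_odd (JTP (q := q) hX)).mul_right (E q q)⁻¹
  rw [mul_assoc, mul_inv_cancel₀ Eq_ne, mul_one] at h
  refine h.congr_fun fun r => ?_
  have c1 : ch2 (2 * r) = 2 * r ^ 2 - r := by have := ch2_two (2 * r); linarith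
  rw [ch2_succ, c1, zpow_add₀ hqn, zpow_add_one₀ (neg_ne_zero.mpr hX), (even_two_mul r).neg_zpow]
  unfold aF
  push_cast; ring

theorem lemA_val {X : ℂ} (hX : X ≠ 0) :
    Tendsto (fun N : ℕ => ∑' r, aF q X 2 r * (1 - X * (q : ℂ) ^ (2 * r)) * K q (X * q) N r) atTop (𝓝 (theta q X)) := by
  have h0 := hq.out.1
  have hqn := q_ne (q := q)
  have hXq : X * (q : ℂ) ≠ 0 := mul_ne_zero hX hqn
  have hXp := norm_pos_iff.mpr hXq
  have hp := (inferInstance : Fact (0 < √q ∧ √q < 1)).out.1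
  obtain ⟨C, D, hC, hD, hb⟩ := lemA_GB (q := q) hX
  rw [← (lemA_lim hX).tsum_eq]
  set τ := √q / ‖X * q‖
  have hτ : 0 < τ := by positivity
  have hM := MEp_nonneg (q := q) hXp.le
  have hCQ := CQ_pos q
  have s := (summ_gauss_abs (p := √q) hD (t := τ) hτ.le).mul_left (C * MEp q ‖X * q‖ * CQ q)
  refine tendsto_tsum_of_dominated_convergence s (fun r => ?_) (Eventually.of_forall fun N r => ?_)
  · refine Tendsto.const_mul _ ?_
    unfold K
    have t1 : Tendsto (fun N : ℕ => E q (X * q * (q : ℂ) ^ ((N : ℤ) + r))) atTop (𝓝 1) := by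
      refine E_tendsto ?_
      refine (qpow_tendsto (q := q) (X * q * (q : ℂ) ^ r)).congr fun N => ?_
      rw [zpow_add₀ hqn, zpow_natCast]; ring
    have t2 : Tendsto (fun N : ℕ => (invQ q ((N : ℤ) - r) : ℂ)) atTop (𝓝 (E q q)⁻¹) := by
      have := (invQ_tendsto (q := q))
      have h3 : Tendsto (fun N : ℕ => ((N : ℤ) - r).toNat) atTop atTop := by
        refine tendsto_atTop.mpr fun b => ?_
        filter_upwards [eventually_ge_atTop (b + r.toNat)] with N hN
        omega
      refine (this.comp h3).congr' ?_
      filter_upwards [eventually_ge_atTop (r.toNat)] with N hN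
      simp only [Function.comp]
      rw [Int.toNat_of_nonneg (by omega)]
    simpa using t1.mul t2
  · unfold K
    rw [norm_mul, norm_mul (E q _)]
    have hE : ‖E q (X * q * (q : ℂ) ^ ((N : ℤ) + r))‖ ≤ MEp q ‖X * q‖ * (τ ^ r * √q ^ (-r ^ 2)) := by
      refine (E_le _).trans (le_trans (Ep_mono (norm_nonneg _) ?_) (Ep_bound hXp r))
      rw [norm_mul, norm_zpow, norm_q, zpow_add₀ h0.ne']
      gcongr
      exact mul_le_of_le_one_left (by positivity) (q_zpow_le_one (by positivity))
    calc _ ≤ C * (D ^ r.natAbs * q ^ (2 * r ^ 2)) * (MEp q ‖X * q‖ * (τ ^ r * √q ^ (-r ^ 2)) * CQ q) := by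
          gcongr
          · exact hb r
          · exact norm_inv_le _
      _ ≤ C * (D ^ r.natAbs * q ^ (r ^ 2)) * (MEp q ‖X * q‖ * (τ ^ r * √q ^ (-r ^ 2)) * CQ q) := by
          refine mul_le_mul_of_nonneg_right (mul_le_mul_of_nonneg_left (mul_le_mul_of_nonneg_left ?_ (by positivity)) hC) (by positivity)
          rw [show 2 * r ^ 2 = r ^ 2 + r ^ 2 by ring, zpow_add₀ h0.ne']
          exact mul_le_of_le_one_left (by positivity) (q_zpow_le_one (by positivity))
      _ = _ := by
          have : q ^ (r ^ 2) * √q ^ (-r ^ 2) = √q ^ (r ^ 2) := by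
            rw [q_zpow_sqrt, ← zpow_add₀ hp.ne']; congr 1; ring
          rw [← this]; ring

theorem lemA {X : ℂ} (hX : X ≠ 0) :
    BP q (X * q) (fun r => aF q X 2 r * (1 - X * (q : ℂ) ^ (2 * r))) (fun _ => theta q X) := by
  have hqn := q_ne (q := q)
  have hXq : X * (q : ℂ) ≠ 0 := mul_ne_zero hX hqn
  have hg := lemA_GB (q := q) hX
  refine ⟨hg, fun N => ?_⟩
  set T : ℤ → ℂ := fun N => ∑' r, aF q X 2 r * (1 - X * (q : ℂ) ^ (2 * r)) * K q (X * q) N r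
  have hc : ∀ N : ℤ, T N = T 0 := by
    intro N
    induction N using Int.induction_on with
    | zero => rfl
    | succ i ih => rw [← ih]; have := lemA_const (q := q) hX (i + 1); simpa [T] using this
    | pred i ih => rw [← ih]; have := lemA_const (q := q) hX (-i); exact this.symm
  have hv : T N = theta q X := by
    rw [hc N]
    refine tendsto_nhds_unique ?_ (lemA_val (q := q) hX)
    exact tendsto_const_nhds.congr fun n => (hc n).symm
  rw [← hv]
  exact (hg.summ hXq N).hasSum

end
end GP
end

section
namespace GP
open Filter Topology

def eps (l : ℕ) : ℤ := if l = 0 then 0 else 1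

def beta (q : ℝ) (X : ℂ) : ℕ → ℕ → ℤ → ℂ
  | 0, _, _ => 1
  | j + 1, l, N => ∑' M : ℤ, (invQ q (N - M) : ℂ) * (X ^ M * (q : ℂ) ^ (M ^ 2 - eps l * M) * beta q X j (l - 1) M)

/-- `Phi` for k = j + 1 levels. -/
def Phi (q : ℝ) (X : ℂ) (j l s : ℕ) : ℂ :=
  ∑' N : ℤ, X ^ N * (q : ℂ) ^ (N ^ 2 - (eps l + s) * N) * beta q X j (l - 1) N

def mo (q : ℝ) (X : ℂ) (a b : ℤ) : ℂ := X ^ a * (q : ℂ) ^ b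

section
variable {q : ℝ} [hq : Fact (0 < q ∧ q < 1)]

theorem mo_mul {X : ℂ} (hX : X ≠ 0) (a b c d : ℤ) : mo q X a b * mo q X c d = mo q X (a + c) (b + d) := by
  unfold mo; rw [zpow_add₀ hX, zpow_add₀ (q_ne (q := q))]; ring

theorem mo_zpow {X : ℂ} (a b n : ℤ) : (mo q X a b) ^ n = mo q X (a * n) (b * n) := by
  unfold mo; rw [mul_zpow, zpow_mul, zpow_mul]

theorem mo_X (X : ℂ) : X = mo q X 1 0 := by simp [mo]
theorem mo_q {X : ℂ} (n : ℤ) : (q : ℂ) ^ n = mo q X 0 n := by simp [mo]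
theorem mo_inv {X : ℂ} (a b : ℤ) : mo q X⁻¹ a b = mo q X (-a) b := by simp [mo]
theorem mo_Xq (X : ℂ) : X / q = mo q X 1 (-1) := by simp [mo, div_eq_mul_inv]

theorem BP.congr {Z : ℂ} {γ v γ' v' : ℤ → ℂ} (h : BP q Z γ v) (h1 : ∀ r, γ' r = γ r) (h2 : ∀ r, v' r = v r) :
    BP q Z γ' v' := by
  rwa [show γ' = γ from funext h1, show v' = v from funext h2]

theorem chain0 {X : ℂ} (hX : X ≠ 0) (j : ℕ) :
    BP q (X * q) (fun r => aF q X (j + 2) r * (1 - X * (q : ℂ) ^ (2 * r))) (fun N => theta q X * beta q X j 0 N) := by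
  have hqn := q_ne (q := q)
  induction j with
  | zero => exact (lemA hX).congr (fun r => rfl) (fun r => by simp [beta])
  | succ j ih =>
    refine (bp_step (mul_ne_zero hX hqn) ih).congr (fun r => ?_) (fun N => ?_)
    · rw [mul_div_cancel_right₀ _ hqn]
      have : aF q X (j + 1 + 2) r = X ^ r * (q : ℂ) ^ (r ^ 2) * aF q X (j + 2) r := by
        change mo q X _ _ = mo q X _ _ * mo q X _ _
        rw [mo_mul hX]; congr 1 <;> (push_cast; ring)
      rw [this]; ring
    · rw [mul_div_cancel_right₀ _ hqn, beta, ← tsum_mul_left]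
      refine tsum_congr fun M => ?_
      simp [eps]; ring

def gam (q : ℝ) (X : ℂ) (c : ℕ) (r : ℤ) : ℂ := aF q X c r - X * (q : ℂ) ^ (2 * r - 2) * aF q X c (r - 1)

theorem mo_ne {X : ℂ} (hX : X ≠ 0) (a b : ℤ) : mo q X a b ≠ 0 :=
  mul_ne_zero (zpow_ne_zero _ hX) (zpow_ne_zero _ q_ne)

theorem GB_mo {X : ℂ} (hX : X ≠ 0) (j : ℕ) (a d e f : ℤ) :
    GB q (fun r => mo q X (a * r + e) ((j + 2) * r ^ 2 + d * r + f)) := by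
  refine ((GB_basic (q := q) (mo q X e f) (mo_ne (q := q) hX a d)).mul one_ne_zero j).congr fun r => ?_
  rw [mo_zpow, one_zpow, one_mul, mo_q (X := X), mo_q (X := X), mo_mul hX, mo_mul hX, mo_mul hX]
  congr 1 <;> ring

theorem aF_mo (X : ℂ) (j : ℕ) (r : ℤ) : aF q X j r = mo q X (j * r) (j * r ^ 2 - r) := rfl

theorem aF_GB {X : ℂ} (hX : X ≠ 0) (j : ℕ) : GB q (aF q X (j + 2)) := by
  refine (GB_mo hX j (j + 2) (-1) 0 0).congr fun r => ?_
  rw [aF_mo]; congr 1 <;> (push_cast; ring)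

theorem aF_GB' {X : ℂ} (hX : X ≠ 0) (j : ℕ) :
    GB q (fun r => X * (q : ℂ) ^ (2 * r - 2) * aF q X (j + 2) (r - 1)) := by
  refine (GB_mo hX j (j + 2) (1 - 2 * (j + 2)) (- (j + 1)) (j + 1)).congr fun r => ?_
  rw [aF_mo, mo_q (X := X)]
  conv_lhs => enter [1, 1]; rw [mo_X (q := q) X]
  rw [mo_mul hX, mo_mul hX]
  congr 1 <;> (push_cast; ring)

theorem K_conv {X : ℂ} (hX : X ≠ 0) (N r : ℤ) :
    (1 - X * (q : ℂ) ^ (2 * r)) * K q (X * q) N r = K q X N r - X * (q : ℂ) ^ (2 * r) * K q X N (r + 1) := by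
  have hqn := q_ne (q := q)
  unfold K
  have e2 : X * (q : ℂ) ^ (N + (r + 1)) = X * (q : ℂ) ^ (N + r) * q := by
    rw [mul_assoc, ← zpow_add_one₀ hqn]; congr 2; ring
  have e3 : X * q * (q : ℂ) ^ (N + r) = X * (q : ℂ) ^ (N + r) * q := by ring
  have e5 : N - (r + 1) = N - r - 1 := by ring
  rw [e2, e3, e5, E_fe (X * (q : ℂ) ^ (N + r)), ← invC_pred]
  have hw : (q : ℂ) ^ r ≠ 0 := zpow_ne_zero _ hqn
  rw [mul_comm 2 r, zpow_mul, zpow_sub₀ hqn, zpow_add₀ hqn]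
  simp only [zpow_ofNat]
  generalize E q _ = e
  generalize (invQ q (N - r) : ℂ) = i
  generalize (q : ℂ) ^ r = w at *
  field_simp
  ring

theorem chain1 {X : ℂ} (hX : X ≠ 0) (j : ℕ) :
    BP q X (gam q X (j + 2)) (fun N => theta q X * beta q X j 0 N) := by
  have h0 := chain0 (q := q) hX j
  have hg1 := aF_GB (q := q) hX j
  have hg3 := aF_GB' (q := q) hX j
  refine ⟨(hg1.add hg3.neg).congr fun r => by rw [gam]; ring, fun N => ?_⟩
  have s1 := (hg1.summ hX N).hasSum
  have s3 := (hg3.summ hX N).hasSum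
  have s3' := (Equiv.addRight (1 : ℤ)).hasSum_iff.mpr s3
  have s4 := (h0.2 N).unique ((s1.sub s3').congr_fun fun r => ?_)
  · rw [s4]
    exact (s1.sub s3).congr_fun fun r => by rw [gam]; ring
  · simp only [Function.comp, Equiv.coe_addRight]
    rw [mul_assoc, K_conv hX, show r + 1 - 1 = r by ring, show 2 * (r + 1) - 2 = 2 * r by ring]
    ring

theorem chain2 {X : ℂ} (hX : X ≠ 0) (j l : ℕ) :
    BP q X (fun r => mo q X (l * r) (l * r ^ 2 - l * r) * gam q X (j + 2) r)
      (fun N => theta q X * beta q X (j + l) l N) := by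
  induction l with
  | zero => exact (chain1 hX j).congr (fun r => by simp [mo]) (fun r => rfl)
  | succ l ih =>
    refine (bp_step hX ih).congr (fun r => ?_) (fun N => ?_)
    · rw [mo_Xq, mo_zpow, mo_q (X := X), mo_mul hX, ← mul_assoc, mo_mul hX]
      congr 2 <;> (push_cast; ring)
    · rw [← add_assoc, beta, ← tsum_mul_left]
      refine tsum_congr fun M => ?_
      rw [mo_Xq, mo_zpow]
      simp only [eps, Nat.add_one_ne_zero, if_false, Nat.add_sub_cancel]
      rw [mo_q (X := X) (M ^ 2), mo_mul hX]
      change _ * (_ * (mo q X _ _ * _)) = _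
      rw [show (1 * M + 0) = M by ring, show M ^ 2 - 1 * M = -1 * M + M ^ 2 by ring]
      ring

/-- term of the expansion of `theta * Phi`, l ≥ 1 -/
def T1 (q : ℝ) (X : ℂ) (j l s : ℕ) (r : ℤ) : ℂ :=
  mo q X (l * r) (l * r ^ 2 - l * r - s * r) * gam q X (j + 2) r * g q s (mo q X 1 (2 * r - 1))

def T0 (q : ℝ) (X : ℂ) (j s : ℕ) (r : ℤ) : ℂ :=
  aF q X (j + 3) r * (1 - X * (q : ℂ) ^ (2 * r)) * (q : ℂ) ^ (-(s * r : ℤ)) * g q s (mo q X 1 (2 * r))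

theorem Phi_T1 {X : ℂ} (hX : X ≠ 0) (j l s : ℕ) :
    HasSum (T1 q X j (l + 1) s) (theta q X * Phi q X (j + l) (l + 1) s) := by
  have h := bp_final hX (chain2 (q := q) hX j l) s
  convert h using 1
  · funext r
    rw [mo_Xq, mo_q (X := X), mo_q (X := X), mo_q (X := X), mo_mul hX, mo_mul hX, mo_zpow, mo_mul hX, T1]
    rw [show ∀ a b c d : ℂ, a * b * (c * d) = (a * c) * b * d by intros; ring, mo_mul hX]
    congr 3
    · push_cast; ring
    · push_cast; ring
    · ring
  · rw [Phi, ← tsum_mul_left]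
    refine tsum_congr fun M => ?_
    rw [mo_Xq, mo_q (X := X) (-(s : ℤ)), mo_mul hX, mo_zpow]
    simp only [eps, Nat.add_one_ne_zero, if_false, Nat.add_sub_cancel]
    rw [mo_q (X := X) (M ^ 2), mo_mul hX]
    change _ * (mo q X _ _ * _) = _
    rw [show (1 + 0) * M + 0 = M by ring, show M ^ 2 - (1 + (s : ℤ)) * M = (-1 + -(s : ℤ)) * M + M ^ 2 by ring]
    ring

theorem Phi_T0 {X : ℂ} (hX : X ≠ 0) (j s : ℕ) :
    HasSum (T0 q X j s) (theta q X * Phi q X j 0 s) := by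
  have hqn := q_ne (q := q)
  have h := bp_final (mul_ne_zero hX hqn) (chain0 (q := q) hX j) s
  rw [mul_div_cancel_right₀ _ hqn] at h
  convert h using 1
  · funext r
    have e1 : (X * (q : ℂ) ^ (-(s : ℤ))) ^ r = mo q X r (-(s * r)) := by
      change (X * _) ^ _ = _
      nth_rw 1 [mo_X (q := q) X]
      rw [mo_q (X := X), mo_mul hX, mo_zpow]; congr 1 <;> ring
    have e2 : X * (q : ℂ) ^ (2 * r) = mo q X 1 (2 * r) := by simp [mo]
    rw [e1, e2, mo_q (X := X), mo_mul hX, T0, e2, aF_mo, aF_mo, mo_q (X := X)]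
    rw [show ∀ a b c d : ℂ, a * b * (c * d) = (a * c) * b * d by intros; ring,
      show ∀ a b c d : ℂ, a * b * c * d = (a * c) * b * d by intros; ring, mo_mul hX, mo_mul hX]
    congr 3
    · push_cast; ring
    · push_cast; ring
  · rw [Phi, ← tsum_mul_left]
    refine tsum_congr fun M => ?_
    have e1 : (X * (q : ℂ) ^ (-(s : ℤ))) ^ M = mo q X M (-(s * M)) := by
      nth_rw 1 [mo_X (q := q) X]
      rw [mo_q (X := X), mo_mul hX, mo_zpow]; congr 1 <;> ring
    rw [e1, mo_q (X := X) (M ^ 2), mo_mul hX]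
    simp only [eps, if_true, Nat.zero_sub]
    change _ * (mo q X _ _ * _) = _
    rw [add_zero, show M ^ 2 - (0 + (s : ℤ)) * M = (-(s * M)) + M ^ 2 by ring]
    ring

theorem g_pal {Y : ℂ} (hY : Y ≠ 0) (s : ℕ) : g q s Y⁻¹ = Y ^ (-(s : ℤ)) * g q s Y := by
  have h : (invQ q s : ℂ) ≠ 0 := by exact_mod_cast (invQ_pos (q := q) s).ne'
  apply mul_left_cancel₀ h
  rw [mul_left_comm, g_eq, g_eq, ← Finset.sum_range_reflect, Finset.mul_sum]
  refine Finset.sum_congr rfl fun j hj => ?_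
  have hj' : j ≤ s := by simp at hj; omega
  obtain ⟨i, rfl⟩ := Nat.exists_eq_add_of_le hj'
  rw [show j + i + 1 - 1 - j = i by omega]
  push_cast
  rw [show (j : ℤ) + i - i = j by ring, show (j : ℤ) + i - j = i by ring]
  rw [show (i : ℤ) ^ 2 - i * (j + i) = (j : ℤ) ^ 2 - j * (j + i) by ring, inv_pow, neg_add, zpow_add₀ hY,
    zpow_neg, zpow_neg, zpow_natCast, zpow_natCast]
  field_simp

theorem gam_refl {X : ℂ} (hX : X ≠ 0) (c : ℕ) (r : ℤ) : gam q X⁻¹ c (1 - r) = - X⁻¹ * gam q X c r := by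
  have hqn := q_ne (q := q)
  have e : (X : ℂ)⁻¹ = mo q X (-1) 0 := by simp [mo]
  have e' : X * (q : ℂ) ^ (2 * r - 2) = mo q X 1 (2 * r - 2) := by simp [mo]
  unfold gam
  rw [aF_mo, aF_mo, aF_mo, aF_mo, mo_inv, mo_inv, e, e', mo_q (X := X), mo_mul hX, mo_mul hX, mo_mul hX,
    show ∀ a b c : ℂ, -a * (b - c) = a * c - a * b by intros; ring, mo_mul hX, mo_mul hX]
  congr 2 <;> (push_cast; ring)

theorem T1_refl {X : ℂ} (hX : X ≠ 0) (j l s : ℕ) (r : ℤ) :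
    T1 q X⁻¹ j l s (1 - r) = - mo q X (-1 - l - s) 0 * T1 q X j l s r := by
  unfold T1
  have e : (X : ℂ)⁻¹ = mo q X (-1) 0 := by simp [mo]
  have e2 : mo q X (-1) (2 * (1 - r) - 1) = (mo q X 1 (2 * r - 1))⁻¹ := by
    rw [← zpow_neg_one, mo_zpow]; congr 1 <;> ring
  rw [gam_refl hX, mo_inv, mo_inv, e2, g_pal (mo_ne hX _ _), mo_zpow, e]
  rw [show ∀ a b c d e : ℂ, a * (-b * c) * (d * e) = -((a * b * d) * c * e) by intros; ring, mo_mul hX, mo_mul hX]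
  rw [show ∀ a b c d : ℂ, -a * (b * c * d) = -((a * b) * c * d) by intros; ring, mo_mul hX]
  congr 4 <;> ring

theorem T0_refl {X : ℂ} (hX : X ≠ 0) (j s : ℕ) (r : ℤ) :
    T0 q X⁻¹ j s (- r) = - mo q X (-1 - s) 0 * T0 q X j s r := by
  unfold T0
  have e2 : mo q X (-1) (2 * (- r)) = (mo q X 1 (2 * r))⁻¹ := by
    rw [← zpow_neg_one, mo_zpow]; congr 1 <;> ring
  have e3 : (1 - X⁻¹ * (q : ℂ) ^ (2 * -r)) = - mo q X (-1) (-2 * r) * (1 - X * (q : ℂ) ^ (2 * r)) := by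
    have e : (X : ℂ)⁻¹ = mo q X (-1) 0 := by simp [mo]
    have e' : X * (q : ℂ) ^ (2 * r) = mo q X 1 (2 * r) := by simp [mo]
    have e1 : (1 : ℂ) = mo q X 0 0 := by simp [mo]
    rw [e', e, mo_q (X := X), mo_mul hX, show ∀ a b : ℂ, -a * (1 - b) = a * b - a by intros; ring, mo_mul hX, e1]
    congr 2 <;> ring
  rw [e3, aF_mo, aF_mo, mo_inv, mo_inv, e2, g_pal (mo_ne hX _ _), mo_zpow, mo_q (X := X) (-(s * -r : ℤ)), mo_q (X := X) (-(s * r : ℤ))]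
  rw [show ∀ a b c d e f : ℂ, a * (-b * c) * d * (e * f) = -((a * b * d * e) * c * f) by intros; ring, mo_mul hX, mo_mul hX, mo_mul hX]
  rw [show ∀ a b c d e : ℂ, -a * (b * c * d * e) = -((a * b * d) * c * e) by intros; ring, mo_mul hX, mo_mul hX]
  congr 4 <;> (push_cast; ring)

theorem Phi_refl {X : ℂ} (hX : X ≠ 0) (hθ : theta q X ≠ 0) (j l s : ℕ) (hl : l ≤ j + 1) :
    Phi q X⁻¹ j l s = X ^ (-(l : ℤ) - s) * Phi q X j l s := by
  have hXi : X⁻¹ ≠ 0 := inv_ne_zero hX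
  have key : theta q X⁻¹ * Phi q X⁻¹ j l s = - X ^ (-1 - (l : ℤ) - s) * (theta q X * Phi q X j l s) := by
    rcases l with _ | l
    · have h1 := Phi_T0 (q := q) hXi j s
      have h2 := (Phi_T0 (q := q) hX j s).mul_left (- mo q X (-1 - s) 0)
      have h3 := (Equiv.neg ℤ).hasSum_iff.mpr h1
      have h4 := h3.unique (h2.congr_fun fun r => by simp only [Function.comp, Equiv.neg_apply]; rw [T0_refl hX])
      rw [h4]; simp [mo]
    · obtain ⟨i, rfl⟩ : ∃ i, j = i + l := ⟨j - l, by omega⟩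
      have h1 := Phi_T1 (q := q) hXi i l s
      have h2 := (Phi_T1 (q := q) hX i l s).mul_left (- mo q X (-1 - (l + 1 : ℕ) - s) 0)
      have h3 := (Equiv.subLeft (1 : ℤ)).hasSum_iff.mpr h1
      have h4 := h3.unique (h2.congr_fun fun r => by simp only [Function.comp, Equiv.subLeft_apply]; rw [T1_refl hX])
      rw [h4]; simp [mo]
  rw [theta_inv hX] at key
  have e : X ^ (-1 - (l : ℤ) - s) = X⁻¹ * X ^ (-(l : ℤ) - s) := by
    rw [← zpow_neg_one, ← zpow_add₀ hX]; congr 1; ring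
  rw [e] at key
  have hne : - X⁻¹ * theta q X ≠ 0 := mul_ne_zero (neg_ne_zero.mpr hXi) hθ
  apply mul_left_cancel₀ hne
  rw [key]; ring

end
end GP
end

section
namespace GP
open Filter Topology

theorem coef_zero {f : ℤ → ℂ} (hs : Summable (fun n => ‖f n‖))
    (h : ∀ u : ℝ, HasSum (fun n : ℤ => f n * Complex.exp (n * u * Complex.I)) 0) : ∀ m, f m = 0 := by
  intro m
  have key := intervalIntegral.hasSum_intervalIntegral_of_summable_norm (a := 0) (b := 2 * Real.pi)
    (f := fun n : ℤ => (⟨fun u : ℝ => f n * Complex.exp (((n - m : ℤ) : ℂ) * u * Complex.I), by fun_prop⟩ : C(ℝ, ℂ))) ?_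
  · have hz : ∀ n : ℤ, ∫ u in (0:ℝ)..(2 * Real.pi), f n * Complex.exp (((n - m : ℤ) : ℂ) * u * Complex.I) =
        if n = m then 2 * Real.pi * f m else 0 := by
      intro n
      split_ifs with h1
      · subst h1; simp
      · rw [intervalIntegral.integral_const_mul]
        have hc : ((n - m : ℤ) : ℂ) * Complex.I ≠ 0 := by
          refine mul_ne_zero ?_ Complex.I_ne_zero
          exact_mod_cast sub_ne_zero.mpr h1
        have := integral_exp_mul_complex (a := 0) (b := 2 * Real.pi) hc
        simp_rw [show ∀ u : ℝ, ((n - m : ℤ) : ℂ) * u * Complex.I = ((n - m : ℤ) : ℂ) * Complex.I * u by intro u; ring]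
        rw [this]
        have e : Complex.exp (((n - m : ℤ) : ℂ) * Complex.I * ((2 * Real.pi : ℝ) : ℂ)) = 1 := by
          rw [Complex.exp_eq_one_iff]; exact ⟨n - m, by push_cast; ring⟩
        rw [e]; simp
    have h0 : ∫ u in (0:ℝ)..(2 * Real.pi), ∑' n : ℤ, f n * Complex.exp (((n - m : ℤ) : ℂ) * u * Complex.I) = 0 := by
      have : ∀ u : ℝ, ∑' n : ℤ, f n * Complex.exp (((n - m : ℤ) : ℂ) * u * Complex.I) = 0 := by
        intro u
        have := ((h u).mul_right (Complex.exp (-(m * u * Complex.I)))).tsum_eq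
        rw [zero_mul] at this
        rw [← this]
        refine tsum_congr fun n => ?_
        rw [mul_assoc (f n), ← Complex.exp_add]; congr 2; push_cast; ring
      simp only [this, intervalIntegral.integral_zero]
    simp only [ContinuousMap.coe_mk] at key
    rw [h0] at key
    simp_rw [hz] at key
    have k2 := key.unique (hasSum_ite_eq m _)
    have hpi : (2 * (Real.pi : ℂ)) ≠ 0 := by
      have := Real.pi_ne_zero
      simp [this]
    have := mul_eq_zero.mp k2.symm
    tauto
  · refine hs.of_nonneg_of_le (fun n => norm_nonneg _) (fun n => ?_)
    rw [ContinuousMap.norm_le _ (norm_nonneg _)]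
    intro x
    simp only [ContinuousMap.restrict_apply, ContinuousMap.coe_mk, norm_mul]
    rw [show ((n - m : ℤ) : ℂ) * (x : ℝ) * Complex.I = ((((n - m : ℤ) : ℝ) * (x : ℝ) : ℝ) : ℂ) * Complex.I by push_cast; ring,
      Complex.norm_exp_ofReal_mul_I, mul_one]

/-- uniqueness of Laurent coefficients on a circle -/
theorem laurent_unique {f g : ℤ → ℂ} {t : ℝ} (ht : 0 < t) (hf : Summable (fun n => ‖f n‖ * t ^ n))
    (hg : Summable (fun n => ‖g n‖ * t ^ n)) {φ : ℂ → ℂ}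
    (h1 : ∀ X : ℂ, ‖X‖ = t → HasSum (fun n => f n * X ^ n) (φ X))
    (h2 : ∀ X : ℂ, ‖X‖ = t → HasSum (fun n => g n * X ^ n) (φ X)) : f = g := by
  have htc : (t : ℂ) ≠ 0 := by exact_mod_cast ht.ne'
  funext m
  have key := coef_zero (f := fun n => (f n - g n) * (t : ℂ) ^ n) ?_ ?_ m
  · have := mul_eq_zero.mp key
    rcases this with h | h
    · exact sub_eq_zero.mp h
    · exact absurd h (zpow_ne_zero _ htc)
  · refine (hf.add hg).of_nonneg_of_le (fun n => norm_nonneg _) (fun n => ?_)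
    rw [norm_mul, norm_zpow, Complex.norm_real, Real.norm_of_nonneg ht.le, ← add_mul]
    gcongr
    exact norm_sub_le _ _
  · intro u
    set X : ℂ := t * Complex.exp (u * Complex.I)
    have hX : ‖X‖ = t := by
      rw [norm_mul, Complex.norm_exp_ofReal_mul_I, Complex.norm_real, Real.norm_of_nonneg ht.le, mul_one]
    have := (h1 X hX).sub (h2 X hX)
    rw [sub_self] at this
    refine this.congr_fun fun n => ?_
    rw [mul_zpow, ← Complex.exp_int_mul]
    rw [← mul_assoc (n : ℂ)]; ring

def oR (x : ℝ) : ENNReal := ENNReal.ofReal x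

theorem oR_mul {x y : ℝ} (hx : 0 ≤ x) : oR (x * y) = oR x * oR y := ENNReal.ofReal_mul hx
theorem oR_toReal {x : ℝ} (hx : 0 ≤ x) : (oR x).toReal = x := ENNReal.toReal_ofReal hx
theorem oR_ne_top (x : ℝ) : oR x ≠ ⊤ := ENNReal.ofReal_ne_top
theorem oR_le {x y : ℝ} (h : x ≤ y) : oR x ≤ oR y := ENNReal.ofReal_le_ofReal h
theorem oR_tsum {ι : Type*} {f : ι → ℝ} (h0 : ∀ i, 0 ≤ f i) (h : Summable f) : ∑' i, oR (f i) ≠ ⊤ := by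
  unfold oR
  rw [← ENNReal.ofReal_tsum_of_nonneg h0 h]; exact ENNReal.ofReal_ne_top

/-- grouping by exponent -/
theorem group {ι : Type*} {c : ι → ENNReal} {e : ι → ℤ} {t : ℝ} (ht : 0 < t)
    (hfin : ∑' i, c i * oR (t ^ e i) ≠ ⊤) {X : ℂ} (hX : ‖X‖ = t) :
    Summable (fun i => ((c i).toReal : ℂ) * X ^ e i) ∧
    HasSum (fun A : ℤ => ((∑' i, if e i = A then c i else 0).toReal : ℂ) * X ^ A) (∑' i, ((c i).toReal : ℂ) * X ^ e i) := by
  have hs0 := ENNReal.summable_toReal hfin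
  have hs : Summable (fun i => ((c i).toReal : ℂ) * X ^ e i) := by
    refine Summable.of_norm (hs0.congr fun i => ?_)
    rw [ENNReal.toReal_mul, oR_toReal (by positivity), norm_mul, norm_zpow, hX, Complex.norm_real, Real.norm_of_nonneg ENNReal.toReal_nonneg]
  refine ⟨hs, ?_⟩
  have hc : ∀ i, c i ≠ ⊤ := by
    intro i hi
    have := ENNReal.ne_top_of_tsum_ne_top hfin i
    rw [hi, ENNReal.top_mul (by simp [oR]; positivity)] at this
    exact this rfl
  have h1 := (Equiv.sigmaFiberEquiv e).hasSum_iff.mpr hs.hasSum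
  have h2 := h1.sigma (g := fun A => ∑' i : {x // e x = A}, ((c i).toReal : ℂ) * X ^ e i)
    (fun A => (h1.summable.sigma_factor A).hasSum)
  refine h2.congr_fun fun A => ?_
  have e1 : (∑' i, if e i = A then c i else 0) = ∑' i : {x // e x = A}, c i := by
    refine Eq.trans ?_ (tsum_subtype {x | e x = A} c).symm
    exact tsum_congr fun i => by simp [Set.indicator]
  rw [e1, ENNReal.tsum_toReal_eq (fun i => hc _), Complex.ofReal_tsum, ← tsum_mul_right]
  refine tsum_congr fun i => ?_
  rw [i.2]

theorem group_fin {ι : Type*} {c : ι → ENNReal} {e : ι → ℤ} {t : ℝ} :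
    ∑' A : ℤ, (∑' i, if e i = A then c i else 0) * oR (t ^ A) = ∑' i, c i * oR (t ^ e i) := by
  simp_rw [← ENNReal.tsum_mul_right]
  rw [ENNReal.tsum_comm]
  refine tsum_congr fun i => ?_
  rw [tsum_eq_single (e i)]
  · simp
  · intro b hb; rw [if_neg (Ne.symm hb), zero_mul]

def R (q : ℝ) : ℕ → ℕ → ℤ → ℤ → ENNReal
  | 0, _, _, A => if A = 0 then 1 else 0
  | j + 1, l, x, A => ∑' N : ℤ, oR (invQ q (x - N)) * (oR (q ^ (N ^ 2 - eps l * N)) * R q j (l - 1) N (A - N))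

/-- F_k^{(s)}(A), k = j+1 -/
def FF (q : ℝ) (j l s : ℕ) (A : ℤ) : ENNReal :=
  ∑' N : ℤ, oR (q ^ (N ^ 2 - (eps l + s) * N)) * R q j (l - 1) N (A - N)

section
variable {q : ℝ} [hq : Fact (0 < q ∧ q < 1)]

theorem group2_eq (w : ℤ → ENNReal) (P : ℤ → ℤ → ENNReal) (A : ℤ) :
    (∑' i : ℤ × ℤ, if i.1 + i.2 = A then w i.1 * P i.1 i.2 else 0) = ∑' N, w N * P N (A - N) := by
  rw [ENNReal.tsum_prod']
  refine tsum_congr fun N => ?_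
  rw [tsum_eq_single (A - N)]
  · simp
  · intro b hb; rw [if_neg]; intro h; exact hb (by simp only at h; omega)

theorem group2_fin (w : ℤ → ENNReal) (P : ℤ → ℤ → ENNReal) {t : ℝ} (ht : 0 < t) :
    ∑' i : ℤ × ℤ, w i.1 * P i.1 i.2 * oR (t ^ (i.1 + i.2)) = ∑' N, w N * oR (t ^ N) * ∑' A, P N A * oR (t ^ A) := by
  rw [ENNReal.tsum_prod']
  refine tsum_congr fun N => ?_
  rw [← ENNReal.tsum_mul_left]
  refine tsum_congr fun A => ?_
  simp only []
  rw [zpow_add₀ ht.ne', oR_mul (by positivity)]; ring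

theorem weight_fin {t : ℝ} (ht : 0 < t) (d : ℤ) : ∑' N : ℤ, oR (q ^ (N ^ 2 - d * N)) * oR (t ^ N) ≠ ⊤ := by
  have h0 := hq.out.1
  have s := summ_gauss (p := q) (t := t * q ^ (-d)) (by positivity)
  convert oR_tsum (fun n => by positivity) s using 3 with N
  rw [← oR_mul (by positivity), mul_zpow, ← zpow_mul, sub_eq_add_neg, zpow_add₀ h0.ne']
  congr 1; rw [neg_mul]; ring

theorem group2_link {w : ℤ → ENNReal} {P : ℤ → ℤ → ENNReal} {t : ℝ} (ht : 0 < t) {b : ℤ → ℂ} {X : ℂ} (hX : ‖X‖ = t)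
    (hfin : ∑' N, w N * oR (t ^ N) * ∑' A, P N A * oR (t ^ A) ≠ ⊤)
    (hb : ∀ N, HasSum (fun A => ((P N A).toReal : ℂ) * X ^ A) (b N)) :
    HasSum (fun A => ((∑' N, w N * P N (A - N)).toReal : ℂ) * X ^ A) (∑' N, ((w N).toReal : ℂ) * (X ^ N * b N)) := by
  have hX0 : X ≠ 0 := by intro h; rw [h, norm_zero] at hX; exact ht.ne hX
  rw [← group2_fin w P ht] at hfin
  have := group (c := fun i : ℤ × ℤ => w i.1 * P i.1 i.2) (e := fun i => i.1 + i.2) ht hfin hX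
  obtain ⟨h1, h2⟩ := this
  simp only [group2_eq] at h2
  convert h2 using 1
  rw [h1.tsum_prod]
  refine tsum_congr fun N => ?_
  rw [← (hb N).tsum_eq, ← tsum_mul_left, ← tsum_mul_left]
  refine tsum_congr fun A => ?_
  rw [ENNReal.toReal_mul, zpow_add₀ hX0]; push_cast; ring

theorem R_bound {t : ℝ} (ht : 0 < t) (j : ℕ) : ∀ l, ∃ M : ENNReal, M ≠ ⊤ ∧ ∀ N, ∑' A, R q j l N A * oR (t ^ A) ≤ M := by
  induction j with
  | zero =>
    refine fun l => ⟨1, by simp, fun N => ?_⟩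
    rw [tsum_eq_single 0]
    · simp [R, oR]
    · intro b hb; simp [R, hb]
  | succ j ih =>
    intro l
    obtain ⟨M, hM, h⟩ := ih (l - 1)
    refine ⟨oR (CQ q) * ((∑' N : ℤ, oR (q ^ (N ^ 2 - eps l * N)) * oR (t ^ N)) * M), ?_, fun x => ?_⟩
    · exact ENNReal.mul_ne_top (oR_ne_top _) (ENNReal.mul_ne_top (weight_fin ht _) hM)
    · have e := group_fin (c := fun i : ℤ × ℤ => (oR (invQ q (x - i.1)) * oR (q ^ (i.1 ^ 2 - eps l * i.1))) * R q j (l - 1) i.1 i.2) (e := fun i => i.1 + i.2) (t := t)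
      have e2 := fun A => group2_eq (fun N => oR (invQ q (x - N)) * oR (q ^ (N ^ 2 - eps l * N))) (R q j (l - 1)) A
      simp only [e2] at e
      rw [group2_fin (fun N => oR (invQ q (x - N)) * oR (q ^ (N ^ 2 - eps l * N))) (R q j (l - 1)) ht] at e
      simp only [R, ← mul_assoc]
      rw [e, ← ENNReal.tsum_mul_left, ← ENNReal.tsum_mul_right]
      refine ENNReal.tsum_le_tsum fun N => ?_
      rw [← mul_assoc]
      gcongr
      · exact oR_le (invQ_le _)
      · exact h N

theorem R_fin {w : ℤ → ENNReal} {t : ℝ} (ht : 0 < t) (j l : ℕ) (C : ENNReal) (hC : C ≠ ⊤) (d : ℤ)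
    (hw : ∀ N, w N ≤ C * oR (q ^ (N ^ 2 - d * N))) :
    ∑' N, w N * oR (t ^ N) * ∑' A, R q j l N A * oR (t ^ A) ≠ ⊤ := by
  obtain ⟨M, hM, h⟩ := R_bound (q := q) ht j l
  have : C * ((∑' N : ℤ, oR (q ^ (N ^ 2 - d * N)) * oR (t ^ N)) * M) ≠ ⊤ :=
    ENNReal.mul_ne_top hC (ENNReal.mul_ne_top (weight_fin ht _) hM)
  refine ne_top_of_le_ne_top this ?_
  rw [← ENNReal.tsum_mul_right, ← ENNReal.tsum_mul_left]
  refine ENNReal.tsum_le_tsum fun N => ?_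
  rw [← mul_assoc, ← mul_assoc]
  gcongr
  · exact hw N
  · exact h N

theorem R_link {X : ℂ} (hX : X ≠ 0) (j : ℕ) : ∀ l N, HasSum (fun A => ((R q j l N A).toReal : ℂ) * X ^ A) (beta q X j l N) := by
  have h0 := hq.out.1
  induction j with
  | zero =>
    intro l N
    rw [beta]
    convert hasSum_ite_eq (0 : ℤ) (1 : ℂ) using 1
    funext A
    by_cases h : A = 0 <;> simp [R, h]
  | succ j ih =>
    intro l x
    have ht := norm_pos_iff.mpr hX
    have := group2_link (w := fun N => oR (invQ q (x - N)) * oR (q ^ (N ^ 2 - eps l * N))) ht rfl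
      (R_fin (q := q) ht j (l - 1) (oR (CQ q)) (oR_ne_top _) (eps l) (fun N => by gcongr; exact oR_le (invQ_le _))) (ih (l - 1))
    simp only [mul_assoc] at this
    simp only [R]
    convert this using 1
    rw [beta]
    refine tsum_congr fun N => ?_
    rw [ENNReal.toReal_mul, oR_toReal (invQ_nonneg _), oR_toReal (by positivity)]
    push_cast; ring

theorem FF_eq_group (j l s : ℕ) (A : ℤ) : FF q j l s A =
    ∑' N, (fun N : ℤ => oR (q ^ (N ^ 2 - (eps l + s) * N))) N * R q j (l - 1) N (A - N) := rfl

theorem FF_link {X : ℂ} (hX : X ≠ 0) (j l s : ℕ) : HasSum (fun A => ((FF q j l s A).toReal : ℂ) * X ^ A) (Phi q X j l s) := by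
  have h0 := hq.out.1
  have ht := norm_pos_iff.mpr hX
  have := group2_link (w := fun N => oR (q ^ (N ^ 2 - (eps l + s) * N))) ht rfl
      (R_fin (q := q) ht j (l - 1) 1 (by simp) (eps l + s) (fun N => by rw [one_mul])) (fun N => R_link hX j (l - 1) N)
  simp only [FF]
  convert this using 1
  rw [Phi]
  refine tsum_congr fun N => ?_
  rw [oR_toReal (by positivity)]
  push_cast; ring

theorem FF_fin {t : ℝ} (ht : 0 < t) (j l s : ℕ) : ∑' A, FF q j l s A * oR (t ^ A) ≠ ⊤ := by
  have h := R_fin (q := q) (w := fun N => oR (q ^ (N ^ 2 - (eps l + s) * N))) ht j (l - 1) 1 (by simp) (eps l + s) (fun N => by rw [one_mul])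
  rw [← group2_fin _ _ ht, ← group_fin] at h
  have e2 := fun A => group2_eq (fun N : ℤ => oR (q ^ (N ^ 2 - (eps l + s) * N))) (R q j (l - 1)) A
  simp only [e2] at h
  exact h

theorem FF_ne_top (j l s : ℕ) (A : ℤ) : FF q j l s A ≠ ⊤ := by
  have := ENNReal.ne_top_of_tsum_ne_top (FF_fin (q := q) one_pos j l s) A
  simpa [oR] using this

theorem theta_ne {X : ℂ} (h1 : q < ‖X‖) (h2 : ‖X‖ < 1) : theta q X ≠ 0 := by
  unfold theta
  have : ‖(q : ℂ) / X‖ < 1 := by rw [norm_div, norm_q, div_lt_one (hq.out.1.trans h1)]; exact h1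
  exact mul_ne_zero (E_ne h2) (E_ne this)

theorem FF_summ {t : ℝ} (ht : 0 < t) (j l s : ℕ) : Summable (fun A => ‖((FF q j l s A).toReal : ℂ)‖ * t ^ A) := by
  refine (ENNReal.summable_toReal (FF_fin (q := q) ht j l s)).congr fun A => ?_
  rw [ENNReal.toReal_mul, oR_toReal (by positivity), Complex.norm_real, Real.norm_of_nonneg ENNReal.toReal_nonneg]

theorem FF_refl (j l s : ℕ) (hl : l ≤ j + 1) (A : ℤ) : FF q j l s A = FF q j l s (l + s - A) := by
  have hp := (inferInstance : Fact (0 < √q ∧ √q < 1)).out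
  have hs := sqrt_sq_q (q := q)
  have hlt : q < √q := by nlinarith [hp.1, hp.2]
  have key := laurent_unique (f := fun A => ((FF q j l s A).toReal : ℂ)) (g := fun A => ((FF q j l s (l + s - A)).toReal : ℂ))
    (φ := fun X => Phi q X j l s) hp.1 (FF_summ hp.1 j l s) ?_ (fun X hX => ?_) (fun X hX => ?_)
  · have := congrFun key A
    simp only [Complex.ofReal_inj] at this
    exact (ENNReal.toReal_eq_toReal_iff' (FF_ne_top _ _ _ _) (FF_ne_top _ _ _ _)).mp this
  · have h := (FF_summ (q := q) (inv_pos.mpr hp.1) j l s).mul_right (√q ^ ((l : ℤ) + s))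
    refine ((Equiv.subLeft ((l : ℤ) + s)).summable_iff.mpr h).congr fun A => ?_
    simp only [Function.comp, Equiv.subLeft_apply]
    rw [mul_assoc]; congr 1
    rw [inv_zpow', ← zpow_add₀ hp.1.ne']; congr 1; ring
  · have hX0 : X ≠ 0 := by intro h; rw [h, norm_zero] at hX; exact hp.1.ne hX
    exact FF_link hX0 j l s
  · have hX0 : X ≠ 0 := by intro h; rw [h, norm_zero] at hX; exact hp.1.ne hX
    have hr := Phi_refl hX0 (theta_ne (by rw [hX]; exact hlt) (by rw [hX]; exact hp.2)) j l s hl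
    have h := (FF_link (q := q) (inv_ne_zero hX0) j l s).mul_right (X ^ ((l : ℤ) + s))
    rw [hr] at h
    have e : X ^ (-(l : ℤ) - s) * Phi q X j l s * X ^ ((l : ℤ) + s) = Phi q X j l s := by
      rw [mul_right_comm, ← zpow_add₀ hX0]; simp
    rw [e] at h
    refine ((Equiv.subLeft ((l : ℤ) + s)).hasSum_iff.mpr h).congr_fun fun A => ?_
    simp only [Function.comp, Equiv.subLeft_apply]
    rw [mul_assoc]; congr 1
    rw [inv_zpow', ← zpow_add₀ hX0]; congr 1; ring

end
end GP
end

section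
namespace GP
open Filter Topology

section
variable {q : ℝ} [hq : Fact (0 < q ∧ q < 1)]

def Gs (q : ℝ) (w Y : ℂ) (s : ℕ) : ℂ := w ^ s * (q : ℂ) ^ ((s + 1).choose 2) * (invQ q s : ℂ) * g q s Y

def Et (q : ℝ) (Y : ℂ) (s : ℕ) : ℂ := (-Y) ^ s * (q : ℂ) ^ (s.choose 2) * (invQ q s : ℂ)

theorem choose_add2 (i j : ℕ) : (i + j + 1).choose 2 = (i + 1).choose 2 + (j + 1).choose 2 + i * j := by
  have h := fun n : ℕ => ch2_nat n
  have e1 := ch2_two ((i + j + 1 : ℕ) : ℤ)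
  have e2 := ch2_two ((i + 1 : ℕ) : ℤ)
  have e3 := ch2_two ((j + 1 : ℕ) : ℤ)
  rw [ch2_nat] at e1 e2 e3
  push_cast at e1 e2 e3
  zify
  nlinarith

theorem choose_succ2 (i : ℕ) : (i + 1).choose 2 = i.choose 2 + i := by
  rw [Nat.choose_succ_succ' i 1]; simp; ring

theorem Gs_eq (w Y : ℂ) (s : ℕ) : Gs q w Y s =
    ∑ p ∈ Finset.HasAntidiagonal.antidiagonal s, Et q (-(w * q)) p.1 * Et q (-(w * Y * q)) p.2 := by
  have hqn := q_ne (q := q)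
  unfold Gs
  rw [mul_assoc, g_eq, Finset.mul_sum, ← Finset.Nat.sum_antidiagonal_swap,
    Finset.Nat.sum_antidiagonal_eq_sum_range_succ_mk]
  refine Finset.sum_congr rfl fun j hj => ?_
  have hj' : j ≤ s := by simp at hj; omega
  obtain ⟨i, rfl⟩ := Nat.exists_eq_add_of_le hj'
  simp only [Prod.swap]
  rw [Nat.add_sub_cancel_left]
  push_cast
  rw [show (j : ℤ) + i - j = i by ring, show (j : ℤ) ^ 2 - j * (j + i) = - ((j * i : ℕ) : ℤ) by push_cast; ring,
    zpow_neg, zpow_natCast, choose_add2, Et, Et, neg_neg, neg_neg, choose_succ2, choose_succ2]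
  simp only [pow_add, mul_pow]
  field_simp

theorem Gs_main (w Y : ℂ) : Summable (fun s => ‖Gs q w Y s‖) ∧
    ∑' s, Gs q w Y s = E q (-(w * q)) * E q (-(w * Y * q)) ∧
    ∑' s, ‖Gs q w Y s‖ ≤ Ep q ‖w * q‖ * Ep q ‖w * Y * q‖ := by
  have s1 : Summable (fun s => ‖Et q (-(w * q)) s‖) := E_summ_norm _
  have s2 : Summable (fun s => ‖Et q (-(w * Y * q)) s‖) := E_summ_norm _
  simp only [Gs_eq]
  refine ⟨summable_norm_sum_mul_antidiagonal_of_summable_norm s1 s2,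
    (tsum_mul_tsum_eq_tsum_sum_antidiagonal_of_summable_norm s1 s2).symm, ?_⟩
  have e := tsum_mul_tsum_eq_tsum_sum_antidiagonal_of_summable_norm (f := fun s => ‖Et q (-(w * q)) s‖)
    (g := fun s => ‖Et q (-(w * Y * q)) s‖) (by simpa using s1) (by simpa using s2)
  have e1 : ∀ Z : ℂ, ∑' s, ‖Et q (-Z) s‖ = Ep q ‖Z‖ := by
    intro Z
    rw [← norm_neg Z]
    unfold Et; simp only [E_norm_term]; rfl
  rw [e1, e1] at e
  rw [e]
  refine (summable_norm_sum_mul_antidiagonal_of_summable_norm s1 s2).tsum_le_tsum (fun s => ?_) ?_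
  · refine (norm_sum_le _ _).trans_eq ?_
    simp
  · have := summable_norm_sum_mul_antidiagonal_of_summable_norm (f := fun s => ‖Et q (-(w * q)) s‖)
      (g := fun s => ‖Et q (-(w * Y * q)) s‖) (by simpa using s1) (by simpa using s2)
    exact this.of_norm

theorem swap_main {x : ℂ} (hx : x ≠ 0) {c : ℤ → ℂ} (hc : GB q c) (d : ℤ) :
    HasSum (fun s : ℕ => ∑' r, c r * Gs q (mo q x (-1) (-r)) (mo q x 2 (2 * r + d)) s)
      (∑' r, c r * (E q (-(mo q x (-1) (1 - r))) * E q (-(mo q x 1 (r + d + 1))))) := by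
  obtain ⟨C, D, hC, hD, hb⟩ := hc
  have h0 := hq.out.1
  have hqn := q_ne (q := q)
  have hp := (inferInstance : Fact (0 < √q ∧ √q < 1)).out.1
  have hxp := norm_pos_iff.mpr hx
  have e1 : ∀ r, mo q x (-1) (-r) * q = mo q x (-1) (1 - r) := by
    intro r
    conv_lhs => rw [← zpow_one (q : ℂ), mo_q (X := x), mo_mul hx]
    congr 1 <;> ring
  have e2 : ∀ r, mo q x (-1) (-r) * mo q x 2 (2 * r + d) * q = mo q x 1 (r + d + 1) := by
    intro r
    conv_lhs => rw [← zpow_one (q : ℂ), mo_q (X := x), mo_mul hx, mo_mul hx]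
    congr 1 <;> ring
  have n1 : ∀ a b, ‖mo q x a b‖ = ‖x‖ ^ a * q ^ b := by
    intro a b; rw [mo, norm_mul, norm_zpow, norm_zpow, norm_q]
  set y := ‖x‖ with hy
  have hM1 := MEp_nonneg (q := q) (z := y ^ (-1 : ℤ)) (by positivity)
  have hM2 := MEp_nonneg (q := q) (z := y ^ (1 : ℤ)) (by positivity)
  have hs : Summable (fun z : ℤ × ℕ => c z.1 * Gs q (mo q x (-1) (-z.1)) (mo q x 2 (2 * z.1 + d)) z.2) := by
    apply Summable.of_norm
    rw [summable_prod_of_nonneg (fun z => norm_nonneg _)]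
    simp only [norm_mul]
    refine ⟨fun r => (Gs_main _ _).1.mul_left _, ?_⟩
    simp only [tsum_mul_left]
    set τ1 := √q / y ^ (-1 : ℤ)
    set τ2 := √q / y ^ (1 : ℤ)
    have hτ1 : 0 < τ1 := by positivity
    have hτ2 : 0 < τ2 := by positivity
    have s := (summ_gauss_abs (p := q) hD (t := τ2 / τ1 * √q ^ (2 - 2 * (d + 1))) (by positivity)).mul_left
      (C * MEp q (y ^ (-1 : ℤ)) * MEp q (y ^ (1 : ℤ)) * τ1 * τ2 ^ (d + 1) * √q ^ (-1 - (d + 1) ^ 2))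
    refine s.of_nonneg_of_le (fun r => mul_nonneg (norm_nonneg _) (tsum_nonneg fun s => norm_nonneg _)) (fun r => ?_)
    have b1 := (Gs_main (q := q) (mo q x (-1) (-r)) (mo q x 2 (2 * r + d))).2.2
    rw [e1, e2, n1, n1] at b1
    have b2 := Ep_bound (q := q) (z := y ^ (-1 : ℤ)) (by positivity) (1 - r)
    have b3 := Ep_bound (q := q) (z := y ^ (1 : ℤ)) (by positivity) (r + d + 1)
    have b4 := b1.trans (mul_le_mul b2 b3 (Ep_nonneg (by positivity)) (by positivity))
    refine (mul_le_mul (hb r) b4 (tsum_nonneg fun s => norm_nonneg _) (by positivity)).trans_eq ?_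
    change _ * (MEp q (y ^ (-1 : ℤ)) * (τ1 ^ (1 - r) * _) * (MEp q (y ^ (1 : ℤ)) * (τ2 ^ (r + d + 1) * _))) = _
    clear_value τ1 τ2
    rw [q_zpow_sqrt, mul_zpow, div_zpow τ2 τ1 r, q_zpow_sqrt (r ^ 2), ← zpow_mul, zpow_sub₀ hτ1.ne', add_assoc, zpow_add₀ hτ2.ne', zpow_one]
    have e3 : √q ^ (2 * (2 * r ^ 2)) * √q ^ (-(1 - r) ^ 2) * √q ^ (-(r + (d + 1)) ^ 2) =
       √q ^ (-1 - (d + 1) ^ 2) * √q ^ ((2 - 2 * (d + 1)) * r) * √q ^ (2 * r ^ 2) := by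
      rw [← zpow_add₀ hp.ne', ← zpow_add₀ hp.ne', ← zpow_add₀ hp.ne', ← zpow_add₀ hp.ne']; congr 1; ring
    linear_combination (C * D ^ r.natAbs * MEp q (y ^ (-1 : ℤ)) * MEp q (y ^ (1 : ℤ)) * (τ1 / τ1 ^ r) * (τ2 ^ r * τ2 ^ (d + 1))) * e3
  have a1 := hs.tsum_prod
  have a2 := hs.prod_symm.hasSum.prod_fiberwise (fun s => (hs.prod_symm.prod_factor s).hasSum)
  rw [show ∑' z : ℕ × ℤ, c (Prod.swap z).1 * Gs q (mo q x (-1) (-(Prod.swap z).1)) (mo q x 2 (2 * (Prod.swap z).1 + d)) (Prod.swap z).2 =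
    ∑' z : ℤ × ℕ, c z.1 * Gs q (mo q x (-1) (-z.1)) (mo q x 2 (2 * z.1 + d)) z.2 from
    (Equiv.prodComm ℕ ℤ).tsum_eq (fun z : ℤ × ℕ => c z.1 * Gs q (mo q x (-1) (-z.1)) (mo q x 2 (2 * z.1 + d)) z.2), a1] at a2
  have a3 : ∀ r, ∑' s, c r * Gs q (mo q x (-1) (-r)) (mo q x 2 (2 * r + d)) s =
      c r * (E q (-(mo q x (-1) (1 - r))) * E q (-(mo q x 1 (r + d + 1)))) := by
    intro r
    rw [tsum_mul_left, (Gs_main _ _).2.1, e1, e2]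
  simp only [a3] at a2
  exact a2

/-- bosonic exponents -/
def B1 (k l : ℕ) (r : ℤ) : ℤ := (k + 1) * r ^ 2 - l * r + ch2 r
def B2 (k l : ℕ) (r : ℤ) : ℤ := (k + 1) * r ^ 2 + l * r + ch2 (r + 1)

def Wt1 (q : ℝ) (k l : ℕ) (x : ℂ) (r : ℤ) : ℂ := mo q x ((2 * k + 3) * r) (B1 k l r)
def Wt2 (q : ℝ) (k l : ℕ) (x : ℂ) (r : ℤ) : ℂ := mo q x ((2 * k + 3) * r + 2 * l + 1) (B2 k l r)

def PsiT (q : ℝ) (j l : ℕ) (x : ℂ) (s : ℕ) : ℂ :=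
  x ^ (-(s : ℤ)) * (q : ℂ) ^ ((s + 1).choose 2) * (invQ q s : ℂ) * Phi q (x ^ 2) j l s

theorem mo_sq (x : ℂ) (a b : ℤ) : mo q (x ^ 2) a b = mo q x (2 * a) b := by
  unfold mo; rw [zpow_mul]; simp only [zpow_ofNat]

theorem th_shift {x : ℂ} (hx : x ≠ 0) (r : ℤ) :
    E q (-(mo q x (-1) (1 - r))) * E q (-(mo q x 1 r)) = mo q x (-r) (-ch2 r) * theta q (-x) := by
  have hqn := q_ne (q := q)
  have h := theta_shift (q := q) (neg_ne_zero.mpr hx) r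
  rw [neg_neg] at h
  unfold theta at h
  have e1 : -x * (q : ℂ) ^ r = -(mo q x 1 r) := by simp [mo]
  have e2 : (q : ℂ) / (-x * (q : ℂ) ^ r) = -(mo q x (-1) (1 - r)) := by
    rw [mo, zpow_sub₀ hqn, zpow_neg_one, zpow_one]
    have : (q : ℂ) ^ r ≠ 0 := zpow_ne_zero _ hqn
    field_simp
  rw [e2, e1] at h
  rw [mul_comm, h]; rfl

end
end GP
end

section
namespace GP
open Filter Topology

section
variable {q : ℝ} [hq : Fact (0 < q ∧ q < 1)]

theorem mo_congr {x : ℂ} {a b a' b' : ℤ} (h : a = a') (h' : b = b') : mo q x a b = mo q x a' b' := by rw [h, h']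

theorem summB1 {t : ℝ} (ht : 0 < t) (k l : ℕ) : Summable (fun r : ℤ => t ^ ((2 * k + 3) * r : ℤ) * q ^ (B1 k l r)) := by
  have hp := (inferInstance : Fact (0 < √q ∧ √q < 1)).out
  have h1 := hp.1
  have : Fact (0 < √q ^ (2 * k + 3) ∧ √q ^ (2 * k + 3) < 1) :=
    ⟨by positivity, pow_lt_one₀ hp.1.le hp.2 (by omega)⟩
  have s := summ_gauss (p := √q ^ (2 * k + 3)) (t := t ^ (2 * k + 3 : ℤ) * √q ^ (-(2 * l + 1) : ℤ)) (by positivity)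
  refine s.congr fun r => ?_
  rw [mul_zpow, ← zpow_mul, q_zpow_sqrt (q := q), ← zpow_natCast, ← zpow_mul, ← zpow_mul, mul_assoc, ← zpow_add₀ h1.ne']
  congr 2
  have := ch2_two r
  unfold B1
  push_cast
  linarith

theorem summB2 {t : ℝ} (ht : 0 < t) (k l : ℕ) : Summable (fun r : ℤ => t ^ ((2 * k + 3) * r + 2 * l + 1 : ℤ) * q ^ (B2 k l r)) := by
  have hp := (inferInstance : Fact (0 < √q ∧ √q < 1)).out
  have h1 := hp.1
  have : Fact (0 < √q ^ (2 * k + 3) ∧ √q ^ (2 * k + 3) < 1) :=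
    ⟨by positivity, pow_lt_one₀ hp.1.le hp.2 (by omega)⟩
  have s := (summ_gauss (p := √q ^ (2 * k + 3)) (t := t ^ (2 * k + 3 : ℤ) * √q ^ (2 * l + 1 : ℤ)) (by positivity)).mul_left
    (t ^ (2 * l + 1 : ℤ))
  refine s.congr fun r => ?_
  rw [mul_zpow, ← zpow_mul, q_zpow_sqrt (q := q), ← zpow_natCast, ← zpow_mul, ← zpow_mul, mul_assoc (t ^ _), ← zpow_add₀ h1.ne', ← mul_assoc, ← zpow_add₀ ht.ne']
  have := ch2_two (r + 1)
  unfold B2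
  congr 2
  · ring
  · push_cast; linarith

theorem Wt1_summ {x : ℂ} (hx : x ≠ 0) (k l : ℕ) : Summable (Wt1 q k l x) := by
  refine Summable.of_norm ((summB1 (q := q) (norm_pos_iff.mpr hx) k l).congr fun r => ?_)
  rw [Wt1, mo, norm_mul, norm_zpow, norm_zpow, norm_q]

theorem Wt2_summ {x : ℂ} (hx : x ≠ 0) (k l : ℕ) : Summable (Wt2 q k l x) := by
  refine Summable.of_norm ((summB2 (q := q) (norm_pos_iff.mpr hx) k l).congr fun r => ?_)
  rw [Wt2, mo, norm_mul, norm_zpow, norm_zpow, norm_q]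

theorem aF_Wt1 {x : ℂ} (hx : x ≠ 0) (i l : ℕ) (r : ℤ) :
    mo q (x ^ 2) (l * r) (l * r ^ 2 - l * r) * aF q (x ^ 2) (i + 2) r * mo q x (-r) (-ch2 r) = Wt1 q (i + l) l x r := by
  rw [aF_mo, mo_sq, mo_sq, mo_mul hx, mo_mul hx, Wt1, B1]
  have := ch2_two r
  congr 1
  · push_cast; ring
  · push_cast; linarith

theorem aF_Wt2 {x : ℂ} (hx : x ≠ 0) (i l : ℕ) (r : ℤ) :
    mo q (x ^ 2) (l * (r + 1)) (l * (r + 1) ^ 2 - l * (r + 1)) * (x ^ 2 * (q : ℂ) ^ (2 * r) * aF q (x ^ 2) (i + 2) r)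
      * mo q x (-(r + 1)) (-ch2 (r + 1)) = Wt2 q (i + l) l x r := by
  have e : x ^ 2 = mo q x 2 0 := by simp [mo]
  rw [aF_mo, mo_sq, mo_sq, e, mo_q (X := x), mo_mul hx, mo_mul hx, mo_mul hx, mo_mul hx, Wt2, B2]
  have := ch2_two (r + 1)
  congr 1
  · push_cast; ring
  · push_cast; linarith

theorem PsiT1 {x : ℂ} (hx : x ≠ 0) (i l s : ℕ) : theta q (x ^ 2) * PsiT q (i + l) (l + 1) x s =
    ∑' r, (mo q (x ^ 2) ((l + 1 : ℕ) * r) ((l + 1 : ℕ) * r ^ 2 - (l + 1 : ℕ) * r) * gam q (x ^ 2) (i + 2) r) *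
      Gs q (mo q x (-1) (-r)) (mo q x 2 (2 * r + (-1))) s := by
  have h := (Phi_T1 (q := q) (pow_ne_zero 2 hx) i l s).mul_left (x ^ (-(s : ℤ)) * (q : ℂ) ^ ((s + 1).choose 2) * (invQ q s : ℂ))
  rw [PsiT, mul_left_comm, ← h.tsum_eq]
  refine tsum_congr fun r => ?_
  rw [T1, Gs, ← zpow_natCast (mo q x (-1) (-r)), mo_zpow, mo_sq, mo_sq, mo_sq,
    show x ^ (-(s : ℤ)) = mo q x (-s) 0 by simp [mo],
    show ∀ a b c d e f : ℂ, a * b * c * (d * e * f) = (a * d) * e * (b * c * f) by intros; ring, mo_mul hx,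
    show ∀ a b c d e f : ℂ, a * b * (c * d * e * f) = (a * c) * b * (d * e * f) by intros; ring, mo_mul hx]
  refine congrArg₂ _ (congrArg₂ _ (mo_congr (by ring) (by ring)) rfl) (congrArg _ (congrArg _ (mo_congr (by ring) (by ring))))

theorem PsiT0 {x : ℂ} (hx : x ≠ 0) (j s : ℕ) : theta q (x ^ 2) * PsiT q j 0 x s =
    ∑' r, (aF q (x ^ 2) (j + 3) r * (1 - x ^ 2 * (q : ℂ) ^ (2 * r))) *
      Gs q (mo q x (-1) (-r)) (mo q x 2 (2 * r + 0)) s := by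
  have h := (Phi_T0 (q := q) (pow_ne_zero 2 hx) j s).mul_left (x ^ (-(s : ℤ)) * (q : ℂ) ^ ((s + 1).choose 2) * (invQ q s : ℂ))
  rw [PsiT, mul_left_comm, ← h.tsum_eq]
  refine tsum_congr fun r => ?_
  rw [T0, Gs, ← zpow_natCast (mo q x (-1) (-r)), mo_zpow, mo_sq, mo_q (X := x) (-(s * r : ℤ)),
    show x ^ (-(s : ℤ)) = mo q x (-s) 0 by simp [mo],
    show ∀ a b c d e f g : ℂ, a * b * c * (d * e * f * g) = (a * f) * (d * e) * (b * c * g) by intros; ring, mo_mul hx,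
    show ∀ b c d e f : ℂ, b * (c * d * e * f) = c * b * (d * e * f) by intros; ring, add_zero]
  refine congrArg₂ _ (congrArg₂ _ (mo_congr (by ring) (by ring)) rfl) (congrArg _ (congrArg _ (mo_congr (by ring) (by ring))))

theorem Psi_main {x : ℂ} (hx : x ≠ 0) (j l : ℕ) (hl : l ≤ j + 1) :
    HasSum (fun s => theta q (x ^ 2) * PsiT q j l x s)
      (theta q (-x) * (∑' r, Wt1 q (j + 1) l x r - ∑' r, Wt2 q (j + 1) l x r)) := by
  have hX : x ^ 2 ≠ 0 := pow_ne_zero 2 hx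
  have hqn := q_ne (q := q)
  rcases l with _ | l
  · have h := swap_main hx (chain0 (q := q) hX (j + 1)).1 0
    simp only [PsiT0 hx]
    convert h using 1
    rw [← (Wt1_summ (q := q) hx _ _).tsum_sub (Wt2_summ hx _ _), ← tsum_mul_left]
    refine tsum_congr fun r => ?_
    have e1 := E_fe (q := q) (-(mo q x 1 r))
    have e2 : -(mo q x 1 r) * q = -(mo q x 1 (r + 0 + 1)) := by
      rw [add_zero, mo, mo, zpow_add_one₀ hqn]; ring
    rw [e2] at e1
    have e3 := th_shift (q := q) hx r
    rw [e1] at e3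
    have f1 := aF_Wt1 (q := q) hx (j + 1) 0 r
    have f2 : mo q x 1 r * (aF q (x ^ 2) (j + 1 + 2) r * mo q x (-r) (-ch2 r)) = Wt2 q (j + 1) 0 x r := by
      rw [aF_mo, mo_sq, mo_mul hx, mo_mul hx, Wt2, B2, ch2_succ]
      have := ch2_two r
      congr 1
      · push_cast; ring
      · push_cast; linarith
    have f3 : mo q (x ^ 2) ((0 : ℕ) * r) ((0 : ℕ) * r ^ 2 - (0 : ℕ) * r) = 1 := by simp [mo]
    rw [f3, one_mul] at f1
    have f4 : x ^ 2 * (q : ℂ) ^ (2 * r) = (mo q x 1 r) ^ 2 := by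
      rw [mo, mul_pow, mul_comm 2 r, zpow_mul]; simp
    rw [f4, ← f2]
    simp only [add_zero] at *
    rw [← f1]
    linear_combination (-(aF q (x ^ 2) (j + 1 + 2) r) * (1 - mo q x 1 r)) * e3
  · obtain ⟨i, rfl⟩ : ∃ i, j = i + l := ⟨j - l, by omega⟩
    have h := swap_main hx (chain2 (q := q) hX i (l + 1)).1 (-1)
    simp only [PsiT1 hx]
    convert h using 1
    have s2 := (Equiv.addRight (-1 : ℤ)).summable_iff.mpr (Wt2_summ (q := q) hx (i + l + 1) (l + 1))
    have e2 := (Equiv.addRight (-1 : ℤ)).tsum_eq (Wt2 q (i + l + 1) (l + 1) x)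
    rw [← e2]
    change theta q (-x) * (_ - ∑' c, (Wt2 q (i + l + 1) (l + 1) x ∘ ⇑(Equiv.addRight (-1 : ℤ))) c) = _
    rw [← (Wt1_summ (q := q) hx _ _).tsum_sub s2, ← tsum_mul_left]
    refine tsum_congr fun r => ?_
    have e3 := th_shift (q := q) hx r
    have f1 := aF_Wt1 (q := q) hx i (l + 1) r
    have f2 := aF_Wt2 (q := q) hx i (l + 1) (r - 1)
    rw [show r + -1 + 1 = r by ring, e3]
    simp only [Equiv.coe_addRight, Function.comp]
    rw [show r + -1 = r - 1 by ring, show i + l + 1 = i + (l + 1) by ring, ← f1, ← f2, gam,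
      show r - 1 + 1 = r by ring, show 2 * (r - 1) = 2 * r - 2 by ring]
    ring

end
end GP
end

section
namespace GP
open Filter Topology

/-- absolutely convergent generating series on the circle of radius t -/
def GS {ι : Type} (t : ℝ) (c : ι → ENNReal) (e : ι → ℤ) (φ : ℂ → ℂ) : Prop :=
  ∑' i, c i * oR (t ^ e i) ≠ ⊤ ∧ ∀ X : ℂ, ‖X‖ = t → HasSum (fun i => ((c i).toReal : ℂ) * X ^ e i) (φ X)

theorem GS.mul {ι κ : Type} {t : ℝ} (ht : 0 < t) {c : ι → ENNReal} {e : ι → ℤ} {φ : ℂ → ℂ}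
    {c' : κ → ENNReal} {e' : κ → ℤ} {φ' : ℂ → ℂ} (h : GS t c e φ) (h' : GS t c' e' φ') :
    GS t (fun p : ι × κ => c p.1 * c' p.2) (fun p => e p.1 + e' p.2) (fun X => φ X * φ' X) := by
  have hfin : ∑' p : ι × κ, c p.1 * c' p.2 * oR (t ^ (e p.1 + e' p.2)) ≠ ⊤ := by
    have : ∑' p : ι × κ, c p.1 * c' p.2 * oR (t ^ (e p.1 + e' p.2)) =
        (∑' i, c i * oR (t ^ e i)) * ∑' i, c' i * oR (t ^ e' i) := by
      rw [ENNReal.tsum_prod', ← ENNReal.tsum_mul_right]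
      refine tsum_congr fun i => ?_
      rw [← ENNReal.tsum_mul_left]
      refine tsum_congr fun k => ?_
      simp only []
      rw [zpow_add₀ ht.ne', oR_mul (by positivity)]; ring
    rw [this]; exact ENNReal.mul_ne_top h.1 h'.1
  refine ⟨hfin, fun X hX => ?_⟩
  have hX0 : X ≠ 0 := by intro h; rw [h, norm_zero] at hX; exact ht.ne hX
  have hs := (group ht hfin hX).1
  have e1 : ∀ p : ι × κ, ((c p.1 * c' p.2).toReal : ℂ) * X ^ (e p.1 + e' p.2) =
      (((c p.1).toReal : ℂ) * X ^ e p.1) * (((c' p.2).toReal : ℂ) * X ^ e' p.2) := by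
    intro p
    rw [ENNReal.toReal_mul, zpow_add₀ hX0]; push_cast; ring
  simp only [e1] at hs ⊢
  have h3 := hs.hasSum
  rwa [← HasSum.mul_eq (h.2 X hX) (h'.2 X hX) h3] at h3

theorem GS.const {ι : Type} {t : ℝ} {c : ι → ENNReal} {e : ι → ℤ} {φ : ℂ → ℂ} (h : GS t c e φ) {a : ℝ} (ha : 0 ≤ a) :
    GS t (fun i => oR a * c i) e (fun X => a * φ X) := by
  constructor
  · simp_rw [mul_assoc]; rw [ENNReal.tsum_mul_left]; exact ENNReal.mul_ne_top (oR_ne_top _) h.1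
  · intro X hX
    refine ((h.2 X hX).mul_left (a : ℂ)).congr_fun fun i => ?_
    rw [ENNReal.toReal_mul, oR_toReal ha]; push_cast; ring

theorem GS.of_real {ι : Type} {t : ℝ} (ht : 0 < t) {c : ι → ℝ} (hc : ∀ i, 0 ≤ c i) {e : ι → ℤ} {φ : ℂ → ℂ}
    (hs : Summable (fun i => c i * t ^ e i))
    (h : ∀ X : ℂ, ‖X‖ = t → HasSum (fun i => (c i : ℂ) * X ^ e i) (φ X)) : GS t (fun i => oR (c i)) e φ := by
  constructor
  · simp_rw [← oR_mul (hc _)]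
    exact oR_tsum (fun i => mul_nonneg (hc i) (by positivity)) hs
  · intro X hX
    refine (h X hX).congr_fun fun i => ?_
    rw [oR_toReal (hc i)]

def grp {ι : Type} (c : ι → ENNReal) (e : ι → ℤ) (A : ℤ) : ENNReal := ∑' i, if e i = A then c i else 0

theorem GS.grp_hasSum {ι : Type} {t : ℝ} (ht : 0 < t) {c : ι → ENNReal} {e : ι → ℤ} {φ : ℂ → ℂ} (h : GS t c e φ)
    {X : ℂ} (hX : ‖X‖ = t) : HasSum (fun A => ((grp c e A).toReal : ℂ) * X ^ A) (φ X) := by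
  rw [← (h.2 X hX).tsum_eq]
  exact (group ht h.1 hX).2

theorem GS.grp_fin {ι : Type} {t : ℝ} {c : ι → ENNReal} {e : ι → ℤ} {φ : ℂ → ℂ} (h : GS t c e φ) :
    ∑' A, grp c e A * oR (t ^ A) ≠ ⊤ := by
  unfold grp; rw [group_fin]; exact h.1

theorem GS.grp_summ {ι : Type} {t : ℝ} (ht : 0 < t) {c : ι → ENNReal} {e : ι → ℤ} {φ : ℂ → ℂ} (h : GS t c e φ) :
    Summable (fun A => (grp c e A).toReal * t ^ A) := by
  refine (ENNReal.summable_toReal h.grp_fin).congr fun A => ?_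
  rw [ENNReal.toReal_mul, oR_toReal (by positivity)]

theorem GS.grp_ne {ι : Type} {t : ℝ} (ht : 0 < t) {c : ι → ENNReal} {e : ι → ℤ} {φ : ℂ → ℂ} (h : GS t c e φ) (A : ℤ) :
    grp c e A ≠ ⊤ := by
  have := ENNReal.ne_top_of_tsum_ne_top h.grp_fin A
  intro h2
  apply this
  rw [h2, ENNReal.top_mul]
  exact (ENNReal.ofReal_pos.mpr (by positivity)).ne'

/-- f = g - h from generating functions -/
theorem GS.uniq {ι κ μ : Type} {t : ℝ} (ht : 0 < t) {c : ι → ENNReal} {e : ι → ℤ} {φ : ℂ → ℂ}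
    {c1 : κ → ENNReal} {e1 : κ → ℤ} {φ1 : ℂ → ℂ} {c2 : μ → ENNReal} {e2 : μ → ℤ} {φ2 : ℂ → ℂ}
    (h : GS t c e φ) (h1 : GS t c1 e1 φ1) (h2 : GS t c2 e2 φ2) (hφ : ∀ X, ‖X‖ = t → φ X = φ1 X - φ2 X) (A : ℤ) :
    (grp c e A).toReal = (grp c1 e1 A).toReal - (grp c2 e2 A).toReal := by
  have := laurent_unique (f := fun A => ((grp c e A).toReal : ℂ))
    (g := fun A => ((grp c1 e1 A).toReal : ℂ) - ((grp c2 e2 A).toReal : ℂ)) (φ := φ) ht ?_ ?_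
    (fun X hX => h.grp_hasSum ht hX) (fun X hX => ?_)
  · have := congrFun this A
    exact_mod_cast this
  · refine (h.grp_summ ht).congr fun A => ?_
    rw [Complex.norm_real, Real.norm_of_nonneg ENNReal.toReal_nonneg]
  · refine ((h1.grp_summ ht).add (h2.grp_summ ht)).of_nonneg_of_le (fun A => by positivity) (fun A => ?_)
    rw [← add_mul]
    refine mul_le_mul_of_nonneg_right ((norm_sub_le _ _).trans_eq ?_) (by positivity)
    rw [Complex.norm_real, Real.norm_of_nonneg ENNReal.toReal_nonneg, Complex.norm_real, Real.norm_of_nonneg ENNReal.toReal_nonneg]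
  · rw [hφ X hX]
    exact ((h1.grp_hasSum ht hX).sub (h2.grp_hasSum ht hX)).congr_fun fun A => by ring

section
variable {q : ℝ} [hq : Fact (0 < q ∧ q < 1)]

theorem Ep_oR {y : ℝ} (hy : 0 ≤ y) : ∑' s : ℕ, oR (y ^ s * q ^ (s.choose 2) * invQ q s) = oR (Ep q y) := by
  have h0 := hq.out.1
  exact (ENNReal.ofReal_tsum_of_nonneg (fun s => mul_nonneg (by positivity) (invQ_nonneg _)) (Ep_summ hy)).symm

theorem PS_fin {t u : ℝ} (ht : 0 < t) (hu : 0 < u) (j l : ℕ) :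
    ∑' s : ℕ, oR (q ^ ((s + 1).choose 2) * invQ q s * u ^ s) * ∑' A, FF q j l s A * oR (t ^ A) ≠ ⊤ := by
  have h0 := hq.out.1
  have hp := (inferInstance : Fact (0 < √q ∧ √q < 1)).out.1
  obtain ⟨M, hM, hb⟩ := R_bound (q := q) ht j (l - 1)
  have e1 : ∀ s : ℕ, ∑' A, FF q j l s A * oR (t ^ A) ≤ ∑' N : ℤ, oR (q ^ (N ^ 2 - (eps l + s) * N)) * oR (t ^ N) * M := by
    intro s
    have h := group_fin (c := fun i : ℤ × ℤ => oR (q ^ (i.1 ^ 2 - (eps l + s) * i.1)) * R q j (l - 1) i.1 i.2)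
      (e := fun i => i.1 + i.2) (t := t)
    rw [group2_fin (fun N => oR (q ^ (N ^ 2 - (eps l + s) * N))) _ ht] at h
    have e2 := fun A => group2_eq (fun N : ℤ => oR (q ^ (N ^ 2 - (eps l + s) * N))) (R q j (l - 1)) A
    simp only [e2] at h
    unfold FF
    rw [h]
    exact ENNReal.tsum_le_tsum fun N => mul_le_mul_right (hb N) _
  have e3 : ∑' s : ℕ, oR (q ^ ((s + 1).choose 2) * invQ q s * u ^ s) * ∑' A, FF q j l s A * oR (t ^ A) ≤
      ∑' N : ℤ, oR (q ^ (N ^ 2 - eps l * N) * t ^ N * Ep q (u * q ^ (1 - N))) * M := by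
    refine (ENNReal.tsum_le_tsum fun s => mul_le_mul_right (e1 s) _).trans_eq ?_
    simp_rw [← ENNReal.tsum_mul_left]
    rw [ENNReal.tsum_comm]
    refine tsum_congr fun N => ?_
    simp_rw [← mul_assoc]
    rw [ENNReal.tsum_mul_right, oR_mul (by positivity), ← Ep_oR (by positivity), ← ENNReal.tsum_mul_left]
    congr 1
    refine tsum_congr fun s => ?_
    rw [← oR_mul (mul_nonneg (mul_nonneg (by positivity) (invQ_nonneg _)) (by positivity)),
      ← oR_mul (mul_nonneg (mul_nonneg (mul_nonneg (by positivity) (invQ_nonneg _)) (by positivity)) (by positivity)), ← oR_mul (by positivity)]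
    congr 1
    rw [choose_succ2, pow_add, mul_pow, ← zpow_natCast (q ^ (1 - N)), ← zpow_mul]
    have : q ^ (N ^ 2 - (eps l + s) * N) * q ^ s = q ^ (N ^ 2 - eps l * N) * q ^ ((1 - N) * s) := by
      rw [← zpow_natCast, ← zpow_add₀ h0.ne', ← zpow_add₀ h0.ne']; congr 1; ring
    linear_combination (q ^ (s.choose 2) * invQ q s * u ^ s * t ^ N) * this
  refine ne_top_of_le_ne_top ?_ e3
  rw [ENNReal.tsum_mul_right]
  refine ENNReal.mul_ne_top ?_ hM
  refine oR_tsum (fun N => mul_nonneg (by positivity) (Ep_nonneg (by positivity))) ?_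
  have s := (summ_gauss (p := √q) (t := t * √q ^ (2 - 2 * eps l) * (√q / u)⁻¹) (by positivity)).mul_left
    (MEp q u * (√q / u) * √q ^ (-1 : ℤ))
  refine s.of_nonneg_of_le (fun N => mul_nonneg (by positivity) (Ep_nonneg (by positivity))) fun N => ?_
  refine (mul_le_mul_of_nonneg_left (Ep_bound hu (1 - N)) (by positivity)).trans_eq ?_
  generalize hτ : √q / u = τ
  have hτ' : 0 < τ := by rw [← hτ]; positivity
  rw [q_zpow_sqrt (q := q), mul_zpow, mul_zpow, inv_zpow, ← zpow_mul √q, zpow_sub₀ hτ'.ne', zpow_one]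
  have : √q ^ (2 * (N ^ 2 - eps l * N)) * √q ^ (-(1 - N) ^ 2) = √q ^ (-1 : ℤ) * √q ^ ((2 - 2 * eps l) * N) * √q ^ (N ^ 2) := by
    rw [← zpow_add₀ hp.ne', ← zpow_add₀ hp.ne', ← zpow_add₀ hp.ne']; congr 1; ring
  linear_combination (MEp q u * t ^ N * (τ / τ ^ N)) * this

end
end GP
end

section
namespace GP
open Filter Topology

theorem tsum_oR {ι : Type*} {f : ι → ℝ} (h0 : ∀ i, 0 ≤ f i) : ∑' i, f i = (∑' i, oR (f i)).toReal := by
  rw [ENNReal.tsum_toReal_eq (fun i => oR_ne_top _)]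
  exact tsum_congr fun i => (oR_toReal (h0 i)).symm

theorem grp_mul {ι κ : Type} (c : ι → ENNReal) (e : ι → ℤ) (c' : κ → ENNReal) (e' : κ → ℤ) (A : ℤ) :
    grp (fun p : ι × κ => c p.1 * c' p.2) (fun p => e p.1 + e' p.2) A = ∑' r, c' r * grp c e (A - e' r) := by
  unfold grp
  rw [ENNReal.tsum_prod', ENNReal.tsum_comm]
  refine tsum_congr fun r => ?_
  rw [← ENNReal.tsum_mul_left]
  refine tsum_congr fun i => ?_
  by_cases h : e i + e' r = A
  · rw [if_pos h, if_pos (by omega), mul_comm]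
  · rw [if_neg h, if_neg (by omega), mul_zero]

def Ftot (q : ℝ) (j l : ℕ) (A : ℤ) : ENNReal :=
  grp (fun i : ℕ × ℤ => oR (q ^ ((i.1 + 1).choose 2) * invQ q i.1) * FF q j l i.1 i.2) (fun i => 2 * i.2 - i.1) A

section
variable {q : ℝ} [hq : Fact (0 < q ∧ q < 1)]

theorem GS_lhs {t : ℝ} (ht : 0 < t) (j l : ℕ) :
    GS t (fun i : ℕ × ℤ => oR (q ^ ((i.1 + 1).choose 2) * invQ q i.1) * FF q j l i.1 i.2) (fun i => 2 * i.2 - i.1)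
      (fun x => ∑' s, PsiT q j l x s) := by
  have h0 := hq.out.1
  have hfin : ∑' i : ℕ × ℤ, oR (q ^ ((i.1 + 1).choose 2) * invQ q i.1) * FF q j l i.1 i.2 * oR (t ^ (2 * i.2 - i.1)) ≠ ⊤ := by
    have h := PS_fin (q := q) (t := t ^ 2) (u := t⁻¹) (by positivity) (by positivity) j l
    convert h using 1
    rw [ENNReal.tsum_prod']
    refine tsum_congr fun s => ?_
    rw [← ENNReal.tsum_mul_left]
    refine tsum_congr fun A => ?_
    simp only []
    rw [oR_mul (mul_nonneg (by positivity) (invQ_nonneg _)), zpow_sub₀ ht.ne', div_eq_mul_inv, oR_mul (x := q ^ ((s + 1).choose 2)) (by positivity), zpow_mul, zpow_natCast,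
      oR_mul (x := (t ^ (2 : ℤ)) ^ A) (by positivity), inv_pow]
    norm_cast
    ring
  refine ⟨hfin, fun X hX => ?_⟩
  have hX0 : X ≠ 0 := by intro h; rw [h, norm_zero] at hX; exact ht.ne hX
  have hs := (group ht hfin hX).1
  convert hs.hasSum using 1
  rw [hs.tsum_prod]
  refine tsum_congr fun s => ?_
  rw [PsiT, ← (FF_link (q := q) (pow_ne_zero 2 hX0) j l s).tsum_eq, ← tsum_mul_left]
  refine tsum_congr fun A => ?_
  simp only []
  rw [ENNReal.toReal_mul, oR_toReal (mul_nonneg (by positivity) (invQ_nonneg _)), sub_eq_add_neg, zpow_add₀ hX0, zpow_mul]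
  push_cast
  norm_cast
  push_cast
  ring

theorem GS_theta {t : ℝ} (ht : 0 < t) : GS t (fun n : ℤ => oR (q ^ ch2 n)) (fun n => n) (fun X => theta q (-X) * E q q) := by
  have h0 := hq.out.1
  have hp := (inferInstance : Fact (0 < √q ∧ √q < 1)).out.1
  refine GS.of_real ht (fun n => by positivity) ?_ (fun X hX => ?_)
  · refine (summ_gauss (p := √q) (t := t * √q ^ (-1 : ℤ)) (by positivity)).congr fun n => ?_
    rw [q_zpow_sqrt (q := q), mul_zpow, ← zpow_mul, ch2_two, mul_assoc, ← zpow_add₀ hp.ne', mul_comm]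
    congr 2; ring
  · have hX0 : X ≠ 0 := by intro h; rw [h, norm_zero] at hX; exact ht.ne hX
    refine (JTP (q := q) (neg_ne_zero.mpr hX0)).congr_fun fun n => ?_
    push_cast
    rw [neg_neg]; ring

theorem E2_eq {Y : ℂ} (hY : ‖Y‖ < 1) : E2 q Y = (E q Y)⁻¹ := eq_inv_of_mul_eq_one_right (E_mul_E2 hY)

theorem GS_E2a {t : ℝ} (ht : 0 < t) (h1 : t ^ 2 < 1) :
    GS t (fun n : ℕ => oR (invQ q n)) (fun n => 2 * n) (fun X => (E q (X ^ 2))⁻¹) := by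
  refine GS.of_real ht (fun n => invQ_nonneg _) ?_ (fun X hX => ?_)
  · have := E2_summ_norm (q := q) (Y := ((t ^ 2 : ℝ) : ℂ)) (by rw [Complex.norm_real, Real.norm_of_nonneg (by positivity)]; exact h1)
    refine this.congr fun n => ?_
    rw [norm_mul, norm_pow, Complex.norm_real, Complex.norm_real, Real.norm_of_nonneg (by positivity), Real.norm_of_nonneg (invQ_nonneg _)]
    rw [zpow_mul]; norm_cast; ring
  · have hn : ‖X ^ 2‖ < 1 := by rw [norm_pow, hX]; exact h1
    rw [← E2_eq hn]
    refine (E2_summ_norm (q := q) hn).of_norm.hasSum.congr_fun fun n => ?_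
    rw [zpow_mul]; norm_cast; ring

theorem GS_E2b {t : ℝ} (ht : 0 < t) (h1 : q < t ^ 2) :
    GS t (fun n : ℕ => oR (q ^ n * invQ q n)) (fun n => -(2 * n)) (fun X => (E q (q / X ^ 2))⁻¹) := by
  have h0 := hq.out.1
  have h2 : q / t ^ 2 < 1 := by rw [div_lt_one (by positivity)]; exact h1
  refine GS.of_real ht (fun n => mul_nonneg (by positivity) (invQ_nonneg _)) ?_ (fun X hX => ?_)
  · have := E2_summ_norm (q := q) (Y := ((q / t ^ 2 : ℝ) : ℂ)) (by rw [Complex.norm_real, Real.norm_of_nonneg (by positivity)]; exact h2)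
    refine this.congr fun n => ?_
    rw [norm_mul, norm_pow, Complex.norm_real, Complex.norm_real, Real.norm_of_nonneg (by positivity), Real.norm_of_nonneg (invQ_nonneg _)]
    rw [zpow_neg, zpow_mul, div_pow]; norm_cast; ring
  · have hn : ‖(q : ℂ) / X ^ 2‖ < 1 := by rw [norm_div, norm_pow, norm_q, hX]; exact h2
    rw [← E2_eq hn]
    refine (E2_summ_norm (q := q) hn).of_norm.hasSum.congr_fun fun n => ?_
    rw [zpow_neg, zpow_mul, div_pow]; norm_cast; push_cast; ring

def Vc (q : ℝ) (p : (ℕ × ℕ) × ℤ) : ENNReal :=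
  oR (qPInf q q)⁻¹ * ((oR (invQ q p.1.1) * oR (q ^ p.1.2 * invQ q p.1.2)) * oR (q ^ ch2 p.2))
def Ve (p : (ℕ × ℕ) × ℤ) : ℤ := (2 * p.1.1 + -(2 * p.1.2)) + p.2

theorem GS_V {t : ℝ} (ht : 0 < t) (h1 : q < t ^ 2) (h2 : t ^ 2 < 1) :
    GS t (Vc q) Ve (fun X => (qPInf q q : ℝ)⁻¹ * ((E q (X ^ 2))⁻¹ * (E q (q / X ^ 2))⁻¹ * (theta q (-X) * E q q))) := by
  have := (GS.mul ht (GS.mul ht (GS_E2a (q := q) ht h2) (GS_E2b (q := q) ht h1)) (GS_theta (q := q) ht)).const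
    (a := (qPInf q q)⁻¹) (inv_nonneg.mpr (qPInf_pos (q := q)).le)
  exact this

theorem V_eq (A : ℤ) : V q (-A) = (grp (Vc q) Ve A).toReal := by
  have h0 := hq.out.1
  have hP := qPInf_pos (q := q)
  rw [V, ← tsum_mul_left]
  refine (tsum_oR (fun i => ?_)).trans ?_
  · have h1 := qP_pos (q := q) i.1
    have h2 := qP_pos (q := q) i.2
    positivity
  congr 1
  conv_rhs => rw [grp, ENNReal.tsum_prod']
  refine tsum_congr fun p => ?_
  rw [tsum_eq_single (A - (2 * p.1 + -(2 * p.2)))]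
  · rw [if_pos (by simp only [Ve]; ring), Vc, ← invQ_nat, ← invQ_nat, ← oR_mul (invQ_nonneg _),
      ← oR_mul (mul_nonneg (invQ_nonneg _) (mul_nonneg (by positivity) (invQ_nonneg _))), ← oR_mul (by positivity), Real.rpow_intCast,
      zpow_add₀ h0.ne', zpow_natCast]
    congr 1
    simp only []
    rw [show 2 * (p.2 : ℤ) - 2 * p.1 - -A = A - (2 * p.1 + -(2 * p.2)) by ring]
    ring
  · intro n hn
    rw [if_neg]
    simp only [Ve]; omega

theorem GS_Wt1 {t : ℝ} (ht : 0 < t) (k l : ℕ) :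
    GS t (fun r : ℤ => oR (q ^ B1 k l r)) (fun r => (2 * k + 3) * r) (fun X => ∑' r, Wt1 q k l X r) := by
  have h0 := hq.out.1
  refine GS.of_real ht (fun n => by positivity) ((summB1 (q := q) ht k l).congr fun r => mul_comm _ _) (fun X hX => ?_)
  have hX0 : X ≠ 0 := by intro h; rw [h, norm_zero] at hX; exact ht.ne hX
  refine (Wt1_summ (q := q) hX0 k l).hasSum.congr_fun fun r => ?_
  rw [Wt1, mo]; push_cast; ring

theorem GS_Wt2 {t : ℝ} (ht : 0 < t) (k l : ℕ) :
    GS t (fun r : ℤ => oR (q ^ B2 k l r)) (fun r => (2 * k + 3) * r + 2 * l + 1) (fun X => ∑' r, Wt2 q k l X r) := by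
  have h0 := hq.out.1
  refine GS.of_real ht (fun n => by positivity) ((summB2 (q := q) ht k l).congr fun r => mul_comm _ _) (fun X hX => ?_)
  have hX0 : X ≠ 0 := by intro h; rw [h, norm_zero] at hX; exact ht.ne hX
  refine (Wt2_summ (q := q) hX0 k l).hasSum.congr_fun fun r => ?_
  rw [Wt2, mo]; push_cast; ring

theorem boson (j l : ℕ) (hl : l ≤ j + 1) (A : ℤ) :
    HasSum (fun r : ℤ => q ^ B2 (j + 1) l r * (V q (-A - (2 * (j + 1 : ℕ) + 3) * r) - V q (-A + (2 * (j + 1 : ℕ) + 3) * r + 2 * l + 1)))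
      (Ftot q j l A).toReal := by
  have h0 := hq.out.1
  have hp := (inferInstance : Fact (0 < √q ∧ √q < 1)).out
  have hss := sqrt_sq_q (q := q)
  obtain ⟨t, ht, ht2⟩ : ∃ t : ℝ, 0 < t ∧ t ^ 2 = √q := ⟨√√q, by have := hp.1; positivity, Real.sq_sqrt hp.1.le⟩
  have hlt : q < √q := by nlinarith [hp.1, hp.2]
  have hV := GS_V (q := q) ht (by rw [ht2]; exact hlt) (by rw [ht2]; exact hp.2)
  have g1 := GS.mul ht hV (GS_Wt1 (q := q) ht (j + 1) l)
  have g2 := GS.mul ht hV (GS_Wt2 (q := q) ht (j + 1) l)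
  have key := GS.uniq ht (GS_lhs (q := q) ht j l) g1 g2 (fun X hX => ?_) A
  · have n1 := g1.grp_ne ht A
    have n2 := g2.grp_ne ht A
    have m1 := grp_mul (Vc q) Ve (fun r : ℤ => oR (q ^ B1 (j + 1) l r)) (fun r => (2 * (j + 1 : ℕ) + 3) * r) A
    have m2 := grp_mul (Vc q) Ve (fun r : ℤ => oR (q ^ B2 (j + 1) l r)) (fun r => (2 * (j + 1 : ℕ) + 3) * r + 2 * l + 1) A
    rw [m1] at n1 key
    rw [m2] at n2 key
    have s1 := (ENNReal.summable_toReal n1).hasSum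
    have s2 := (ENNReal.summable_toReal n2).hasSum
    rw [← ENNReal.tsum_toReal_eq (fun r => ENNReal.ne_top_of_tsum_ne_top n1 r)] at s1
    rw [← ENNReal.tsum_toReal_eq (fun r => ENNReal.ne_top_of_tsum_ne_top n2 r)] at s2
    rw [Ftot, key]
    refine (((Equiv.neg ℤ).hasSum_iff.mpr s1).sub s2).congr_fun fun r => ?_
    simp only [Function.comp, Equiv.neg_apply]
    rw [ENNReal.toReal_mul, ENNReal.toReal_mul, ← V_eq, ← V_eq, oR_toReal (by positivity), oR_toReal (by positivity)]
    have e1 : B1 (j + 1) l (-r) = B2 (j + 1) l r := by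
      unfold B1 B2
      have a1 := ch2_two (-r)
      have a2 := ch2_two (r + 1)
      have : ch2 (-r) = ch2 (r + 1) := by nlinarith
      rw [this]; ring
    rw [e1, mul_sub]
    congr 3 <;> (push_cast; ring)
  · have hX0 : X ≠ 0 := by intro h; rw [h, norm_zero] at hX; exact ht.ne hX
    have hth : theta q (X ^ 2) ≠ 0 := theta_ne (by rw [norm_pow, hX, ht2]; exact hlt) (by rw [norm_pow, hX, ht2]; exact hp.2)
    have h := Psi_main (q := q) hX0 j l hl
    have h2 := h.tsum_eq
    rw [tsum_mul_left] at h2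
    have hE := Eq_ne (q := q)
    have hP := qPInf_eq (q := q)
    have ht1 : E q (X ^ 2) ≠ 0 := fun h => hth (by rw [theta, h, zero_mul])
    have ht2 : E q (q / X ^ 2) ≠ 0 := fun h => hth (by rw [theta, h, mul_zero])
    push_cast
    rw [hP]
    apply mul_left_cancel₀ hth
    have hθ : theta q (X ^ 2) = E q (X ^ 2) * E q (q / X ^ 2) := rfl
    rw [h2, hθ]
    field_simp

end
end GP
end

section
namespace GP
open Filter Topology

/-- q-binomial for integers -/
def qB (q : ℝ) (a b : ℤ) : ℝ := (invQ q a)⁻¹ * invQ q b * invQ q (a - b)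

section
variable {q : ℝ} [hq : Fact (0 < q ∧ q < 1)]

theorem qB_nonneg (a b : ℤ) : 0 ≤ qB q a b :=
  mul_nonneg (mul_nonneg (inv_nonneg.mpr (invQ_nonneg _)) (invQ_nonneg _)) (invQ_nonneg _)

theorem qB_neg {a b : ℤ} (h : b < 0) : qB q a b = 0 := by rw [qB, invQ_neg h]; ring
theorem qB_lt {a b : ℤ} (h : a < b) : qB q a b = 0 := by rw [qB, invQ_neg (by omega : a - b < 0)]; ring

theorem qB_base (c u : ℤ) : qB q (c + u) c * invQ q (c + u) = invQ q c * invQ q u := by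
  rw [qB, add_sub_cancel_left]
  by_cases h : 0 ≤ c + u
  · have := (invQ_pos' (q := q) h).ne'
    field_simp
  · rw [invQ_neg (by omega : c + u < 0)]
    rcases lt_or_ge c 0 with h1 | h1
    · rw [invQ_neg h1]; ring
    · rw [invQ_neg (by omega : u < 0)]; ring

theorem qB_pascal {a : ℤ} (ha : 0 ≤ a) (c : ℤ) : qB q (a + 1) c = qB q a (c - 1) + q ^ c * qB q a c := by
  have h0 := hq.out.1
  unfold qB
  have e1 := invQ_pred (q := q) (a + 1)
  have e2 := invQ_pred (q := q) c
  have e3 := invQ_pred (q := q) (a + 1 - c)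
  rw [show a + 1 - 1 = a by ring] at e1
  rw [show a + 1 - c - 1 = a - c by ring] at e3
  have p1 := (invQ_pos' (q := q) ha).ne'
  have p2 := (invQ_pos' (q := q) (by omega : 0 ≤ a + 1)).ne'
  rw [show a - (c - 1) = a + 1 - c by ring, ← e2, ← e3, ← e1]
  have p3 : 1 - q ^ (a + 1) ≠ 0 := by
    intro h; rw [h, zero_mul] at e1; exact p1 e1.symm
  have e4 : q ^ c * q ^ (a + 1 - c) = q ^ (a + 1) := by rw [← zpow_add₀ h0.ne']; congr 1; ring
  field_simp
  linear_combination (invQ q c * invQ q (a + 1 - c)) * e4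

theorem oR_add {x y : ℝ} (hx : 0 ≤ x) (hy : 0 ≤ y) : oR (x + y) = oR x + oR y := ENNReal.ofReal_add hx hy

theorem tsum_shift (f : ℤ → ENNReal) (n : ℤ) : ∑' c, f (c + n) = ∑' c, f c := (Equiv.addRight n).tsum_eq f

def Jt (q : ℝ) (p c u n : ℤ) : ℝ := q ^ ((c - n) * (p - n)) * qB q p n * invQ q (c - n) * invQ q (u + n)

theorem Jt_nonneg (p c u n : ℤ) : 0 ≤ Jt q p c u n := by
  have h0 := hq.out.1
  exact mul_nonneg (mul_nonneg (mul_nonneg (by positivity) (qB_nonneg _ _)) (invQ_nonneg _)) (invQ_nonneg _)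

theorem J (p : ℕ) (c u : ℤ) : oR (qB q (c + u + p) c * invQ q (c + u)) = ∑' n : ℤ, oR (Jt q p c u n) := by
  have h0 := hq.out.1
  induction p generalizing c u with
  | zero =>
    rw [tsum_eq_single 0]
    · have : qB q 0 0 = 1 := by simp [qB, invQ_zero]
      simp [Jt, qB_base, this]
    · intro n hn
      have : qB q 0 n = 0 := by
        rcases lt_or_gt_of_ne hn with h | h
        · exact qB_neg h
        · exact qB_lt h
      simp [Jt, this, oR]
  | succ p ih =>
    have hL : qB q (c + u + (p + 1 : ℕ)) c * invQ q (c + u) =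
        qB q (c - 1 + (u + 1) + p) (c - 1) * invQ q (c - 1 + (u + 1)) + q ^ c * (qB q (c + u + p) c * invQ q (c + u)) := by
      rw [show c - 1 + (u + 1) = c + u by ring, show c + u + ((p + 1 : ℕ) : ℤ) = c + u + p + 1 by push_cast; ring]
      by_cases h : 0 ≤ c + u
      · rw [qB_pascal (by omega)]; ring
      · rw [invQ_neg (by omega : c + u < 0)]; ring
    rw [hL, oR_add (mul_nonneg (qB_nonneg _ _) (invQ_nonneg _)) (mul_nonneg (by positivity) (mul_nonneg (qB_nonneg _ _) (invQ_nonneg _))),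
      oR_mul (x := q ^ c) (by positivity), ih, ih, ← ENNReal.tsum_mul_left, ← tsum_shift _ (-1), ← ENNReal.tsum_add]
    refine tsum_congr fun n => ?_
    rw [← oR_mul (by positivity), ← oR_add (Jt_nonneg _ _ _ _) (mul_nonneg (by positivity) (Jt_nonneg _ _ _ _))]
    congr 1
    unfold Jt
    rw [Nat.cast_add_one, qB_pascal (by omega), show c - 1 - (n + -1) = c - n by ring, show u + 1 + (n + -1) = u + n by ring,
      show (p : ℤ) - (n + -1) = p + 1 - n by ring, show n + -1 = n - 1 by ring]
    have e : q ^ c * q ^ ((c - n) * (p - n)) = q ^ ((c - n) * (p + 1 - n)) * q ^ n := by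
      rw [← zpow_add₀ h0.ne', ← zpow_add₀ h0.ne']; congr 1; ring
    linear_combination (qB q p n * invQ q (c - n) * invQ q (u + n)) * e

theorem D_E (v : ℤ) : ∑' e : ℤ, oR (q ^ (e ^ 2 + e * v) * invQ q e * invQ q (e + v)) = oR (qPInf q q)⁻¹ := by
  have h0 := hq.out.1
  have hP := qPInf_pos (q := q)
  have h := D_r (q := q) v
  have nn : ∀ e : ℤ, 0 ≤ q ^ (e ^ 2 + e * v) * invQ q e * invQ q (e + v) := fun e =>
    mul_nonneg (mul_nonneg (by positivity) (invQ_nonneg _)) (invQ_nonneg _)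
  have hs : Summable (fun e : ℕ => q ^ ((e : ℤ) ^ 2 + e * v) * invQ q e * invQ q (e + v)) := by
    by_contra hn
    rw [tsum_eq_zero_of_not_summable hn, mul_zero] at h
    exact zero_ne_one h
  rw [← eq_inv_of_mul_eq_one_right h]
  rw [oR, ENNReal.ofReal_tsum_of_nonneg (fun e : ℕ => nn (e : ℤ)) hs]
  have inj : Function.Injective (fun n : ℕ => (n : ℤ)) := Nat.cast_injective
  refine (inj.tsum_eq (f := fun e : ℤ => oR (q ^ (e ^ 2 + e * v) * invQ q e * invQ q (e + v))) ?_).symm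
  intro e he
  by_contra hc
  apply he
  have : e < 0 := by
    by_contra h2
    exact hc ⟨e.toNat, by simp; omega⟩
  simp [invQ_neg this, oR]

theorem T {u m : ℤ} (v : ℤ) (hm : u ≤ m) :
    ∑' c : ℤ, oR (q ^ (c ^ 2 + c * (u + v - m)) * qB q (c + m) c * invQ q (c + u) * invQ q (c + v)) =
    oR (qPInf q q)⁻¹ * ∑' n : ℤ, oR (q ^ (n ^ 2 + n * (u + v - m)) * qB q (m - u) n * invQ q (u + n)) := by
  have h0 := hq.out.1
  obtain ⟨p, hp⟩ : ∃ p : ℕ, (p : ℤ) = m - u := ⟨(m - u).toNat, by omega⟩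
  have e1 : ∀ c : ℤ, oR (q ^ (c ^ 2 + c * (u + v - m)) * qB q (c + m) c * invQ q (c + u) * invQ q (c + v)) =
      ∑' n : ℤ, oR (q ^ (c ^ 2 + c * (u + v - m)) * invQ q (c + v) * Jt q p c u n) := by
    intro c
    have nn : 0 ≤ q ^ (c ^ 2 + c * (u + v - m)) * invQ q (c + v) := mul_nonneg (by positivity) (invQ_nonneg _)
    simp_rw [oR_mul nn]
    rw [ENNReal.tsum_mul_left, ← J, ← oR_mul nn]
    congr 1
    rw [show c + u + (p : ℤ) = c + m by omega]; ring
  simp_rw [e1]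
  rw [ENNReal.tsum_comm, ← ENNReal.tsum_mul_left]
  refine tsum_congr fun n => ?_
  rw [← tsum_shift _ n, ← D_E (v + n), ← ENNReal.tsum_mul_right]
  refine tsum_congr fun d => ?_
  rw [← oR_mul (mul_nonneg (mul_nonneg (by positivity) (invQ_nonneg _)) (invQ_nonneg _))]
  congr 1
  unfold Jt
  rw [hp, add_sub_cancel_right, show d + n + v = d + (v + n) by ring]
  have e : q ^ ((d + n) ^ 2 + (d + n) * (u + v - m)) * q ^ (d * (m - u - n)) = q ^ (d ^ 2 + d * (v + n)) * q ^ (n ^ 2 + n * (u + v - m)) := by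
    rw [← zpow_add₀ h0.ne', ← zpow_add₀ h0.ne']; congr 1; ring
  linear_combination (invQ q (d + (v + n)) * qB q (m - u) n * invQ q d * invQ q (u + n)) * e

end
end GP
end

section
namespace GP
open Filter Topology

def H (q : ℝ) : ℕ → ℕ → ℤ → ℤ → ENNReal
  | 0, _, _, A => if A = 0 then 1 else 0
  | j + 1, l, x, A => ∑' N : ℤ, oR (qB q (x - N + 2 * A - l) (x - N)) * (oR (q ^ (N ^ 2 - eps l * N)) * H q j (l - 1) N (A - N))

def W (q : ℝ) (j l : ℕ) (A N : ℤ) : ENNReal := oR (q ^ (N ^ 2 - eps l * N)) * H q j (l - 1) N (A - N)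

def SS (q : ℝ) (j l s : ℕ) (A0 : ℤ) : ENNReal :=
  oR (qPInf q q) * ∑' A : ℤ, oR (invQ q (A - A0)) * oR (invQ q (A - (l + s - A0))) *
    ∑' N : ℤ, oR (q ^ (-(s * N) : ℤ)) * W q j l A N

section
variable {q : ℝ} [hq : Fact (0 < q ∧ q < 1)]

theorem invQ_ge {n : ℤ} (h : 0 ≤ n) : 1 ≤ invQ q n := by
  obtain ⟨h0, h1⟩ := hq.out
  obtain ⟨m, rfl⟩ := Int.eq_ofNat_of_zero_le h
  rw [invQ_nat]
  apply (one_le_inv₀ (qP_pos _)).mpr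
  unfold qP
  refine Finset.prod_le_one (fun i _ => ?_) (fun i _ => ?_)
  · have : q * q ^ i ≤ 1 := by rw [← pow_succ']; exact pow_le_one₀ h0.le h1.le
    linarith
  · have : 0 < q * q ^ i := by positivity
    linarith

theorem qB_le (a b : ℤ) : qB q a b ≤ CQ q * invQ q b := by
  have hb := invQ_nonneg (q := q) b
  have h1 : (invQ q a)⁻¹ ≤ 1 := by
    by_cases h : 0 ≤ a
    · exact inv_le_one_of_one_le₀ (invQ_ge h)
    · rw [invQ_neg (by omega)]; simp
  unfold qB
  have h2 := invQ_le (q := q) (a - b)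
  have h3 := invQ_nonneg (q := q) (a - b)
  calc _ ≤ 1 * invQ q b * CQ q := by gcongr
    _ = _ := by ring

theorem H_le (j : ℕ) : ∀ l x A, H q j l x A ≤ oR (CQ q) ^ j * R q j l x A := by
  induction j with
  | zero => intro l x A; simp [H, R]
  | succ j ih =>
    intro l x A
    rw [H, R, ← ENNReal.tsum_mul_left]
    refine ENNReal.tsum_le_tsum fun N => ?_
    calc _ ≤ oR (CQ q * invQ q (x - N)) * (oR (q ^ (N ^ 2 - eps l * N)) * (oR (CQ q) ^ j * R q j (l - 1) N (A - N))) := by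
          gcongr
          · exact oR_le (qB_le _ _)
          · exact ih _ _ _
      _ = _ := by rw [oR_mul (CQ_pos q).le]; ring

theorem R_ne_top (j l : ℕ) (x A : ℤ) : R q j l x A ≠ ⊤ := by
  obtain ⟨M, hM, hb⟩ := R_bound (q := q) one_pos j l
  have := ENNReal.ne_top_of_tsum_ne_top (ne_top_of_le_ne_top hM (hb x)) A
  simpa [oR] using this

theorem H_ne_top (j l : ℕ) (x A : ℤ) : H q j l x A ≠ ⊤ :=
  ne_top_of_le_ne_top (ENNReal.mul_ne_top (ENNReal.pow_ne_top (oR_ne_top _)) (R_ne_top j l x A)) (H_le j l x A)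

theorem W_ne_top (j l : ℕ) (A N : ℤ) : W q j l A N ≠ ⊤ := ENNReal.mul_ne_top (oR_ne_top _) (H_ne_top _ _ _ _)

theorem swap_signed {ι : Type} (a : ℕ → ℝ) (w : ι → ENNReal) (hw : ∀ i, w i ≠ ⊤) (c : ℕ → ι → ℝ) (hc : ∀ s i, 0 ≤ c s i)
    (g : ι → ℝ) (hg : ∀ i, w i ≠ 0 → ∑' s, a s * c s i = g i) (hg0 : ∀ i, 0 ≤ g i)
    (hfin : ∑' s, oR |a s| * ∑' i, oR (c s i) * w i ≠ ⊤) :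
    ∑' s, a s * (∑' i, oR (c s i) * w i).toReal = (∑' i, oR (g i) * w i).toReal ∧ ∑' i, oR (g i) * w i ≠ ⊤ := by
  have hS : Summable (fun p : ℕ × ι => a p.1 * (c p.1 p.2 * (w p.2).toReal)) := by
    have : ∑' p : ℕ × ι, oR |a p.1| * (oR (c p.1 p.2) * w p.2) ≠ ⊤ := by
      rw [ENNReal.tsum_prod']
      simp_rw [ENNReal.tsum_mul_left]
      exact hfin
    refine Summable.of_norm ((ENNReal.summable_toReal this).congr fun p => ?_)
    rw [ENNReal.toReal_mul, ENNReal.toReal_mul, oR_toReal (abs_nonneg _), oR_toReal (hc _ _), norm_mul, Real.norm_eq_abs,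
      Real.norm_of_nonneg (mul_nonneg (hc _ _) ENNReal.toReal_nonneg)]
  have e1 : ∀ s, a s * (∑' i, oR (c s i) * w i).toReal = ∑' i, a s * (c s i * (w i).toReal) := by
    intro s
    rw [ENNReal.tsum_toReal_eq (fun i => ENNReal.mul_ne_top (oR_ne_top _) (hw i)), ← tsum_mul_left]
    refine tsum_congr fun i => ?_
    rw [ENNReal.toReal_mul, oR_toReal (hc _ _)]
  have e2 : ∀ i, ∑' s, a s * (c s i * (w i).toReal) = g i * (w i).toReal := by
    intro i
    by_cases h : w i = 0
    · simp [h]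
    · rw [← hg i h, ← tsum_mul_right]
      exact tsum_congr fun s => by ring
  have e3 : ∀ i, g i * (w i).toReal = (oR (g i) * w i).toReal := fun i => by rw [ENNReal.toReal_mul, oR_toReal (hg0 i)]
  have hS2 : Summable (fun i => g i * (w i).toReal) := by
    have := hS.prod_symm.prod
    refine this.congr fun i => ?_
    rw [← e2]; rfl
  constructor
  · simp_rw [e1]
    rw [ENNReal.tsum_toReal_eq (fun i => ENNReal.mul_ne_top (oR_ne_top _) (hw i))]
    simp_rw [← e3, ← e2]
    exact Summable.tsum_comm (f := fun i s => a s * (c s i * (w i).toReal)) hS.prod_symm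
  · have := oR_tsum (fun i => mul_nonneg (hg0 i) ENNReal.toReal_nonneg) hS2
    convert this using 3 with i
    rw [oR_mul (hg0 i), oR, oR, ENNReal.ofReal_toReal (hw i)]

def aS (q : ℝ) (x : ℤ) (s : ℕ) : ℝ := (-1) ^ s * (q ^ ((s + 1).choose 2) * invQ q s * (q ^ x) ^ s)

theorem aS_tsum (x N : ℤ) : ∑' s : ℕ, aS q x s * q ^ (-(s * N) : ℤ) = qPInf q q * invQ q (x - N) := by
  have h0 := hq.out.1
  have h := E_q_zpow (q := q) (x - N)
  rw [← qPInf_eq] at h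
  have h2 : ((∑' s : ℕ, aS q x s * q ^ (-(s * N) : ℤ) : ℝ) : ℂ) = E q ((q : ℂ) ^ (x - N + 1)) := by
    rw [Complex.ofReal_tsum, E]
    refine tsum_congr fun s => ?_
    rw [aS, choose_succ2, neg_pow ((q : ℂ) ^ (x - N + 1))]
    push_cast
    have e : ((q : ℂ) ^ (x - N + 1)) ^ s = (q : ℂ) ^ s * (q ^ x) ^ s * (q : ℂ) ^ (-(s * N) : ℤ) := by
      rw [← zpow_natCast, ← zpow_mul, ← zpow_natCast, ← zpow_natCast (_ ^ x), ← zpow_mul, ← zpow_add₀ q_ne, ← zpow_add₀ q_ne]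
      congr 1; ring
    rw [e, pow_add]; ring
  rw [h] at h2
  exact_mod_cast h2

theorem qB_fin_aux (n : ℕ) : ∀ y : ℤ, 0 ≤ y + n →
    ∑ s ∈ Finset.range (n + 1), aS q y s * invQ q (n - s) = qB q (y + n) y := by
  have h0 := hq.out.1
  induction n with
  | zero =>
    intro y hy
    have := (invQ_pos' (q := q) (by simpa using hy)).ne'
    simp [aS, qB, invQ_zero, this]
  | succ n ih =>
    intro y hy
    have hy' : 0 ≤ y + 1 + n := by push_cast at hy; omega
    have hi := ih (y + 1) hy'
    have hn : (1 - q ^ (n + 1)) ≠ 0 := by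
      have : q ^ (n + 1) < 1 := pow_lt_one₀ h0.le hq.out.2 (Nat.succ_ne_zero n)
      linarith
    have key : (1 - q ^ (n + 1)) * ∑ s ∈ Finset.range (n + 1 + 1), aS q y s * invQ q ((n + 1 : ℕ) - s) =
        (1 - q ^ (y + 1)) * ∑ s ∈ Finset.range (n + 1), aS q (y + 1) s * invQ q (n - s) := by
      have e1 : (1 - q ^ (n + 1)) * ∑ s ∈ Finset.range (n + 1 + 1), aS q y s * invQ q ((n + 1 : ℕ) - s) =
          ∑ s ∈ Finset.range (n + 1 + 1), (1 - q ^ s) * (aS q y s * invQ q ((n + 1 : ℕ) - s)) +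
          ∑ s ∈ Finset.range (n + 1 + 1), q ^ s * aS q y s * ((1 - q ^ (((n + 1 : ℕ) : ℤ) - s)) * invQ q ((n + 1 : ℕ) - s)) := by
        rw [← Finset.sum_add_distrib, Finset.mul_sum]
        refine Finset.sum_congr rfl fun s _ => ?_
        have : q ^ (n + 1) = q ^ s * q ^ (((n + 1 : ℕ) : ℤ) - s) := by
          rw [← zpow_natCast, ← zpow_natCast, ← zpow_add₀ h0.ne']; congr 1; ring
        rw [this]; ring
      rw [e1, Finset.sum_range_succ' _ (n + 1), Finset.sum_range_succ _ (n + 1)]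
      simp only [pow_zero, sub_self, zero_mul, add_zero, zpow_zero, mul_zero]
      rw [← Finset.sum_add_distrib, Finset.mul_sum]
      refine Finset.sum_congr rfl fun s _ => ?_
      rw [invQ_pred, show ((n + 1 : ℕ) : ℤ) - s - 1 = n - s by push_cast; ring,
        show ((n + 1 : ℕ) : ℤ) - (s + 1 : ℕ) = n - s by push_cast; ring]
      have p := invQ_pred (q := q) ((s + 1 : ℕ) : ℤ)
      rw [show ((s + 1 : ℕ) : ℤ) - 1 = s by push_cast; ring, zpow_natCast] at p
      have e2 : aS q (y + 1) s = q ^ s * aS q y s := by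
        simp only [aS]; rw [zpow_add₀ h0.ne', mul_pow, zpow_one]; ring
      have e3 : (1 - q ^ (s + 1)) * aS q y (s + 1) = - q ^ (y + 1) * (q ^ s * aS q y s) := by
        simp only [aS]
        rw [← p, choose_succ2 (s + 1), zpow_add₀ h0.ne', zpow_one]
        generalize q ^ y = z
        ring
      rw [e2]
      linear_combination (invQ q (n - s)) * e3
    apply mul_left_cancel₀ hn
    rw [key, hi, qB, qB]
    have p := invQ_pred (q := q) ((n + 1 : ℕ) : ℤ)
    have p2 := invQ_pred (q := q) (y + 1)
    rw [show ((n + 1 : ℕ) : ℤ) - 1 = n by push_cast; ring, zpow_natCast] at p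
    rw [add_sub_cancel_right] at p2
    rw [show y + 1 + (n : ℤ) - (y + 1) = n by ring, show y + ((n + 1 : ℕ) : ℤ) - y = (n + 1 : ℕ) by ring,
      show y + ((n + 1 : ℕ) : ℤ) = y + 1 + n by push_cast; ring, ← p, ← p2]
    ring

theorem qB_finite {y B : ℤ} (h : 0 ≤ y + B) :
    ∑' s : ℕ, aS q y s * invQ q (B - s) = qB q (y + B) y := by
  rcases lt_or_ge B 0 with hB | hB
  · have : ∀ s : ℕ, aS q y s * invQ q (B - s) = 0 := fun s => by rw [invQ_neg (by omega), mul_zero]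
    simp only [this, tsum_zero]
    rw [qB, show y + B - y = B by ring, invQ_neg hB, mul_zero]
  · obtain ⟨n, rfl⟩ := Int.eq_ofNat_of_zero_le hB
    rw [← qB_fin_aux n y h]
    refine tsum_eq_sum fun s hs => ?_
    rw [invQ_neg (by simp at hs; omega), mul_zero]

def Good (q : ℝ) (j l : ℕ) (c : ℤ) : Prop := ∀ A N, W q j l A N ≠ 0 → (l : ℤ) ≤ c + (A - N)

theorem SS_eq (j l s : ℕ) (A0 : ℤ) : SS q j l s A0 = oR (qPInf q q) *
    ∑' i : ℤ × ℤ, oR (q ^ (-(s * i.2) : ℤ) * invQ q (i.1 - l + A0 - s)) * (oR (invQ q (i.1 - A0)) * W q j l i.1 i.2) := by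
  have h0 := hq.out.1
  rw [SS, ENNReal.tsum_prod']
  congr 1
  refine tsum_congr fun A => ?_
  rw [← ENNReal.tsum_mul_left]
  refine tsum_congr fun N => ?_
  rw [oR_mul (by positivity), show A - (l + s - A0) = A - l + A0 - s by ring]
  ring

theorem step_a (j l : ℕ) (x A0 : ℤ) (hG : Good q j l (x + A0)) (hSF : ∀ s, SS q j l s A0 = FF q j l s A0) :
    ∑' A, oR (invQ q (A - A0)) * ∑' N, oR (qB q (x - N + (A - l + A0)) (x - N)) * W q j l A N = R q (j + 1) l x A0 := by
  have h0 := hq.out.1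
  have hP := qPInf_pos (q := q)
  have ab : ∀ s, oR |aS q x s| = oR (q ^ ((s + 1).choose 2) * invQ q s * (q ^ x) ^ s) := by
    intro s
    rw [aS, abs_mul, abs_pow, abs_neg, abs_one, one_pow, one_mul, abs_of_nonneg]
    exact mul_nonneg (mul_nonneg (by positivity) (invQ_nonneg _)) (by positivity)
  have hfinF : ∑' s, oR |aS q x s| * FF q j l s A0 ≠ ⊤ := by
    refine ne_top_of_le_ne_top (PS_fin (q := q) (t := 1) (u := q ^ x) one_pos (by positivity) j l) ?_
    refine ENNReal.tsum_le_tsum fun s => ?_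
    rw [ab]
    gcongr
    refine le_trans ?_ (ENNReal.le_tsum A0)
    simp [oR]
  have eF : ∀ s, FF q j l s A0 = ∑' N : ℤ, oR (q ^ (-(s * N) : ℤ)) * (oR (q ^ (N ^ 2 - eps l * N)) * R q j (l - 1) N (A0 - N)) := by
    intro s
    rw [FF]
    refine tsum_congr fun N => ?_
    rw [← mul_assoc, ← oR_mul (by positivity), ← zpow_add₀ h0.ne']
    congr 3; ring
  have eS : ∀ s : ℕ, SS q j l s A0 = ∑' i : ℤ × ℤ, oR (qPInf q q * (q ^ (-(s * i.2) : ℤ) * invQ q (i.1 - l + A0 - s))) *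
      (oR (invQ q (i.1 - A0)) * W q j l i.1 i.2) := by
    intro s
    rw [SS_eq, ← ENNReal.tsum_mul_left]
    refine tsum_congr fun i => ?_
    rw [oR_mul hP.le, mul_assoc]
  have F := swap_signed (aS q x) (fun N => oR (q ^ (N ^ 2 - eps l * N)) * R q j (l - 1) N (A0 - N))
    (fun N => ENNReal.mul_ne_top (oR_ne_top _) (R_ne_top _ _ _ _)) (fun s N => q ^ (-(s * N) : ℤ)) (fun s N => by positivity)
    (fun N => qPInf q q * invQ q (x - N)) (fun N _ => aS_tsum x N) (fun N => mul_nonneg hP.le (invQ_nonneg _))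
    (by simp_rw [← eF]; exact hfinF)
  have S := swap_signed (aS q x) (fun i : ℤ × ℤ => oR (invQ q (i.1 - A0)) * W q j l i.1 i.2)
    (fun N => ENNReal.mul_ne_top (oR_ne_top _) (W_ne_top _ _ _ _))
    (fun s i => qPInf q q * (q ^ (-(s * i.2) : ℤ) * invQ q (i.1 - l + A0 - s)))
    (fun s i => mul_nonneg hP.le (mul_nonneg (by positivity) (invQ_nonneg _)))
    (fun i => qPInf q q * qB q (x - i.2 + (i.1 - l + A0)) (x - i.2))
    (fun i hi => by
      have hW : W q j l i.1 i.2 ≠ 0 := right_ne_zero_of_mul hi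
      have := hG _ _ hW
      rw [← qB_finite (by omega), ← tsum_mul_left]
      refine tsum_congr fun s => ?_
      have : aS q (x - i.2) s = aS q x s * q ^ (-(s * i.2) : ℤ) := by
        simp only [aS]
        have : (q ^ (x - i.2)) ^ s = (q ^ x) ^ s * q ^ (-(s * i.2) : ℤ) := by
          rw [← zpow_natCast, ← zpow_natCast, ← zpow_mul, ← zpow_mul, ← zpow_add₀ h0.ne']; congr 1; ring
        rw [this]; ring
      rw [this]; ring)
    (fun i => mul_nonneg hP.le (qB_nonneg _ _))
    (by
      refine ne_of_eq_of_ne (tsum_congr fun s => ?_) hfinF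
      rw [← hSF, eS])
  have e : (∑' i : ℤ × ℤ, oR (qPInf q q * qB q (x - i.2 + (i.1 - l + A0)) (x - i.2)) * (oR (invQ q (i.1 - A0)) * W q j l i.1 i.2)) =
      ∑' N : ℤ, oR (qPInf q q * invQ q (x - N)) * (oR (q ^ (N ^ 2 - eps l * N)) * R q j (l - 1) N (A0 - N)) := by
    rw [← ENNReal.toReal_eq_toReal_iff' S.2 F.2, ← S.1, ← F.1]
    refine tsum_congr fun s => ?_
    rw [← eF, ← hSF, eS]
  simp_rw [oR_mul hP.le, mul_assoc] at e
  rw [ENNReal.tsum_mul_left, ENNReal.tsum_mul_left] at e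
  have hc : oR (qPInf q q) ≠ 0 := by simp [oR, hP]
  have e' := (ENNReal.mul_right_inj hc (oR_ne_top _)).mp e
  rw [ENNReal.tsum_prod'] at e'
  rw [R, ← e']
  refine tsum_congr fun A => ?_
  rw [← ENNReal.tsum_mul_left]
  refine tsum_congr fun N => ?_
  ring

end
end GP
end

section
namespace GP
open Filter Topology

section
variable {q : ℝ} [hq : Fact (0 < q ∧ q < 1)]

theorem SS_base (l s : ℕ) (hl : l ≤ 1) (A0 : ℤ) : SS q 0 l s A0 = FF q 0 l s A0 := by
  have h0 := hq.out.1
  have hP := qPInf_pos (q := q)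
  have hel : eps l = l := by interval_cases l <;> rfl
  have e2 : FF q 0 l s A0 = oR (q ^ (A0 ^ 2 - (l + s) * A0)) := by
    rw [FF, tsum_eq_single A0]
    · simp [R, hel]
    · intro N hN; simp [R, sub_eq_zero, hN.symm]
  have e1 : ∀ A : ℤ, ∑' N : ℤ, oR (q ^ (-(s * N) : ℤ)) * W q 0 l A N = oR (q ^ (A ^ 2 - (l + s) * A)) := by
    intro A
    rw [tsum_eq_single A]
    · simp only [W, H, hel, sub_self, if_true, mul_one]
      rw [← oR_mul (by positivity), ← zpow_add₀ h0.ne']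
      congr 2; ring
    · intro N hN; simp [W, H, sub_eq_zero, hN.symm]
  rw [SS, e2]
  simp_rw [e1]
  rw [← tsum_shift _ A0]
  have e3 : ∀ c : ℤ, oR (invQ q (c + A0 - A0)) * oR (invQ q (c + A0 - (l + s - A0))) * oR (q ^ ((c + A0) ^ 2 - (l + s) * (c + A0))) =
      oR (q ^ (A0 ^ 2 - (l + s) * A0)) * oR (q ^ (c ^ 2 + c * (2 * A0 - l - s)) * invQ q c * invQ q (c + (2 * A0 - l - s))) := by
    intro c
    have i1 := invQ_nonneg (q := q) (c + A0 - A0)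
    have i2 := invQ_nonneg (q := q) (c + A0 - (l + s - A0))
    rw [← oR_mul i1, ← oR_mul (mul_nonneg i1 i2), ← oR_mul (by positivity)]
    congr 1
    rw [show (c + A0) ^ 2 - (l + s) * (c + A0) = (A0 ^ 2 - (l + s) * A0) + (c ^ 2 + c * (2 * A0 - l - s)) by ring,
      zpow_add₀ h0.ne', show c + A0 - A0 = c by ring, show c + A0 - (l + s - A0) = c + (2 * A0 - l - s) by ring]
    ring
  simp_rw [e3]
  rw [ENNReal.tsum_mul_left, D_E, mul_left_comm, ← oR_mul hP.le, mul_inv_cancel₀ hP.ne']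
  simp [oR]

theorem H_supp (j l : ℕ) (x A : ℤ) (h : H q (j + 1) l x A ≠ 0) : (l : ℤ) ≤ 2 * A := by
  by_contra hc
  apply h
  rw [H, ENNReal.tsum_eq_zero]
  intro N
  rw [qB_lt (by omega)]; simp [oR]

theorem good (j l : ℕ) (hl : l ≤ j + 2) (A0 : ℤ) (h : (l : ℤ) ≤ 2 * A0) : Good q j (l - 1) A0 := by
  intro A N hW
  have hH : H q j (l - 1 - 1) N (A - N) ≠ 0 := right_ne_zero_of_mul hW
  rcases j with _ | j
  · have : A - N = 0 := by
      by_contra hc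
      exact hH (by simp [H, hc])
    omega
  · have := H_supp _ _ _ _ hH
    omega

theorem eps_sub (l : ℕ) : eps l = (l : ℤ) - (l - 1 : ℕ) := by
  unfold eps
  split_ifs <;> omega

theorem step_b (j l s : ℕ) (hl : l ≤ j + 2) (A0 : ℤ) (h : (l : ℤ) ≤ 2 * A0)
    (ih : ∀ s A, SS q j (l - 1) s A = FF q j (l - 1) s A) : SS q (j + 1) l s A0 = FF q (j + 1) l s A0 := by
  have h0 := hq.out.1
  have hP := qPInf_pos (q := q)
  have hG := good (q := q) j l hl A0 h
  have he := eps_sub l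
  -- reorder
  have e1 : ∑' A : ℤ, oR (invQ q (A - A0)) * oR (invQ q (A - (l + s - A0))) *
      ∑' N : ℤ, oR (q ^ (-(s * N) : ℤ)) * W q (j + 1) l A N =
      ∑' A' : ℤ, ∑' N2 : ℤ, W q j (l - 1) A' N2 * ∑' N1 : ℤ, oR (q ^ (N1 ^ 2 - (eps l + s) * N1) *
        qB q (N1 - N2 + 2 * A' - (l - 1 : ℕ)) (N1 - N2) * invQ q (A' + N1 - A0) * invQ q (A' + N1 - (l + s - A0))) := by
    simp_rw [← ENNReal.tsum_mul_left]
    rw [ENNReal.tsum_comm]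
    have : ∀ N : ℤ, ∑' A : ℤ, oR (invQ q (A - A0)) * oR (invQ q (A - (l + s - A0))) * (oR (q ^ (-(s * N) : ℤ)) * W q (j + 1) l A N) =
        ∑' A' : ℤ, oR (invQ q (A' + N - A0)) * oR (invQ q (A' + N - (l + s - A0))) * (oR (q ^ (-(s * N) : ℤ)) * W q (j + 1) l (A' + N) N) :=
      fun N => (tsum_shift (fun A => oR (invQ q (A - A0)) * oR (invQ q (A - (l + s - A0))) * (oR (q ^ (-(s * N) : ℤ)) * W q (j + 1) l A N)) N).symm
    simp_rw [this]
    rw [ENNReal.tsum_comm]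
    refine tsum_congr fun A' => ?_
    rw [ENNReal.tsum_comm (f := fun N2 N1 => W q j (l - 1) A' N2 * oR (q ^ (N1 ^ 2 - (eps l + s) * N1) *
        qB q (N1 - N2 + 2 * A' - (l - 1 : ℕ)) (N1 - N2) * invQ q (A' + N1 - A0) * invQ q (A' + N1 - (l + s - A0))))]
    refine tsum_congr fun N1 => ?_
    rw [W, add_sub_cancel_right, H, ← ENNReal.tsum_mul_left, ← ENNReal.tsum_mul_left, ← ENNReal.tsum_mul_left]
    refine tsum_congr fun N2 => ?_
    rw [show N1 ^ 2 - (eps l + s) * N1 = (N1 ^ 2 - eps l * N1) + -(s * N1) by ring, zpow_add₀ h0.ne',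
      oR_mul (mul_nonneg (mul_nonneg (by positivity) (qB_nonneg _ _)) (invQ_nonneg _)),
      oR_mul (mul_nonneg (by positivity) (qB_nonneg _ _)), oR_mul (by positivity), oR_mul (by positivity), W]
    ring
  have e2 : ∀ A' N2 : ℤ, W q j (l - 1) A' N2 * ∑' N1 : ℤ, oR (q ^ (N1 ^ 2 - (eps l + s) * N1) *
        qB q (N1 - N2 + 2 * A' - (l - 1 : ℕ)) (N1 - N2) * invQ q (A' + N1 - A0) * invQ q (A' + N1 - (l + s - A0))) =
      oR (qPInf q q)⁻¹ * ∑' x : ℤ, oR (q ^ (x ^ 2 - (eps l + s) * x)) * (oR (invQ q (A' - (A0 - x))) *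
        (oR (qB q (x - N2 + (A' - (l - 1 : ℕ) + (A0 - x))) (x - N2)) * W q j (l - 1) A' N2)) := by
    intro A' N2
    by_cases hW : W q j (l - 1) A' N2 = 0
    · simp [hW]
    have hg := hG _ _ hW
    have t := T (q := q) (u := N2 + A' - A0) (m := 2 * A' - (l - 1 : ℕ)) (N2 + A' - (l + s - A0)) (by omega)
    rw [show N2 + A' - A0 + (N2 + A' - (l + s - A0)) - (2 * A' - ((l - 1 : ℕ) : ℤ)) = 2 * N2 - (eps l + s) by rw [he]; ring] at t
    have ex : ∀ c : ℤ, q ^ ((c + N2) ^ 2 - (eps l + s) * (c + N2)) = q ^ (N2 ^ 2 - (eps l + s) * N2) * q ^ (c ^ 2 + c * (2 * N2 - (eps l + s))) := by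
      intro c
      rw [← zpow_add₀ h0.ne']; congr 1; ring
    rw [← tsum_shift _ N2]
    rw [← tsum_shift (fun x : ℤ => oR (q ^ (x ^ 2 - (eps l + s) * x)) * (oR (invQ q (A' - (A0 - x))) *
        (oR (qB q (x - N2 + (A' - (l - 1 : ℕ) + (A0 - x))) (x - N2)) * W q j (l - 1) A' N2))) N2]
    have l1 : ∀ c : ℤ, oR (q ^ ((c + N2) ^ 2 - (eps l + s) * (c + N2)) *
        qB q (c + N2 - N2 + 2 * A' - (l - 1 : ℕ)) (c + N2 - N2) * invQ q (A' + (c + N2) - A0) * invQ q (A' + (c + N2) - (l + s - A0))) =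
        oR (q ^ (N2 ^ 2 - (eps l + s) * N2)) * oR (q ^ (c ^ 2 + c * (2 * N2 - (eps l + s))) * qB q (c + (2 * A' - (l - 1 : ℕ))) c *
          invQ q (c + (N2 + A' - A0)) * invQ q (c + (N2 + A' - (l + s - A0)))) := by
      intro c
      rw [ex, ← oR_mul (by positivity), show c + N2 - N2 = c by ring, show c + 2 * A' - ((l - 1 : ℕ) : ℤ) = c + (2 * A' - (l - 1 : ℕ)) by ring,
        show A' + (c + N2) - A0 = c + (N2 + A' - A0) by ring, show A' + (c + N2) - (l + s - A0) = c + (N2 + A' - (l + s - A0)) by ring]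
      congr 1; ring
    have l2 : ∀ n : ℤ, oR (q ^ ((n + N2) ^ 2 - (eps l + s) * (n + N2))) * (oR (invQ q (A' - (A0 - (n + N2)))) *
        (oR (qB q (n + N2 - N2 + (A' - (l - 1 : ℕ) + (A0 - (n + N2)))) (n + N2 - N2)) * W q j (l - 1) A' N2)) =
        W q j (l - 1) A' N2 * (oR (q ^ (N2 ^ 2 - (eps l + s) * N2)) * oR (q ^ (n ^ 2 + n * (2 * N2 - (eps l + s))) *
          qB q (2 * A' - (l - 1 : ℕ) - (N2 + A' - A0)) n * invQ q (N2 + A' - A0 + n))) := by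
      intro n
      rw [ex, oR_mul (by positivity), oR_mul (mul_nonneg (by positivity) (qB_nonneg _ _)), oR_mul (by positivity),
        show n + N2 - N2 = n by ring, show A' - (A0 - (n + N2)) = N2 + A' - A0 + n by ring,
        show n + (A' - ((l - 1 : ℕ) : ℤ) + (A0 - (n + N2))) = 2 * A' - (l - 1 : ℕ) - (N2 + A' - A0) by ring]
      ring
    simp_rw [l1, l2]
    rw [ENNReal.tsum_mul_left, t, ENNReal.tsum_mul_left, ENNReal.tsum_mul_left]
    ring
  rw [SS, e1]
  simp_rw [e2]
  simp_rw [ENNReal.tsum_mul_left]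
  rw [← mul_assoc, ← oR_mul hP.le, mul_inv_cancel₀ hP.ne', show oR 1 = 1 by simp [oR], one_mul, FF]
  have e3 : ∀ x : ℤ, R q (j + 1) (l - 1) x (A0 - x) = _ := fun x =>
    (step_a (q := q) j (l - 1) x (A0 - x) (by rw [add_sub_cancel]; exact hG) (fun s => ih s _)).symm
  simp_rw [e3, ← ENNReal.tsum_mul_left]
  exact (tsum_congr fun A' => ENNReal.tsum_comm).trans ENNReal.tsum_comm

theorem SS_symm (j l s : ℕ) (A0 : ℤ) : SS q j l s A0 = SS q j l s (l + s - A0) := by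
  rw [SS, SS]
  congr 1
  refine tsum_congr fun A => ?_
  rw [show (l : ℤ) + s - (l + s - A0) = A0 by ring, mul_comm (oR (invQ q (A - A0)))]

theorem SS_FF (j : ℕ) : ∀ l s A0, l ≤ j + 1 → SS q j l s A0 = FF q j l s A0 := by
  induction j with
  | zero => exact fun l s A0 hl => SS_base l s hl A0
  | succ j ih =>
    intro l s A0 hl
    rcases le_or_gt ((l : ℤ) + s) (2 * A0) with h | h
    · exact step_b j l s hl A0 (by omega) (fun s A => ih _ _ _ (by omega))
    · rw [SS_symm, FF_refl _ _ _ hl]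
      exact step_b j l s hl _ (by omega) (fun s A => ih _ _ _ (by omega))

end
end GP
end

section
namespace GP
open Filter Topology

def sm {j : ℕ} (n : Fin j → ℕ) : ℤ := ∑ i, (n i : ℤ)
def Dp {j : ℕ} (n : Fin j → ℕ) : ℤ := ∑ i : Fin j, (i : ℤ) * (n i : ℤ)
def Mp {j : ℕ} (n : Fin j → ℕ) : ℤ := ∑ i : Fin j, ∑ i' : Fin j, (n i : ℤ) * n i' * min (i : ℤ) (i' : ℤ)
def Lp {j : ℕ} (l : ℕ) (n : Fin j → ℕ) : ℤ := ∑ i : Fin j, (n i : ℤ) * min (i : ℤ) (l : ℤ)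
def exI {j : ℕ} (l : ℕ) (Z : ℤ) (n : Fin j → ℕ) : ℤ := j * Z ^ 2 + 2 * Z * Dp n + Mp n - l * Z - Lp l n
def mu {j : ℕ} (l : ℕ) (A Z : ℤ) (n : Fin j → ℕ) (i : Fin j) : ℤ :=
  2 * A - 2 * i * Z - 2 * (∑ i' : Fin j, min (i : ℤ) (i' : ℤ) * n i') - ((l - i : ℕ) : ℤ)

theorem sm_cons {j : ℕ} (c : ℕ) (n : Fin j → ℕ) : sm (Fin.cons c n : Fin (j + 1) → ℕ) = c + sm n := by
  simp [sm, Fin.sum_univ_succ]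

theorem Dp_cons {j : ℕ} (c : ℕ) (n : Fin j → ℕ) : Dp (Fin.cons c n : Fin (j + 1) → ℕ) = sm n + Dp n := by
  simp only [Dp, sm, Fin.sum_univ_succ, Fin.cons_succ, ← Finset.sum_add_distrib]
  simp only [Fin.val_zero, Nat.cast_zero, zero_mul, zero_add]
  refine Finset.sum_congr rfl fun i _ => ?_
  push_cast [Fin.val_succ]; ring

theorem Mp_cons {j : ℕ} (c : ℕ) (n : Fin j → ℕ) : Mp (Fin.cons c n : Fin (j + 1) → ℕ) = sm n ^ 2 + Mp n := by
  simp only [Mp, sm, Fin.sum_univ_succ, Fin.cons_succ, sq, Finset.sum_mul_sum, ← Finset.sum_add_distrib]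
  have e : ∀ i : Fin j, min ((0 : ℕ) : ℤ) ((i.succ : ℕ) : ℤ) = 0 := fun i => by omega
  have e' : ∀ i : Fin j, min ((i.succ : ℕ) : ℤ) ((0 : ℕ) : ℤ) = 0 := fun i => by omega
  simp only [Fin.val_zero, e, e', min_self]
  simp only [Nat.cast_zero, mul_zero, Finset.sum_const_zero, zero_add]
  refine Finset.sum_congr rfl fun i _ => Finset.sum_congr rfl fun i' _ => ?_
  rw [show min ((i.succ : ℕ) : ℤ) ((i'.succ : ℕ) : ℤ) = 1 + min (i : ℤ) i' by simp only [Fin.val_succ]; omega]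
  ring

theorem Lp_zero {j : ℕ} (n : Fin j → ℕ) : Lp 0 n = 0 := by simp [Lp]

theorem Lp_cons {j : ℕ} (l c : ℕ) (n : Fin j → ℕ) : Lp (l + 1) (Fin.cons c n : Fin (j + 1) → ℕ) = sm n + Lp l n := by
  simp only [Lp, sm, Fin.sum_univ_succ, Fin.cons_succ, ← Finset.sum_add_distrib]
  have e : min ((0 : ℕ) : ℤ) ((l + 1 : ℕ) : ℤ) = 0 := by omega
  simp only [Fin.val_zero, e, mul_zero, zero_add]
  refine Finset.sum_congr rfl fun i _ => ?_
  rw [show min ((i.succ : ℕ) : ℤ) ((l + 1 : ℕ) : ℤ) = 1 + min (i : ℤ) l by simp only [Fin.val_succ]; omega]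
  ring

theorem exI_cons {j : ℕ} (l c : ℕ) (Z : ℤ) (n : Fin j → ℕ) :
    exI l Z (Fin.cons c n : Fin (j + 1) → ℕ) = ((Z + sm n) ^ 2 - eps l * (Z + sm n)) + exI (l - 1) Z n := by
  rcases l with _ | l
  · simp only [exI, Dp_cons, Mp_cons, Lp_zero, eps, Nat.zero_sub, if_true]; push_cast; ring
  · simp only [exI, Dp_cons, Mp_cons, Lp_cons, eps, Nat.add_sub_cancel]
    rw [if_neg (by omega)]; push_cast; ring

theorem mu_zero {j : ℕ} (l c : ℕ) (A Z : ℤ) (n : Fin j → ℕ) : mu l A Z (Fin.cons c n : Fin (j + 1) → ℕ) 0 = 2 * A - l := by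
  have e : ∀ i : Fin (j + 1), min ((0 : ℕ) : ℤ) (i : ℤ) = 0 := fun i => by omega
  simp only [mu, Fin.val_zero, e, zero_mul, Finset.sum_const_zero, Nat.sub_zero]
  simp

theorem mu_succ {j : ℕ} (l c : ℕ) (A Z : ℤ) (n : Fin j → ℕ) (i : Fin j) :
    mu l A Z (Fin.cons c n : Fin (j + 1) → ℕ) i.succ = mu (l - 1) (A - (Z + sm n)) Z n i := by
  simp only [mu, Fin.sum_univ_succ, Fin.cons_succ]
  have e' : min ((i.succ : ℕ) : ℤ) ((0 : ℕ) : ℤ) = 0 := by omega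
  have e : ∑ x : Fin j, min ((i.succ : ℕ) : ℤ) ((x.succ : ℕ) : ℤ) * (n x : ℤ) = sm n + ∑ x : Fin j, min (i : ℤ) (x : ℤ) * (n x : ℤ) := by
    rw [sm, ← Finset.sum_add_distrib]
    refine Finset.sum_congr rfl fun i' _ => ?_
    rw [show min ((i.succ : ℕ) : ℤ) ((i'.succ : ℕ) : ℤ) = 1 + min (i : ℤ) i' by simp only [Fin.val_succ]; omega]
    ring
  rw [e, Fin.val_zero, e', show l - ((i.succ : ℕ)) = l - 1 - i by simp only [Fin.val_succ]; omega]
  push_cast [Fin.val_succ]; ring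

section
variable {q : ℝ} [hq : Fact (0 < q ∧ q < 1)]

theorem tsum_int_natE (f : ℤ → ENNReal) (h : ∀ n < 0, f n = 0) : ∑' n : ℤ, f n = ∑' n : ℕ, f n := by
  have inj : Function.Injective (fun n : ℕ => (n : ℤ)) := Nat.cast_injective
  refine (inj.tsum_eq (f := f) ?_).symm
  intro e he
  by_contra hc
  apply he
  apply h
  by_contra h2
  exact hc ⟨e.toNat, by simp; omega⟩

theorem unroll (φ : ℤ → ℤ → ℝ) (hφ : ∀ m n, 0 ≤ φ m n) (hφ' : ∀ m n, n < 0 → φ m n = 0) (T : ℕ → ℕ → ℤ → ℤ → ENNReal)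
    (hT0 : ∀ l x A, T 0 l x A = if A = 0 then 1 else 0)
    (hT : ∀ j l x A, T (j + 1) l x A = ∑' N : ℤ, oR (φ (2 * A - l) (x - N)) * (oR (q ^ (N ^ 2 - eps l * N)) * T j (l - 1) N (A - N)))
    (j : ℕ) : ∀ (l : ℕ) (x A : ℤ), l ≤ j → T j l x A = ∑' n : Fin j → ℕ, if j * (x - sm n) + Dp n = A then
      oR (q ^ exI l (x - sm n) n * ∏ i, φ (mu l A (x - sm n) n i) (n i)) else 0 := by
  have h0 := hq.out.1
  induction j with
  | zero =>
    intro l x A hl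
    rw [hT0, tsum_eq_single (fun i : Fin 0 => i.elim0)]
    · obtain rfl : l = 0 := by omega
      simp [exI, Dp, Mp, Lp, oR, eq_comm]
    · intro b hb; exact absurd (Subsingleton.elim _ _) hb
  | succ j ih =>
    intro l x A hl
    rw [hT]
    have e1 := (Equiv.subLeft x).tsum_eq (fun N : ℤ => oR (φ (2 * A - l) (x - N)) * (oR (q ^ (N ^ 2 - eps l * N)) * T j (l - 1) N (A - N)))
    rw [← e1]
    rw [tsum_int_natE _ (fun n hn => by simp [Equiv.subLeft, hφ' _ _ hn, oR])]
    rw [← (Fin.consEquiv (fun _ => ℕ)).tsum_eq, ENNReal.tsum_prod']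
    refine tsum_congr fun c => ?_
    simp only [Equiv.subLeft_apply]
    rw [ih (l - 1) _ _ (by omega), ← ENNReal.tsum_mul_left, ← ENNReal.tsum_mul_left]
    refine tsum_congr fun n => ?_
    rw [show (Fin.consEquiv fun _ : Fin (j + 1) => ℕ) (c, n) = (Fin.cons c n : Fin (j + 1) → ℕ) from rfl]
    have hc : ((j + 1 : ℕ) : ℤ) * (x - sm (Fin.cons c n : Fin (j + 1) → ℕ)) + Dp (Fin.cons c n : Fin (j + 1) → ℕ) = A ↔
        (j : ℤ) * (x - c - sm n) + Dp n = A - (x - c) := by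
      rw [sm_cons, Dp_cons]; push_cast
      constructor <;> intro h <;> linarith
    simp only [hc]
    split_ifs with h
    · rw [Fin.prod_univ_succ, mu_zero, exI_cons, sm_cons]
      simp only [mu_succ, Fin.cons_zero, Fin.cons_succ]
      have z : x - (c + sm n) = x - c - sm n := by ring
      rw [z, show x - c - sm n + sm n = x - c by ring, zpow_add₀ h0.ne', ← oR_mul (by positivity), ← oR_mul (hφ _ _),
        show x - (x - (c : ℤ)) = c by ring]
      congr 1; ring
    · simp

/-- closed form exponent -/
def EX {j : ℕ} (l s : ℕ) (Z : ℤ) (n : Fin j → ℕ) : ℤ :=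
  (Z + sm n) ^ 2 - (eps l + s) * (Z + sm n) + exI (l - 1) Z n

theorem unroll2 (φ : ℤ → ℤ → ℝ) (hφ : ∀ m n, 0 ≤ φ m n) (hφ' : ∀ m n, n < 0 → φ m n = 0) (T : ℕ → ℕ → ℤ → ℤ → ENNReal)
    (hT0 : ∀ l x A, T 0 l x A = if A = 0 then 1 else 0)
    (hT : ∀ j l x A, T (j + 1) l x A = ∑' N : ℤ, oR (φ (2 * A - l) (x - N)) * (oR (q ^ (N ^ 2 - eps l * N)) * T j (l - 1) N (A - N)))
    (j l s : ℕ) (A : ℤ) (hl : l ≤ j + 1) :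
    ∑' N : ℤ, oR (q ^ (N ^ 2 - (eps l + s) * N)) * T j (l - 1) N (A - N) =
    ∑' n : Fin j → ℕ, if ((j + 1 : ℕ) : ℤ) ∣ A - (sm n + Dp n) then
      oR (q ^ EX l s ((A - (sm n + Dp n)) / ((j + 1 : ℕ) : ℤ)) n *
        ∏ i, φ (mu (l - 1) (A - ((A - (sm n + Dp n)) / ((j + 1 : ℕ) : ℤ) + sm n)) ((A - (sm n + Dp n)) / ((j + 1 : ℕ) : ℤ)) n i) (n i)) else 0 := by
  have h0 := hq.out.1
  have e : ∀ N : ℤ, oR (q ^ (N ^ 2 - (eps l + s) * N)) * T j (l - 1) N (A - N) = ∑' n : Fin j → ℕ,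
      if j * (N - sm n) + Dp n = A - N then
      oR (q ^ (N ^ 2 - (eps l + s) * N) * (q ^ exI (l - 1) (N - sm n) n * ∏ i, φ (mu (l - 1) (A - N) (N - sm n) n i) (n i))) else 0 := by
    intro N
    rw [unroll φ hφ hφ' T hT0 hT j _ _ _ (by omega), ← ENNReal.tsum_mul_left]
    refine tsum_congr fun n => ?_
    split_ifs
    · rw [← oR_mul (by positivity)]
    · simp
  simp_rw [e]
  rw [ENNReal.tsum_comm]
  refine tsum_congr fun n => ?_
  rw [← tsum_shift _ (sm n)]
  have hc : ∀ Z : ℤ, ((j : ℤ) * (Z + sm n - sm n) + Dp n = A - (Z + sm n)) ↔ ((j + 1 : ℕ) : ℤ) * Z = A - (sm n + Dp n) := by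
    intro Z; push_cast
    constructor <;> intro h <;> linarith
  simp only [hc]
  simp only [add_sub_cancel_right]
  split_ifs with h
  · obtain ⟨Z, hZ⟩ := h
    rw [hZ, Int.mul_ediv_cancel_left _ (by omega)]
    rw [tsum_eq_single Z]
    · rw [if_pos rfl, EX, zpow_add₀ h0.ne', mul_assoc]
    · intro b hb
      rw [if_neg]
      intro h
      exact hb (mul_left_cancel₀ (by omega) h)
  · rw [ENNReal.tsum_eq_zero]
    intro Z
    rw [if_neg]
    exact fun hh => h ⟨Z, hh.symm⟩

end
end GP
end

section
namespace GP
open Filter Topology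

theorem sum_D {j : ℕ} (n : Fin j → ℕ) : ∑ i : Fin j, ((i : ℤ) + 1) * (n i : ℤ) = sm n + Dp n := by
  rw [sm, Dp, ← Finset.sum_add_distrib]
  exact Finset.sum_congr rfl fun i _ => by ring

theorem mvec_eV (j l : ℕ) (hl : l ≤ j + 1) (i : Fin j) :
    mvec (j + 1) (eV (j + 1) l) i = ((min ((i : ℤ) + 1) l : ℤ) : ℚ) - ((i : ℚ) + 1) * l / ((j : ℚ) + 1) := by
  have hk : ((j : ℚ) + 1) ≠ 0 := by positivity
  have hi := i.isLt
  by_cases h : l = 0 ∨ l = j + 1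
  · have z : mvec (j + 1) (eV (j + 1) l) i = 0 := by
      refine Finset.sum_eq_zero fun i' _ => ?_
      have hi' : (i' : ℕ) < j := i'.isLt
      simp only [eV]
      rw [if_neg (by omega)]; simp
    rw [z]
    rcases h with rfl | rfl
    · rw [show min ((i : ℤ) + 1) ((0 : ℕ) : ℤ) = 0 by omega]; simp
    · rw [show min ((i : ℤ) + 1) ((j + 1 : ℕ) : ℤ) = (i : ℤ) + 1 by omega]
      push_cast; field_simp; ring
  · have hl' : l - 1 < j + 1 - 1 := by omega
    have : mvec (j + 1) (eV (j + 1) l) i = cinv (j + 1) i (l - 1) := by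
      unfold mvec
      rw [Finset.sum_eq_single (⟨l - 1, hl'⟩ : Fin (j + 1 - 1))]
      · simp only [eV]; rw [if_pos (by show ((l - 1 : ℕ) : ℤ) + 1 = l; omega)]; simp
      · intro b _ hb
        simp only [eV]; rw [if_neg]
        · simp
        · intro hc; apply hb; ext; simp; omega
      · intro h; exact absurd (Finset.mem_univ _) h
    rw [this, cinv]
    have e : (((l - 1 : ℕ) : ℚ)) + 1 = l := by
      have : l - 1 + 1 = l := by omega
      exact_mod_cast this
    rw [e]; push_cast; ring

theorem mvec_n {j : ℕ} (n : Fin j → ℕ) (i : Fin j) :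
    mvec (j + 1) (fun i : Fin (j + 1 - 1) => (n i : ℤ)) i =
      ((sm n + ∑ i' : Fin j, min (i : ℤ) (i' : ℤ) * n i' : ℤ) : ℚ) - ((i : ℚ) + 1) * ((sm n + Dp n : ℤ) : ℚ) / ((j : ℚ) + 1) := by
  unfold mvec sm Dp
  push_cast
  rw [← Finset.sum_add_distrib, ← Finset.sum_add_distrib, Finset.mul_sum, Finset.sum_div, ← Finset.sum_sub_distrib]
  refine Finset.sum_congr rfl fun i' _ => ?_
  rw [cinv, min_add_add_right]
  push_cast
  ring

theorem mvec_comb {k : ℕ} (a b : ℤ) (u v w : Fin (k - 1) → ℤ) (i : Fin (k - 1)) :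
    mvec k (a • u + v - b • w) i = a * mvec k u i + mvec k v i - b * mvec k w i := by
  unfold mvec
  rw [Finset.mul_sum, Finset.mul_sum, ← Finset.sum_add_distrib, ← Finset.sum_sub_distrib]
  refine Finset.sum_congr rfl fun i' _ => ?_
  simp; ring

theorem mvec_comb2 {k : ℕ} (a : ℤ) (u v w : Fin (k - 1) → ℤ) (i : Fin (k - 1)) :
    mvec k (w - a • u - v) i = mvec k w i - a * mvec k u i - mvec k v i := by
  unfold mvec
  rw [Finset.mul_sum, ← Finset.sum_sub_distrib, ← Finset.sum_sub_distrib]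
  refine Finset.sum_congr rfl fun i' _ => ?_
  simp; ring

theorem quad_mvec (k : ℕ) (w v : Fin (k - 1) → ℤ) : quad k w v = ∑ i, (w i : ℚ) * mvec k v i := by
  unfold quad mvec
  refine Finset.sum_congr rfl fun i _ => ?_
  rw [Finset.mul_sum]
  exact Finset.sum_congr rfl fun i' _ => by ring

theorem L1_eq {j : ℕ} (l : ℕ) (n : Fin j → ℕ) : ∑ i : Fin j, (n i : ℤ) * min ((i : ℤ) + 1) l = eps l * sm n + Lp (l - 1) n := by
  rcases l with _ | l
  · simp only [eps, if_true, Nat.zero_sub, Lp_zero, zero_mul, add_zero]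
    refine Finset.sum_eq_zero fun i _ => ?_
    rw [show min ((i : ℤ) + 1) ((0 : ℕ) : ℤ) = 0 by omega, mul_zero]
  · rw [eps, if_neg (by omega), one_mul, sm, Lp, ← Finset.sum_add_distrib]
    refine Finset.sum_congr rfl fun i _ => ?_
    rw [show min ((i : ℤ) + 1) ((l + 1 : ℕ) : ℤ) = 1 + min (i : ℤ) ((l + 1 - 1 : ℕ) : ℤ) by omega]
    ring

theorem quad_eq {j : ℕ} (l s : ℕ) (hl : l ≤ j + 1) (n : Fin j → ℕ) (A Z : ℤ) (hZ : A - (sm n + Dp n) = ((j + 1 : ℕ) : ℤ) * Z) :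
    quad (j + 1) (fun i : Fin (j + 1 - 1) => (n i : ℤ)) ((fun i : Fin (j + 1 - 1) => (n i : ℤ)) - (s : ℤ) • eV (j + 1) 1 - eV (j + 1) l) =
      (EX l s Z n : ℚ) - (A : ℚ) * (A - l - s) / ((j : ℚ) + 1) := by
  have hk : ((j : ℚ) + 1) ≠ 0 := by positivity
  rw [quad_mvec]
  have e : ∀ i : Fin j, (((n i : ℕ) : ℤ) : ℚ) * mvec (j + 1) ((fun i : Fin (j + 1 - 1) => (n i : ℤ)) - (s : ℤ) • eV (j + 1) 1 - eV (j + 1) l) i =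
      (n i : ℚ) * ((sm n : ℤ) : ℚ) + ((n i * ∑ i' : Fin j, min (i : ℤ) (i' : ℤ) * n i' : ℤ) : ℚ)
      - (((i : ℤ) + 1) * n i : ℤ) * (((sm n + Dp n : ℤ) : ℚ) / ((j : ℚ) + 1)) - s * n i
      + (((i : ℤ) + 1) * n i : ℤ) * ((s + l) / ((j : ℚ) + 1)) - (((n i : ℤ) * min ((i : ℤ) + 1) l : ℤ) : ℚ) := by
    intro i
    have h1 := mvec_eV j 1 (by omega) i
    have h2 := mvec_eV j l hl i
    have h3 := mvec_n n i
    rw [show min ((i : ℤ) + 1) ((1 : ℕ) : ℤ) = 1 by omega] at h1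
    rw [mvec_comb2]
    rw [Nat.cast_one] at h1
    rw [h1, h2, h3]
    push_cast; ring
  have e' : ∑ i : Fin (j + 1 - 1), (((n i : ℕ) : ℤ) : ℚ) * mvec (j + 1) ((fun i : Fin (j + 1 - 1) => (n i : ℤ)) - (s : ℤ) • eV (j + 1) 1 - eV (j + 1) l) i =
    ∑ i : Fin j, (((n i : ℕ) : ℤ) : ℚ) * mvec (j + 1) ((fun i : Fin (j + 1 - 1) => (n i : ℤ)) - (s : ℤ) • eV (j + 1) 1 - eV (j + 1) l) i := rfl
  rw [e', Finset.sum_congr rfl (fun i _ => e i)]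
  simp only [Finset.sum_add_distrib, Finset.sum_sub_distrib, ← Finset.sum_mul, ← Finset.mul_sum]
  simp only [← Int.cast_sum]
  rw [L1_eq, sum_D]
  have e1 : ∑ i : Fin j, (n i : ℚ) = ((sm n : ℤ) : ℚ) := by rw [sm]; push_cast; rfl
  have e2 : ∑ i : Fin j, ((n i : ℤ) * ∑ i' : Fin j, min (i : ℤ) (i' : ℤ) * n i') = Mp n := by
    rw [Mp]
    refine Finset.sum_congr rfl fun i _ => ?_
    rw [Finset.mul_sum]
    exact Finset.sum_congr rfl fun i' _ => by ring
  have e3 : ((l - 1 : ℕ) : ℤ) = l - eps l := by rw [eps_sub]; ring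
  rw [e1, e2, EX, exI, e3]
  have hA : (A : ℚ) = (sm n + Dp n : ℤ) + ((j : ℚ) + 1) * Z := by
    have : A = (sm n + Dp n) + ((j : ℤ) + 1) * Z := by push_cast at hZ; linarith
    rw [this]; push_cast; ring
  rw [hA]
  push_cast
  field_simp
  ring

theorem mvec_mu {j : ℕ} (l s : ℕ) (hl : l ≤ j + 1) (n : Fin j → ℕ) (A Z t : ℤ) (hZ : A - (sm n + Dp n) = ((j + 1 : ℕ) : ℤ) * Z)
    (ht : t = 2 * A - l) (i : Fin j) :
    mvec (j + 1) (t • eV (j + 1) 1 + eV (j + 1) l - (2 : ℤ) • (fun i : Fin (j + 1 - 1) => (n i : ℤ))) i = (mu (l - 1) (A - (Z + sm n)) Z n i : ℚ) := by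
  have hk : ((j : ℚ) + 1) ≠ 0 := by positivity
  have h1 := mvec_eV j 1 (by omega) i
  have h2 := mvec_eV j l hl i
  have h3 := mvec_n n i
  rw [show min ((i : ℤ) + 1) ((1 : ℕ) : ℤ) = 1 by omega] at h1
  rw [mvec_comb]
  rw [Nat.cast_one] at h1
  rw [h1, h2, h3, mu, show min ((i : ℤ) + 1) (l : ℤ) = l - ((l - 1 - i : ℕ) : ℤ) by omega, ht]
  have hA : (A : ℚ) = (sm n + Dp n : ℤ) + ((j : ℚ) + 1) * Z := by
    have : A = (sm n + Dp n) + ((j : ℤ) + 1) * Z := by push_cast at hZ; linarith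
    rw [this]; push_cast; ring
  generalize ((l - 1 - i : ℕ) : ℤ) = w
  push_cast
  rw [hA]
  push_cast
  field_simp
  ring

section
variable {q : ℝ} [hq : Fact (0 < q ∧ q < 1)]

theorem qBinQ_eq (n : ℕ) (m : ℤ) : qBinQ q ((n : ℚ) + (m : ℚ)) (n : ℚ) = qB q (n + m) n := by
  have e : (n : ℚ) + (m : ℚ) = ((n + m : ℤ) : ℚ) := by push_cast; ring
  have e2 : (n : ℚ) = ((n : ℤ) : ℚ) := by push_cast; ring
  rw [e, qBinQ]
  by_cases h : 0 ≤ m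
  · obtain ⟨p, rfl⟩ := Int.eq_ofNat_of_zero_le h
    rw [if_pos]
    · rw [qB, show (n : ℤ) + p = ((n + p : ℕ) : ℤ) by push_cast; ring, invQ_nat, invQ_nat, inv_inv,
        show ((n + p : ℕ) : ℤ) - n = (p : ℕ) by push_cast; ring, invQ_nat, Rat.num_intCast, Rat.num_natCast,
        show ((n + p : ℕ) : ℤ) - n = (p : ℕ) by push_cast; ring]
      simp only [Int.toNat_natCast]
      ring
    · refine ⟨Rat.den_intCast _, Rat.den_natCast _, by positivity, ?_⟩
      push_cast; linarith [(by positivity : (0 : ℚ) ≤ p)]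
  · rw [if_neg, qB_lt (by omega)]
    rintro ⟨-, -, -, hc⟩
    have : (n : ℤ) ≤ n + m := by exact_mod_cast hc
    omega

end
end GP
end

section
namespace GP
open Filter Topology

def Ft (q : ℝ) (k : ℕ) (ℓ r : ℤ) (x : ℕ × (Fin (k - 1) → ℕ)) : ℝ :=
  if (2 * (k : ℤ)) ∣ (r + ℓ + (x.1 : ℤ) - 2 * ∑ i : Fin (k-1), ((i : ℤ) + 1) * (x.2 i : ℤ)) then
        q ^ ( (((r - ℓ - (x.1 : ℤ)) * (r + ℓ + (x.1 : ℤ)) : ℤ) : ℝ) / (4 * (k : ℝ))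
            + ((ch2 ((x.1 : ℤ) + 1) : ℤ) : ℝ)
            + ((quad k (fun i => (x.2 i : ℤ))
                ((fun i => (x.2 i : ℤ)) - (x.1 : ℤ) • eV k 1 - eV k ℓ) : ℚ) : ℝ) )
          * ((qP q q x.1)⁻¹ * ∏ i, (qP q q (x.2 i))⁻¹)
      else 0

def St (q : ℝ) (k : ℕ) (ℓ r : ℤ) (x : ℕ × ℕ × (Fin (k - 1) → ℕ)) : ℝ :=
      if (2 * (k : ℤ)) ∣ (2 * (x.1 : ℤ) + r + ℓ + (x.2.1 : ℤ)
          - 2 * ∑ i : Fin (k-1), ((i : ℤ) + 1) * (x.2.2 i : ℤ)) then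
        q ^ ( ((x.1 : ℝ) * ((x.1 : ℝ) + (r : ℝ))) / (k : ℝ)
            + (((r - ℓ - (x.2.1 : ℤ)) * (r + ℓ + (x.2.1 : ℤ)) : ℤ) : ℝ) / (4 * (k : ℝ))
            + ((ch2 ((x.2.1 : ℤ) + 1) : ℤ) : ℝ)
            + ((quad k (fun i => (x.2.2 i : ℤ))
                ((fun i => (x.2.2 i : ℤ)) - (x.2.1 : ℤ) • eV k 1 - eV k ℓ) : ℚ) : ℝ) )
          * ((qP q q x.1)⁻¹ * invQ q ((x.1 : ℤ) + r) * (qP q q x.2.1)⁻¹)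
          * ∏ i, qBinQ q ((x.2.2 i : ℚ) +
              mvec k ((2 * (x.1 : ℤ) + r + (x.2.1 : ℤ)) • eV k 1 + eV k ℓ
                - (2 : ℤ) • (fun i => (x.2.2 i : ℤ))) i)
              (x.2.2 i : ℚ)
      else 0

theorem par_sum (g : ℤ → ENNReal) (s A' : ℤ) :
    ∑' A : ℤ, (if 2 * A - s = A' then g A else 0) = if (2 : ℤ) ∣ A' + s then g ((A' + s) / 2) else 0 := by
  split_ifs with h
  · rw [tsum_eq_single ((A' + s) / 2)]
    · rw [if_pos (by omega)]
    · intro b hb; rw [if_neg (by omega)]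
  · rw [ENNReal.tsum_eq_zero]
    intro A; rw [if_neg (by omega)]

theorem dvd_iff (k A D x : ℤ) (hx : x = 2 * A) : 2 * k ∣ x - 2 * D ↔ k ∣ A - D := by
  rw [hx, ← mul_sub]; exact mul_dvd_mul_iff_left (by norm_num)

theorem not_dvd (k D x : ℤ) (hx : ¬ (2 : ℤ) ∣ x) : ¬ 2 * k ∣ x - 2 * D := by
  rintro ⟨c, hc⟩
  exact hx ⟨k * c + D, by linarith⟩

theorem expo {j : ℕ} (l s : ℕ) (hl : l ≤ j + 1) (n : Fin j → ℕ) (A Z r L : ℤ) (hA : 2 * L + r + l + s = 2 * A)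
    (hZ : A - (sm n + Dp n) = ((j + 1 : ℕ) : ℤ) * Z) :
    ((L : ℝ) * ((L : ℝ) + (r : ℝ))) / ((j + 1 : ℕ) : ℝ) + (((r - (l : ℤ) - (s : ℤ)) * (r + (l : ℤ) + (s : ℤ)) : ℤ) : ℝ) / (4 * ((j + 1 : ℕ) : ℝ))
            + ((ch2 ((s : ℤ) + 1) : ℤ) : ℝ)
            + ((quad (j + 1) (fun i : Fin (j + 1 - 1) => (n i : ℤ))
                ((fun i : Fin (j + 1 - 1) => (n i : ℤ)) - (s : ℤ) • eV (j + 1) 1 - eV (j + 1) l) : ℚ) : ℝ)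
     = ((((s + 1).choose 2 : ℕ) + EX l s Z n : ℤ) : ℝ) := by
  have hk : ((j : ℝ) + 1) ≠ 0 := by positivity
  rw [quad_eq l s hl n A Z hZ]
  have h1 : ch2 ((s : ℤ) + 1) = ((s + 1).choose 2 : ℕ) := by
    rw [← ch2_nat]; push_cast; rfl
  rw [h1]
  have hr : (r : ℝ) = 2 * A - l - s - 2 * L := by
    have : r = 2 * A - l - s - 2 * L := by linarith
    rw [this]; push_cast; ring
  push_cast
  rw [hr]
  field_simp
  ring

section
variable {q : ℝ} [hq : Fact (0 < q ∧ q < 1)]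

theorem Ftot_eq (j l : ℕ) (A' : ℤ) : Ftot q j l A' =
    ∑' s : ℕ, if (2 : ℤ) ∣ A' + s then oR (q ^ ((s + 1).choose 2) * invQ q s) * FF q j l s ((A' + s) / 2) else 0 := by
  rw [Ftot, grp, ENNReal.tsum_prod']
  refine tsum_congr fun s => ?_
  exact par_sum (fun A => oR (q ^ ((s + 1).choose 2) * invQ q s) * FF q j l s A) s A'

theorem Ftot_refl (j l : ℕ) (hl : l ≤ j + 1) (A' : ℤ) : Ftot q j l A' = Ftot q j l (2 * l - A') := by
  rw [Ftot_eq, Ftot_eq]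
  refine tsum_congr fun s => ?_
  by_cases h : (2 : ℤ) ∣ A' + s
  · rw [if_pos h, if_pos (by omega), FF_refl j l s hl, show (2 * (l : ℤ) - A' + s) / 2 = l + s - (A' + s) / 2 by omega]
  · rw [if_neg h, if_neg (by omega)]

theorem Ft_nonneg (k : ℕ) (ℓ r : ℤ) (x) : 0 ≤ Ft q k ℓ r x := by
  have h0 := hq.out.1
  unfold Ft
  split_ifs
  · have h := fun n => (qP_pos (q := q) n).le
    exact mul_nonneg (Real.rpow_nonneg h0.le _) (mul_nonneg (inv_nonneg.2 (h _)) (Finset.prod_nonneg fun i _ => inv_nonneg.2 (h _)))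
  · exact le_rfl

theorem qBinQ_nonneg (a b : ℚ) : 0 ≤ qBinQ q a b := by
  have h := fun n => (qP_pos (q := q) n).le
  unfold qBinQ
  split_ifs
  · exact mul_nonneg (h _) (mul_nonneg (inv_nonneg.2 (h _)) (inv_nonneg.2 (h _)))
  · exact le_rfl

theorem St_nonneg (k : ℕ) (ℓ r : ℤ) (x) : 0 ≤ St q k ℓ r x := by
  have h0 := hq.out.1
  unfold St
  split_ifs
  · have h := fun n => (qP_pos (q := q) n).le
    exact mul_nonneg (mul_nonneg (Real.rpow_nonneg h0.le _) (mul_nonneg (mul_nonneg (inv_nonneg.2 (h _)) (invQ_nonneg _)) (inv_nonneg.2 (h _)))) (Finset.prod_nonneg fun i _ => qBinQ_nonneg _ _)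
  · exact le_rfl

theorem Ft_eq (j l s : ℕ) (hl : l ≤ j + 1) (n : Fin j → ℕ) (A r : ℤ) (hA : r + l + s = 2 * A) :
    oR (Ft q (j + 1) l r (s, n)) = oR (q ^ ((s + 1).choose 2) * invQ q s) *
     (if ((j + 1 : ℕ) : ℤ) ∣ A - (sm n + Dp n) then
      oR (q ^ EX l s ((A - (sm n + Dp n)) / ((j + 1 : ℕ) : ℤ)) n * ∏ i, invQ q (n i)) else 0) := by
  have h0 := hq.out.1
  have hd := dvd_iff ((j + 1 : ℕ) : ℤ) A (sm n + Dp n) (r + l + s) hA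
  rw [← sum_D] at hd
  rw [Ft]
  by_cases h : ((j + 1 : ℕ) : ℤ) ∣ A - (sm n + Dp n)
  · have h' := h
    rw [← sum_D] at h'
    rw [if_pos h]
    refine (congrArg oR (if_pos (hd.2 h'))).trans ?_
    obtain ⟨Z, hZ⟩ := h
    rw [hZ, Int.mul_ediv_cancel_left _ (by omega)]
    have he := expo l s hl n A Z r 0 (by linarith) hZ
    rw [Int.cast_zero, zero_mul, zero_div, zero_add] at he
    rw [← oR_mul (mul_nonneg (by positivity) (invQ_nonneg _))]
    congr 1
    refine (congrArg₂ (· * ·) (congrArg (fun z => q ^ z) he) rfl).trans ?_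
    simp only []
    rw [Real.rpow_intCast, zpow_add₀ h0.ne', zpow_natCast, invQ_nat]
    simp only [invQ_nat]
    ring_nf
    rfl
  · have h' := h
    rw [← sum_D] at h'
    rw [if_neg h]
    refine (congrArg oR (if_neg (fun hh => h' (hd.1 hh)))).trans ?_
    simp [oR]

theorem St_eq (j l s L : ℕ) (hl : l ≤ j + 1) (n : Fin j → ℕ) (A r : ℤ) (hA : 2 * L + r + l + s = 2 * A) :
    oR (St q (j + 1) l r (L, s, n)) = oR (q ^ ((s + 1).choose 2) * invQ q s) * (oR (invQ q L) * oR (invQ q (L + r)) *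
     (if ((j + 1 : ℕ) : ℤ) ∣ A - (sm n + Dp n) then
      oR (q ^ EX l s ((A - (sm n + Dp n)) / ((j + 1 : ℕ) : ℤ)) n * ∏ i, 
       qB q (n i + mu (l - 1) (A - ((A - (sm n + Dp n)) / ((j + 1 : ℕ) : ℤ) + sm n)) ((A - (sm n + Dp n)) / ((j + 1 : ℕ) : ℤ)) n i) (n i)) else 0)) := by
  have h0 := hq.out.1
  have hd := dvd_iff ((j + 1 : ℕ) : ℤ) A (sm n + Dp n) (2 * L + r + l + s) hA
  rw [← sum_D] at hd
  rw [St]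
  by_cases h : ((j + 1 : ℕ) : ℤ) ∣ A - (sm n + Dp n)
  · have h' := h
    rw [← sum_D] at h'
    rw [if_pos h]
    refine (congrArg oR (if_pos (hd.2 h'))).trans ?_
    obtain ⟨Z, hZ⟩ := h
    rw [hZ, Int.mul_ediv_cancel_left _ (by omega)]
    have he := expo l s hl n A Z r L hA hZ
    rw [Int.cast_natCast] at he
    rw [← oR_mul (invQ_nonneg _), ← oR_mul (mul_nonneg (invQ_nonneg _) (invQ_nonneg _)), ← oR_mul (mul_nonneg (by positivity) (invQ_nonneg _))]
    congr 1
    have hp : ∀ i : Fin (j + 1 - 1), qBinQ q ((n i : ℚ) +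
              mvec (j + 1) ((2 * (L : ℤ) + r + (s : ℤ)) • eV (j + 1) 1 + eV (j + 1) l
                - (2 : ℤ) • (fun i : Fin (j + 1 - 1) => (n i : ℤ))) i)
              (n i : ℚ) = qB q (n i + mu (l - 1) (A - (Z + sm n)) Z n i) (n i) := by
      intro i
      rw [mvec_mu l s hl n A Z _ hZ (by linarith) i, qBinQ_eq]
    refine (congrArg₂ (· * ·) (congrArg₂ (· * ·) (congrArg (fun z => q ^ z) he) rfl) (Finset.prod_congr rfl fun i _ => hp i)).trans ?_
    simp only []
    rw [Real.rpow_intCast, zpow_add₀ h0.ne', zpow_natCast, invQ_nat, invQ_nat]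
    ring_nf
    rfl
  · have h' := h
    rw [← sum_D] at h'
    rw [if_neg h]
    refine (congrArg oR (if_neg (fun hh => h' (hd.1 hh)))).trans ?_
    simp [oR]

theorem FF_unroll (j l s : ℕ) (hl : l ≤ j + 1) (A : ℤ) : FF q j l s A = ∑' n : Fin j → ℕ,
     (if ((j + 1 : ℕ) : ℤ) ∣ A - (sm n + Dp n) then
      oR (q ^ EX l s ((A - (sm n + Dp n)) / ((j + 1 : ℕ) : ℤ)) n * ∏ i, invQ q (n i)) else 0) := by
  exact unroll2 (fun _ n => invQ q n) (fun _ n => invQ_nonneg n) (fun _ n h => invQ_neg h) (R q) (fun _ _ _ => rfl)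
    (fun _ _ _ _ => rfl) j l s A hl

theorem W_unroll (j l s : ℕ) (hl : l ≤ j + 1) (A : ℤ) : ∑' N : ℤ, oR (q ^ (-(s * N) : ℤ)) * W q j l A N = ∑' n : Fin j → ℕ,
     (if ((j + 1 : ℕ) : ℤ) ∣ A - (sm n + Dp n) then
      oR (q ^ EX l s ((A - (sm n + Dp n)) / ((j + 1 : ℕ) : ℤ)) n * ∏ i, 
       qB q (n i + mu (l - 1) (A - ((A - (sm n + Dp n)) / ((j + 1 : ℕ) : ℤ) + sm n)) ((A - (sm n + Dp n)) / ((j + 1 : ℕ) : ℤ)) n i) (n i)) else 0) := by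
  have h0 := hq.out.1
  rw [← unroll2 (q := q) (fun m n => qB q (n + m) n) (fun _ n => qB_nonneg _ _) (fun _ n h => qB_neg h) (H q) (fun _ _ _ => rfl)
    (fun j l x A => tsum_congr fun N => by rw [add_sub_assoc]) j l s A hl]
  refine tsum_congr fun N => ?_
  rw [W, ← mul_assoc, ← oR_mul (by positivity), ← zpow_add₀ h0.ne']
  congr 3
  ring

theorem F_sum (j l : ℕ) (hl : l ≤ j + 1) (r : ℤ) : ∑' x, Ft q (j + 1) l r x = (Ftot q j l (r + l)).toReal := by
  rw [tsum_oR (Ft_nonneg _ _ _), Ftot_eq, ENNReal.tsum_prod']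
  congr 1
  refine tsum_congr fun s => ?_
  split_ifs with h
  · rw [FF_unroll j l s hl, ← ENNReal.tsum_mul_left]
    exact tsum_congr fun n => Ft_eq j l s hl n _ r (by omega)
  · rw [ENNReal.tsum_eq_zero]
    intro n
    rw [Ft, if_neg (not_dvd _ _ _ h)]
    simp [oR]

theorem S_sum (j l : ℕ) (hl : l ≤ j + 1) (r : ℤ) : qPInf q q * ∑' x, St q (j + 1) l r x = (Ftot q j l (r + l)).toReal := by
  have hP : 0 < qPInf q q := qPInf_pos
  rw [tsum_oR (St_nonneg _ _ _), Ftot_eq, ENNReal.tsum_prod']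
  rw [← oR_toReal hP.le, ← ENNReal.toReal_mul]
  congr 1
  simp_rw [ENNReal.tsum_prod']
  rw [ENNReal.tsum_comm, ← ENNReal.tsum_mul_left]
  refine tsum_congr fun s => ?_
  split_ifs with h
  · rw [← SS_FF j l s _ hl, SS]
    obtain ⟨A0, hA0⟩ := h
    rw [hA0, Int.mul_ediv_cancel_left _ (by norm_num), ← tsum_shift _ A0, tsum_int_natE]
    · rw [mul_left_comm]
      congr 1
      rw [← ENNReal.tsum_mul_left]
      refine tsum_congr fun L => ?_
      rw [W_unroll j l s hl, ← ENNReal.tsum_mul_left, ← ENNReal.tsum_mul_left]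
      refine tsum_congr fun n => ?_
      rw [show (L : ℤ) + A0 - A0 = L by ring, show (L : ℤ) + A0 - (l + s - A0) = L + r by linarith]
      exact St_eq j l s L hl n _ r (by linarith)
    · intro n hn
      rw [show n + A0 - A0 = n by ring, invQ_neg hn]
      simp [oR]
  · rw [mul_eq_zero]; right
    rw [ENNReal.tsum_eq_zero]
    intro L
    rw [ENNReal.tsum_eq_zero]
    intro n
    rw [St, if_neg (not_dvd _ _ _ _)]
    · simp [oR]
    · show ¬ (2 : ℤ) ∣ 2 * (L : ℤ) + r + l + s
      omega

theorem B_sum (j l : ℕ) (hl : l ≤ j + 1) (r : ℤ) : ∑' i : ℤ,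
      q ^ (((i * ((2 * ((j + 1 : ℕ) : ℤ) + 3) * i + 2 * (l : ℤ) + 1) : ℤ) : ℝ) / 2) *
        (V q (r - (l : ℤ) - (2 * ((j + 1 : ℕ) : ℤ) + 3) * i) - V q (r + (l : ℤ) + 1 + (2 * ((j + 1 : ℕ) : ℤ) + 3) * i)) = (Ftot q j l (r + l)).toReal := by
  rw [Ftot_refl j l hl, show 2 * (l : ℤ) - (r + l) = l - r by ring, ← (boson (q := q) j l hl (l - r)).tsum_eq]
  refine tsum_congr fun i => ?_
  have h2 := ch2_two (i + 1)
  have e : (((i * ((2 * ((j + 1 : ℕ) : ℤ) + 3) * i + 2 * (l : ℤ) + 1) : ℤ) : ℝ) / 2) = ((B2 (j + 1) l i : ℤ) : ℝ) := by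
    rw [div_eq_iff (by norm_num)]
    have : (i * ((2 * ((j + 1 : ℕ) : ℤ) + 3) * i + 2 * (l : ℤ) + 1) : ℤ) = B2 (j + 1) l i * 2 := by
      rw [B2]; push_cast; linear_combination -h2
    exact_mod_cast this
  rw [e, Real.rpow_intCast]
  refine congrArg₂ (· * ·) rfl (congrArg₂ (· - ·) (congrArg (V q) ?_) (congrArg (V q) ?_))
  · push_cast; ring
  · push_cast; ring

end
end GP
end

/-- Equality of the bosonic, spinon and fermionic forms of the graded parafermion characters. -/
theorem graded_parafermion_B_eq_S_eq_F
    (k : ℕ) (hk : 1 ≤ k) (ℓ : ℤ) (hℓ0 : 0 ≤ ℓ) (hℓk : ℓ ≤ (k : ℤ)) (r : ℤ)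
    (q : ℝ) (hq0 : 0 < q) (hq1 : q < 1)
    (B S F : ℝ)
    (hB : B = ∑' j : ℤ,
      q ^ (((j * ((2 * (k : ℤ) + 3) * j + 2 * ℓ + 1) : ℤ) : ℝ) / 2) *
        (V q (r - ℓ - (2 * (k : ℤ) + 3) * j) - V q (r + ℓ + 1 + (2 * (k : ℤ) + 3) * j)))
    (hS : S = qPInf q q * ∑' x : ℕ × ℕ × (Fin (k - 1) → ℕ),
      if (2 * (k : ℤ)) ∣ (2 * (x.1 : ℤ) + r + ℓ + (x.2.1 : ℤ)
          - 2 * ∑ i : Fin (k-1), ((i : ℤ) + 1) * (x.2.2 i : ℤ)) then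
        q ^ ( ((x.1 : ℝ) * ((x.1 : ℝ) + (r : ℝ))) / (k : ℝ)
            + (((r - ℓ - (x.2.1 : ℤ)) * (r + ℓ + (x.2.1 : ℤ)) : ℤ) : ℝ) / (4 * (k : ℝ))
            + ((ch2 ((x.2.1 : ℤ) + 1) : ℤ) : ℝ)
            + ((quad k (fun i => (x.2.2 i : ℤ))
                ((fun i => (x.2.2 i : ℤ)) - (x.2.1 : ℤ) • eV k 1 - eV k ℓ) : ℚ) : ℝ) )
          * ((qP q q x.1)⁻¹ * invQ q ((x.1 : ℤ) + r) * (qP q q x.2.1)⁻¹)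
          * ∏ i, qBinQ q ((x.2.2 i : ℚ) +
              mvec k ((2 * (x.1 : ℤ) + r + (x.2.1 : ℤ)) • eV k 1 + eV k ℓ
                - (2 : ℤ) • (fun i => (x.2.2 i : ℤ))) i)
              (x.2.2 i : ℚ)
      else 0)
    (hF : F = ∑' x : ℕ × (Fin (k - 1) → ℕ),
      if (2 * (k : ℤ)) ∣ (r + ℓ + (x.1 : ℤ) - 2 * ∑ i : Fin (k-1), ((i : ℤ) + 1) * (x.2 i : ℤ)) then
        q ^ ( (((r - ℓ - (x.1 : ℤ)) * (r + ℓ + (x.1 : ℤ)) : ℤ) : ℝ) / (4 * (k : ℝ))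
            + ((ch2 ((x.1 : ℤ) + 1) : ℤ) : ℝ)
            + ((quad k (fun i => (x.2 i : ℤ))
                ((fun i => (x.2 i : ℤ)) - (x.1 : ℤ) • eV k 1 - eV k ℓ) : ℚ) : ℝ) )
          * ((qP q q x.1)⁻¹ * ∏ i, (qP q q (x.2 i))⁻¹)
      else 0) :
    B = S ∧ S = F := by
  obtain ⟨j, rfl⟩ : ∃ j, k = j + 1 := ⟨k - 1, by omega⟩
  lift ℓ to ℕ using hℓ0 with l
  have hl : l ≤ j + 1 := by exact_mod_cast hℓk
  haveI : Fact (0 < q ∧ q < 1) := ⟨hq0, hq1⟩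
  have h1 : B = (GP.Ftot q j l (r + l)).toReal := hB.trans (GP.B_sum j l hl r)
  have h2 : S = (GP.Ftot q j l (r + l)).toReal := hS.trans (GP.S_sum j l hl r)
  have h3 : F = (GP.Ftot q j l (r + l)).toReal := hF.trans (GP.F_sum j l hl r)
  exact ⟨h1.trans h2.symm, h2.trans h3.symm⟩
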